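/- Let K be a number field, m ≥ 5, and a₁, …, a_m ∈ Kˣ. Then the quadratic form a₁x₁² + ⋯ + a_mx_m² has no nontrivial zero over K if and only if there exists a ring embedding σ : K → ℝ such that σ(a₁), …, σ(a_m) are all positive or all negative. -/

import Mathlib

section PartP0
open NumberField Module

namespace HM

variable (K : Type*) [Field K] [NumberField K]

abbrev Idx := Module.Free.ChooseBasisIndex ℤ (𝓞 K)

noncomputable abbrev bs : Basis (Idx K) ℤ (𝓞 K) := RingOfIntegers.basis K

variable {K}

/-- integral coordinates -/
noncomputable def co (x : 𝓞 K) (j : Idx K) : ℤ := (bs K).repr x j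

/-- element with given coordinates -/
noncomputable def el (z : Idx K → ℤ) : 𝓞 K := ∑ j, z j • bs K j

/-- pairing with a real functional -/
noncomputable def pr (ξ : Idx K → ℝ) (x : 𝓞 K) : ℝ := ∑ j, ξ j * (co x j : ℝ)

/-- action of integers on functionals -/
noncomputable def act (x : 𝓞 K) (ξ : Idx K → ℝ) : Idx K → ℝ := fun j => pr ξ (x * bs K j)

theorem el_co (x : 𝓞 K) : el (co x) = x := (bs K).sum_repr x

theorem co_el (z : Idx K → ℤ) : co (el z) = z := by
  funext j
  have := (bs K).repr_sum_self z
  simp only [co, el]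
  rw [this]

noncomputable def coEquiv : 𝓞 K ≃ (Idx K → ℤ) where
  toFun := co
  invFun := el
  left_inv := el_co
  right_inv := co_el

theorem co_add (x y : 𝓞 K) (j) : co (x + y) j = co x j + co y j := by simp [co]
theorem co_sub (x y : 𝓞 K) (j) : co (x - y) j = co x j - co y j := by simp [co]
theorem co_neg (x : 𝓞 K) (j) : co (-x) j = - co x j := by simp [co]
theorem co_zero (j) : co (0 : 𝓞 K) j = 0 := by simp [co]
theorem co_zsmul (n : ℤ) (x : 𝓞 K) (j) : co (n • x) j = n * co x j := by
  simp only [co, map_zsmul, Finsupp.smul_apply, smul_eq_mul]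
theorem co_intCast_mul (n : ℤ) (x : 𝓞 K) (j) : co ((n : 𝓞 K) * x) j = n * co x j := by
  rw [← zsmul_eq_mul, co_zsmul]
theorem co_natCast_mul (n : ℕ) (x : 𝓞 K) (j) : co ((n : 𝓞 K) * x) j = n * co x j := by
  have := co_intCast_mul (n : ℤ) x j
  simpa using this

theorem co_eq_zero {x : 𝓞 K} (h : ∀ j, co x j = 0) : x = 0 := by
  rw [← el_co x]; simp [el, h]

theorem co_bs [DecidableEq (Idx K)] (i j : Idx K) : co (bs K i) j = if i = j then 1 else 0 := by
  simp [co, Finsupp.single_apply]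

theorem pr_add (ξ : Idx K → ℝ) (x y : 𝓞 K) : pr ξ (x + y) = pr ξ x + pr ξ y := by
  simp [pr, co_add, mul_add, Finset.sum_add_distrib]

theorem pr_sub (ξ : Idx K → ℝ) (x y : 𝓞 K) : pr ξ (x - y) = pr ξ x - pr ξ y := by
  simp [pr, co_sub, mul_sub, Finset.sum_sub_distrib]

theorem pr_zero (ξ : Idx K → ℝ) : pr ξ (0 : 𝓞 K) = 0 := by
  simp [pr, co_zero]

theorem pr_zsmul (ξ : Idx K → ℝ) (n : ℤ) (x : 𝓞 K) : pr ξ (n • x) = n * pr ξ x := by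
  simp only [pr, co_zsmul, Finset.mul_sum]; push_cast
  exact Finset.sum_congr rfl fun _ _ => by ring

theorem pr_sum {α : Type*} (s : Finset α) (ξ : Idx K → ℝ) (f : α → 𝓞 K) :
    pr ξ (∑ i ∈ s, f i) = ∑ i ∈ s, pr ξ (f i) := by
  classical
  induction s using Finset.induction_on with
  | empty => simp [pr_zero]
  | insert a s ha ih => rw [Finset.sum_insert ha, Finset.sum_insert ha, pr_add, ih]

theorem pr_add_left (ξ η : Idx K → ℝ) (x : 𝓞 K) : pr (ξ + η) x = pr ξ x + pr η x := by
  simp [pr, add_mul, Finset.sum_add_distrib]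

theorem pr_sub_left (ξ η : Idx K → ℝ) (x : 𝓞 K) : pr (ξ - η) x = pr ξ x - pr η x := by
  simp [pr, sub_mul, Finset.sum_sub_distrib]

theorem pr_smul_left (c : ℝ) (ξ : Idx K → ℝ) (x : 𝓞 K) : pr (c • ξ) x = c * pr ξ x := by
  simp [pr, Finset.mul_sum, mul_assoc]

theorem pr_bs (ξ : Idx K → ℝ) (j : Idx K) : pr ξ (bs K j) = ξ j := by
  classical
  simp [pr, co_bs]

theorem act_apply (x : 𝓞 K) (ξ : Idx K → ℝ) (j) : act x ξ j = pr ξ (x * bs K j) := rfl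

theorem pr_act (x y : 𝓞 K) (ξ : Idx K → ℝ) : pr (act x ξ) y = pr ξ (x * y) := by
  conv_rhs => rw [← el_co y, el, Finset.mul_sum, pr_sum]
  change ∑ j, act x ξ j * (co y j : ℝ) = _
  refine Finset.sum_congr rfl fun j _ => ?_
  rw [mul_smul_comm, pr_zsmul, act_apply, mul_comm]

theorem act_act (x y : 𝓞 K) (ξ : Idx K → ℝ) : act x (act y ξ) = act (x * y) ξ := by
  funext j
  rw [act_apply, pr_act, act_apply]; ring_nf

theorem act_add (x : 𝓞 K) (ξ η : Idx K → ℝ) : act x (ξ + η) = act x ξ + act x η := by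
  funext j; simp [act_apply, pr_add_left]
theorem act_sub (x : 𝓞 K) (ξ η : Idx K → ℝ) : act x (ξ - η) = act x ξ - act x η := by
  funext j; simp [act_apply, pr_sub_left]
theorem act_smul (x : 𝓞 K) (c : ℝ) (ξ : Idx K → ℝ) : act x (c • ξ) = c • act x ξ := by
  funext j; simp [act_apply, pr_smul_left]
theorem add_act (x y : 𝓞 K) (ξ : Idx K → ℝ) : act (x + y) ξ = act x ξ + act y ξ := by
  funext j; simp [act_apply, add_mul, pr_add]
theorem sub_act (x y : 𝓞 K) (ξ : Idx K → ℝ) : act (x - y) ξ = act x ξ - act y ξ := by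
  funext j; simp [act_apply, sub_mul, pr_sub]
theorem zero_act (ξ : Idx K → ℝ) : act (0 : 𝓞 K) ξ = 0 := by
  funext j; simp [act_apply, pr_zero]
theorem one_act (ξ : Idx K → ℝ) : act (1 : 𝓞 K) ξ = ξ := by
  funext j; simp [act_apply, pr_bs]
theorem intCast_act (n : ℤ) (ξ : Idx K → ℝ) : act (n : 𝓞 K) ξ = (n : ℝ) • ξ := by
  funext j; rw [act_apply, ← zsmul_eq_mul, pr_zsmul, pr_bs]; simp

/-- the real vector of an integer vector -/
def rv (z : Idx K → ℤ) : Idx K → ℝ := fun j => (z j : ℝ)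

/-- integral action -/
noncomputable def actZ (x : 𝓞 K) (z : Idx K → ℤ) : Idx K → ℤ :=
  fun j => ∑ i, z i * co (x * bs K j) i

theorem act_rv (x : 𝓞 K) (z : Idx K → ℤ) : act x (rv z) = rv (actZ x z) := by
  funext j; simp [act, pr, rv, actZ]

/-- a bound for coordinates of products -/
theorem exists_mul_bound (K : Type*) [Field K] [NumberField K] : ∃ C : ℝ, 0 < C ∧
    (∀ (x y : 𝓞 K) (A B : ℝ), 0 ≤ A → 0 ≤ B → (∀ j, |(co x j : ℝ)| ≤ A) → (∀ j, |(co y j : ℝ)| ≤ B) →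
      ∀ j, |(co (x * y) j : ℝ)| ≤ C * A * B) ∧
    (∀ (x : 𝓞 K) (ξ : Idx K → ℝ) (A B : ℝ), 0 ≤ A → 0 ≤ B → (∀ j, |(co x j : ℝ)| ≤ A) →
      (∀ j, |ξ j| ≤ B) → ∀ j, |act x ξ j| ≤ C * A * B) := by
  classical
  set S : ℝ := ∑ i : Idx K, ∑ j : Idx K, ∑ k : Idx K, |(co (bs K i * bs K j) k : ℝ)| with hS
  have hS0 : 0 ≤ S := by positivity
  have h1 : ∀ (x y : 𝓞 K) (k), (co (x * y) k : ℝ) = ∑ i, ∑ j, (co x i : ℝ) * co y j * co (bs K i * bs K j) k := by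
    intro x y k
    have : co (x * y) k = ∑ i, ∑ j, co x i * co y j * co (bs K i * bs K j) k := by
      conv_lhs => rw [← el_co x, ← el_co y, el, el, Finset.sum_mul_sum]
      simp only [co, map_sum, Finsupp.coe_finsetSum, Finset.sum_apply]
      refine Finset.sum_congr rfl fun i _ => Finset.sum_congr rfl fun j _ => ?_
      rw [smul_mul_smul_comm, map_smul]; simp
    rw [this]; push_cast; rfl
  refine ⟨S + 1, by positivity, ?_, ?_⟩
  · intro x y A B hA hB hx hy k
    rw [h1]
    calc |∑ i, ∑ j, (co x i : ℝ) * co y j * co (bs K i * bs K j) k|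
        ≤ ∑ i, ∑ j, |(co x i : ℝ) * co y j * co (bs K i * bs K j) k| :=
          (Finset.abs_sum_le_sum_abs _ _).trans
            (Finset.sum_le_sum fun i _ => Finset.abs_sum_le_sum_abs _ _)
      _ ≤ ∑ i, ∑ j, A * B * ∑ k, |(co (bs K i * bs K j) k : ℝ)| := by
          refine Finset.sum_le_sum fun i _ => Finset.sum_le_sum fun j _ => ?_
          rw [abs_mul, abs_mul]
          have := Finset.single_le_sum (f := fun k => |(co (bs K i * bs K j) k : ℝ)|)
            (fun _ _ => abs_nonneg _) (Finset.mem_univ k)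
          have h2 := mul_le_mul (hx i) (hy j) (abs_nonneg _) hA
          exact mul_le_mul h2 this (abs_nonneg _) (by positivity)
      _ = A * B * S := by rw [hS]; simp only [Finset.mul_sum]
      _ ≤ (S + 1) * A * B := by nlinarith [mul_nonneg hA hB]
  · intro x ξ A B hA hB hx hξ j
    rw [act_apply]
    have : x * bs K j = ∑ i, co x i • (bs K i * bs K j) := by
      conv_lhs => rw [← el_co x, el, Finset.sum_mul]
      exact Finset.sum_congr rfl fun i _ => smul_mul_assoc _ _ _
    rw [this, pr_sum]
    simp only [pr_zsmul]
    simp only [pr, Finset.mul_sum]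
    calc |∑ i, ∑ k, (co x i : ℝ) * (ξ k * co (bs K i * bs K j) k)|
        ≤ ∑ i, ∑ k, |(co x i : ℝ) * (ξ k * co (bs K i * bs K j) k)| :=
          (Finset.abs_sum_le_sum_abs _ _).trans
            (Finset.sum_le_sum fun i _ => Finset.abs_sum_le_sum_abs _ _)
      _ ≤ ∑ i, ∑ k, A * B * |(co (bs K i * bs K j) k : ℝ)| := by
          refine Finset.sum_le_sum fun i _ => Finset.sum_le_sum fun k _ => ?_
          rw [abs_mul, abs_mul, ← mul_assoc]
          have h2 := mul_le_mul (hx i) (hξ k) (abs_nonneg _) hA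
          exact mul_le_mul_of_nonneg_right h2 (abs_nonneg _)
      _ = A * B * ∑ i, ∑ k, |(co (bs K i * bs K j) k : ℝ)| := by simp only [Finset.mul_sum]
      _ ≤ A * B * S := by
          refine mul_le_mul_of_nonneg_left ?_ (by positivity)
          rw [hS]
          refine Finset.sum_le_sum fun i _ => ?_
          exact Finset.single_le_sum (f := fun j => ∑ k, |(co (bs K i * bs K j) k : ℝ)|)
            (fun _ _ => by positivity) (Finset.mem_univ j)
      _ ≤ (S + 1) * A * B := by nlinarith [mul_nonneg hA hB]

end HM

end PartP0

section PartPT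
open scoped ENNReal
namespace HM

theorem prod_sum_fin {α : Type*} (n : ℕ) (f : Fin n → α → ℂ) (hf : ∀ i, Summable fun a => ‖f i a‖) :
    Summable (fun x : Fin n → α => ‖∏ i, f i (x i)‖) ∧
    ∑' x : Fin n → α, ∏ i, f i (x i) = ∏ i, ∑' a, f i a := by
  induction n with
  | zero =>
      constructor
      · exact (hasSum_fintype _).summable
      · simp
  | succ n ih =>
      obtain ⟨h1, h2⟩ := ih (fun i => f i.succ) (fun i => hf i.succ)
      let e : α × (Fin n → α) ≃ (Fin (n + 1) → α) := Fin.consEquiv (fun _ => α)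
      have he : ∀ p : α × (Fin n → α), ∏ i, f i (e p i) = f 0 p.1 * ∏ i, f (Fin.succ i) (p.2 i) := by
        intro p; rw [Fin.prod_univ_succ]; simp [e, Fin.consEquiv]
      have hs : Summable fun p : α × (Fin n → α) => ‖f 0 p.1 * ∏ i, f (Fin.succ i) (p.2 i)‖ :=
        Summable.mul_norm (f := f 0) (g := fun x : Fin n → α => ∏ i, f (Fin.succ i) (x i)) (hf 0) h1
      constructor
      · rw [← e.summable_iff]
        refine hs.congr fun p => ?_
        simp only [Function.comp]; rw [he]
      · rw [← e.tsum_eq, Fin.prod_univ_succ, ← h2]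
        rw [tsum_mul_tsum_of_summable_norm (f := f 0)
          (g := fun x : Fin n → α => ∏ i, f (Fin.succ i) (x i)) (hf 0) h1]
        exact tsum_congr he

theorem prod_sum {ι α : Type*} [Fintype ι] (f : ι → α → ℂ) (hf : ∀ i, Summable fun a => ‖f i a‖) :
    Summable (fun x : ι → α => ‖∏ i, f i (x i)‖) ∧
    ∑' x : ι → α, ∏ i, f i (x i) = ∏ i, ∑' a, f i a := by
  let e := Fintype.equivFin ι
  obtain ⟨h1, h2⟩ := prod_sum_fin (Fintype.card ι) (fun i => f (e.symm i)) (fun i => hf _)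
  let E : (Fin (Fintype.card ι) → α) ≃ (ι → α) := e.symm.arrowCongr (Equiv.refl α)
  have hE : ∀ x, ∏ i, f i (E x i) = ∏ i, f (e.symm i) (x i) := by
    intro x
    rw [← e.symm.prod_comp]
    simp [E]
  constructor
  · rw [← E.summable_iff]
    refine h1.congr fun x => ?_
    simp only [Function.comp]; rw [hE]
  · rw [← E.tsum_eq, tsum_congr hE, h2, ← e.symm.prod_comp]

theorem prod_sum_fin_enn {α : Type*} : ∀ (n : ℕ) (f : Fin n → α → ℝ≥0∞),
    ∑' x : Fin n → α, ∏ i, f i (x i) = ∏ i, ∑' a, f i a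
  | 0, f => by simp
  | n + 1, f => by
      have h2 := prod_sum_fin_enn n (fun i => f i.succ)
      let e : α × (Fin n → α) ≃ (Fin (n + 1) → α) := Fin.consEquiv (fun _ => α)
      have he : ∀ p : α × (Fin n → α), ∏ i, f i (e p i) = f 0 p.1 * ∏ i, f (Fin.succ i) (p.2 i) := by
        intro p; rw [Fin.prod_univ_succ]; simp [e, Fin.consEquiv]
      rw [← e.tsum_eq, Fin.prod_univ_succ, ← h2, tsum_congr he, ENNReal.tsum_prod']
      simp_rw [ENNReal.tsum_mul_left, ENNReal.tsum_mul_right]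

theorem prod_sum_enn {ι α : Type*} [Fintype ι] (f : ι → α → ℝ≥0∞) :
    ∑' x : ι → α, ∏ i, f i (x i) = ∏ i, ∑' a, f i a := by
  let e := Fintype.equivFin ι
  have h2 := prod_sum_fin_enn (Fintype.card ι) (fun i => f (e.symm i))
  let E : (Fin (Fintype.card ι) → α) ≃ (ι → α) := e.symm.arrowCongr (Equiv.refl α)
  have hE : ∀ x, ∏ i, f i (E x i) = ∏ i, f (e.symm i) (x i) := by
    intro x
    rw [← e.symm.prod_comp]
    simp [E]
  rw [← E.tsum_eq, tsum_congr hE, h2, ← e.symm.prod_comp]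

theorem summable_gauss (c : ℝ) (hc : 0 < c) : Summable fun y : ℤ => Real.exp (-c * (y : ℝ) ^ 2) := by
  have h := (summable_int_iff_summable_nat_and_neg (f := fun y : ℤ => Real.exp (-c * (y : ℝ) ^ 2))).2
  have h1 : Summable fun n : ℕ => Real.exp (-c * n) := by
    simpa [mul_comm] using Real.summable_exp_nat_mul_iff.2 (neg_lt_zero.2 hc)
  have h2 : Summable fun n : ℕ => Real.exp (-c * (n : ℝ) ^ 2) := by
    refine Summable.of_nonneg_of_le (fun _ => (Real.exp_pos _).le) (fun n => ?_) h1
    apply Real.exp_le_exp.2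
    have : (n : ℝ) ≤ (n : ℝ) ^ 2 := by exact_mod_cast Nat.le_self_pow two_ne_zero n
    nlinarith
  refine h ⟨by simpa using h2, by simpa using h2⟩

theorem oneD (R : ℝ) (hR : 0 < R) (u : ℤ) (η : ℝ) :
    Summable (fun y : ℤ => ‖Complex.exp (((-Real.pi * (((y : ℝ) + u) ^ 2 + (y : ℝ) ^ 2) / R ^ 2 : ℝ) : ℂ)
        + (2 * Real.pi * (y * η) : ℝ) * Complex.I)‖) ∧
    ‖∑' y : ℤ, Complex.exp (((-Real.pi * (((y : ℝ) + u) ^ 2 + (y : ℝ) ^ 2) / R ^ 2 : ℝ) : ℂ)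
        + (2 * Real.pi * (y * η) : ℝ) * Complex.I)‖ₑ ≤
    ENNReal.ofReal (R * Real.exp (-(Real.pi / 2) * (u : ℝ) ^ 2 / R ^ 2)) *
      ∑' k : ℤ, ENNReal.ofReal (Real.exp (-(Real.pi / 2) * R ^ 2 * (η - k) ^ 2)) := by
  have hpi := Real.pi_pos
  constructor
  · refine Summable.of_nonneg_of_le (fun _ => norm_nonneg _) (fun y => ?_)
      (summable_gauss (Real.pi / R ^ 2) (by positivity))
    rw [Complex.norm_exp]
    apply Real.exp_le_exp.2
    simp only [Complex.add_re, Complex.ofReal_re, Complex.mul_re, Complex.I_re, Complex.ofReal_im,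
      Complex.I_im, mul_zero, zero_mul, sub_zero, add_zero]
    rw [neg_mul, neg_mul, neg_div, neg_le_neg_iff, div_mul_eq_mul_div]
    gcongr
    nlinarith [sq_nonneg ((y : ℝ) + u)]
  · have hR2 : (0 : ℝ) < 2 / R ^ 2 := by positivity
    have hP := Complex.tsum_exp_neg_quadratic (a := ((2 / R ^ 2 : ℝ) : ℂ)) (by rw [Complex.ofReal_re]; exact hR2)
      (((- u / R ^ 2 : ℝ) : ℂ) + (η : ℂ) * Complex.I)
    have h1 : ∀ y : ℤ, Complex.exp (((-Real.pi * (((y : ℝ) + u) ^ 2 + (y : ℝ) ^ 2) / R ^ 2 : ℝ) : ℂ)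
        + (2 * Real.pi * (y * η) : ℝ) * Complex.I) =
        ((Real.exp (-Real.pi * (u : ℝ) ^ 2 / R ^ 2) : ℝ) : ℂ) *
        Complex.exp (-(Real.pi : ℂ) * ((2 / R ^ 2 : ℝ) : ℂ) * (y : ℂ) ^ 2 +
          2 * Real.pi * (((- u / R ^ 2 : ℝ) : ℂ) + (η : ℂ) * Complex.I) * y) := by
      intro y
      rw [Complex.ofReal_exp, ← Complex.exp_add]
      congr 1
      push_cast
      ring
    rw [tsum_congr h1, tsum_mul_left, hP, ← mul_assoc]
    rw [← tsum_mul_left]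
    refine (enorm_tsum_le_tsum_enorm).trans ?_
    rw [← ENNReal.tsum_mul_left]
    refine ENNReal.tsum_le_tsum fun k => ?_
    rw [← ENNReal.ofReal_mul (by positivity), ← ofReal_norm]
    apply ENNReal.ofReal_le_ofReal
    rw [norm_mul, norm_mul, Complex.norm_exp]
    have hr : ‖1 / (((2 / R ^ 2 : ℝ) : ℂ) ^ (1 / 2 : ℂ))‖ ≤ R := by
      rw [norm_div, norm_one]
      have : ((1 / 2 : ℂ)) = ((1 / 2 : ℝ) : ℂ) := by push_cast; rfl
      rw [this, ← Complex.ofReal_cpow hR2.le, Complex.norm_real, Real.norm_of_nonneg (by positivity),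
        ← Real.sqrt_eq_rpow, Real.sqrt_div zero_le_two, Real.sqrt_sq hR.le, one_div_div]
      apply div_le_self hR.le
      rw [Real.one_le_sqrt]; norm_num
    have hex : (-(Real.pi : ℂ) / ((2 / R ^ 2 : ℝ) : ℂ) * ((k : ℂ) + Complex.I * (((- u / R ^ 2 : ℝ) : ℂ) + (η : ℂ) * Complex.I)) ^ 2).re
        = -(Real.pi / 2) * R ^ 2 * (η - k) ^ 2 + (Real.pi / 2) * (u : ℝ) ^ 2 / R ^ 2 := by
      have : (-(Real.pi : ℂ) / ((2 / R ^ 2 : ℝ) : ℂ) * ((k : ℂ) + Complex.I * (((- u / R ^ 2 : ℝ) : ℂ) + (η : ℂ) * Complex.I)) ^ 2)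
        = ((-(Real.pi / 2) * R ^ 2 * (η - k) ^ 2 + (Real.pi / 2) * (u : ℝ) ^ 2 / R ^ 2 : ℝ) : ℂ)
          + ((-(Real.pi / 2) * R ^ 2 * (2 * (k - η) * (-u / R^2)) : ℝ) : ℂ) * Complex.I := by
        have hRc : (R : ℂ) ≠ 0 := by exact_mod_cast hR.ne'
        push_cast
        field_simp
        ring_nf
        simp only [Complex.I_sq, Complex.I_pow_three, Complex.I_pow_four]
        ring
      rw [this, Complex.add_re, Complex.re_ofReal_mul, Complex.I_re, Complex.ofReal_re]
      ring
    rw [hex, Real.exp_add]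
    have e1 : ‖((Real.exp (-Real.pi * (u : ℝ) ^ 2 / R ^ 2) : ℝ) : ℂ)‖ = Real.exp (-Real.pi * (u : ℝ) ^ 2 / R ^ 2) := by
      rw [Complex.norm_real, Real.norm_of_nonneg (Real.exp_pos _).le]
    rw [e1]
    have e2 : Real.exp (-(Real.pi / 2) * (u : ℝ) ^ 2 / R ^ 2) =
      Real.exp (-Real.pi * (u : ℝ) ^ 2 / R ^ 2) * Real.exp ((Real.pi / 2) * (u : ℝ) ^ 2 / R ^ 2) := by
      rw [← Real.exp_add]; congr 1; ring
    rw [e2]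
    set A := Real.exp (-Real.pi * (u : ℝ) ^ 2 / R ^ 2)
    set B := Real.exp ((Real.pi / 2) * (u : ℝ) ^ 2 / R ^ 2)
    set D := Real.exp (-(Real.pi / 2) * R ^ 2 * (η - k) ^ 2)
    calc A * ‖1 / (((2 / R ^ 2 : ℝ) : ℂ) ^ (1 / 2 : ℂ))‖ * (D * B) ≤ A * R * (D * B) := by gcongr
      _ = R * (A * B) * D := by ring

end HM

end PartPT

section PartPW
open NumberField Module
open scoped ENNReal
namespace HM
variable {K : Type*} [Field K] [NumberField K]

/-- additive character -/
noncomputable def ec (t : ℝ) : ℂ := Complex.exp ((2 * Real.pi * t : ℝ) * Complex.I)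

theorem ec_add (s t : ℝ) : ec (s + t) = ec s * ec t := by
  simp only [ec]; rw [← Complex.exp_add]; congr 1; push_cast; ring

theorem norm_ec (t : ℝ) : ‖ec t‖ = 1 := by
  simp only [ec]; exact Complex.norm_exp_ofReal_mul_I _

theorem ec_zero : ec 0 = 1 := by simp [ec]

theorem ec_conj (t : ℝ) : (starRingEnd ℂ) (ec t) = ec (-t) := by
  simp only [ec]; rw [← Complex.exp_conj, map_mul, Complex.conj_ofReal, Complex.conj_I]; congr 1; push_cast; ring

theorem ec_sum {α : Type*} (s : Finset α) (f : α → ℝ) : ec (∑ i ∈ s, f i) = ∏ i ∈ s, ec (f i) := by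
  simp only [ec]; rw [← Complex.exp_sum]; congr 1; push_cast
  rw [Finset.mul_sum, Finset.sum_mul]

/-- Gaussian weight -/
noncomputable def wt (R : ℝ) (x : 𝓞 K) : ℝ := Real.exp (-Real.pi * (∑ j, (co x j : ℝ) ^ 2) / R ^ 2)

theorem wt_pos (R : ℝ) (x : 𝓞 K) : 0 < wt R x := Real.exp_pos _

noncomputable def thf (a : 𝓞 K) (R : ℝ) (ξ : Idx K → ℝ) (x : 𝓞 K) : ℂ :=
  (wt R x : ℂ) * ec (pr ξ (a * x ^ 2))

noncomputable def theta (a : 𝓞 K) (R : ℝ) (ξ : Idx K → ℝ) : ℂ := ∑' x : 𝓞 K, thf a R ξ x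

theorem norm_thf (a : 𝓞 K) (R : ℝ) (ξ : Idx K → ℝ) (x : 𝓞 K) : ‖thf a R ξ x‖ = wt R x := by
  rw [thf, norm_mul, norm_ec, mul_one, Complex.norm_real, Real.norm_of_nonneg (wt_pos _ _).le]

theorem summable_wt (R : ℝ) (hR : 0 < R) : Summable fun x : 𝓞 K => wt R x := by
  rw [← (coEquiv (K := K)).symm.summable_iff]
  have h := (prod_sum (ι := Idx K) (fun _ (y : ℤ) => ((Real.exp (-(Real.pi / R ^ 2) * (y : ℝ) ^ 2) : ℝ) : ℂ))
    (fun _ => by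
      have := summable_gauss (Real.pi / R ^ 2) (by positivity)
      refine this.congr fun y => ?_
      rw [Complex.norm_real, Real.norm_of_nonneg (Real.exp_pos _).le])).1
  refine h.congr fun z => ?_
  rw [← Complex.ofReal_prod, Complex.norm_real, Real.norm_of_nonneg (by positivity), ← Real.exp_sum]
  simp only [Function.comp, coEquiv, Equiv.coe_fn_symm_mk, wt, co_el]
  congr 1
  rw [← Finset.mul_sum]; ring

theorem summable_norm_thf (a : 𝓞 K) (R : ℝ) (hR : 0 < R) (ξ : Idx K → ℝ) :
    Summable fun x => ‖thf a R ξ x‖ := by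
  simp only [norm_thf]; exact summable_wt R hR

/-- inner sum bound -/
theorem inner_bound (a : 𝓞 K) (R : ℝ) (hR : 0 < R) (ξ : Idx K → ℝ) (u : 𝓞 K) :
    ‖∑' y : 𝓞 K, thf a R ξ (y + u) * (starRingEnd ℂ) (thf a R ξ y)‖ₑ ≤
    ENNReal.ofReal (R ^ Fintype.card (Idx K)) *
      ∑' k : Idx K → ℤ, ∏ j, (ENNReal.ofReal (Real.exp (-(Real.pi / 2) * (co u j : ℝ) ^ 2 / R ^ 2)) *
        ENNReal.ofReal (Real.exp (-(Real.pi / 2) * R ^ 2 * (act (2 * a * u) ξ j - k j) ^ 2))) := by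
  set η := act (2 * a * u) ξ with hη
  have key : ∀ z : Idx K → ℤ, thf a R ξ (el z + u) * (starRingEnd ℂ) (thf a R ξ (el z)) =
      ec (pr ξ (a * u ^ 2)) * ∏ j, Complex.exp (((-Real.pi * (((z j : ℝ) + co u j) ^ 2 + (z j : ℝ) ^ 2) / R ^ 2 : ℝ) : ℂ)
        + (2 * Real.pi * (z j * η j) : ℝ) * Complex.I) := by
    intro z
    have e1 : ∀ j, Complex.exp (((-Real.pi * (((z j : ℝ) + co u j) ^ 2 + (z j : ℝ) ^ 2) / R ^ 2 : ℝ) : ℂ)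
        + (2 * Real.pi * (z j * η j) : ℝ) * Complex.I) =
        ((Real.exp (-Real.pi * (((z j : ℝ) + co u j) ^ 2 + (z j : ℝ) ^ 2) / R ^ 2) : ℝ) : ℂ) * ec (z j * η j) := by
      intro j; rw [Complex.exp_add, Complex.ofReal_exp, ec]
    simp only [e1]
    rw [Finset.prod_mul_distrib, ← Complex.ofReal_prod, ← Real.exp_sum, ← ec_sum]
    have e2 : ∑ j, (z j : ℝ) * η j = pr ξ (2 * a * u * el z) := by
      rw [← pr_act, ← hη, pr, co_el]
      exact Finset.sum_congr rfl fun _ _ => mul_comm _ _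
    rw [e2]
    simp only [thf, map_mul, Complex.conj_ofReal, ec_conj]
    have e3 : wt R (el z + u) * wt R (el z) =
      Real.exp (∑ j, -Real.pi * (((z j : ℝ) + co u j) ^ 2 + (z j : ℝ) ^ 2) / R ^ 2) := by
      simp only [wt]
      rw [← Real.exp_add]
      congr 1
      simp only [co_add, co_el]
      rw [← Finset.sum_div, ← Finset.mul_sum, Finset.sum_add_distrib]
      push_cast
      ring
    rw [← e3]
    have e4 : ec (pr ξ (a * (el z + u) ^ 2)) * ec (-pr ξ (a * el z ^ 2)) =
        ec (pr ξ (a * u ^ 2)) * ec (pr ξ (2 * a * u * el z)) := by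
      rw [← ec_add, ← ec_add, ← sub_eq_add_neg, ← pr_sub, ← pr_add]
      congr 2; ring
    push_cast
    linear_combination ((wt R (el z + u) : ℂ) * (wt R (el z) : ℂ)) * e4
  rw [← (coEquiv (K := K)).symm.tsum_eq]
  have : ∀ z : Idx K → ℤ, (coEquiv (K := K)).symm z = el z := fun z => rfl
  simp only [this, key]
  rw [tsum_mul_left, enorm_mul]
  have he : ‖ec (pr ξ (a * u ^ 2))‖ₑ = 1 := by
    rw [← ofReal_norm, norm_ec, ENNReal.ofReal_one]
  rw [he, one_mul]
  rw [(prod_sum (ι := Idx K) (fun j (y : ℤ) =>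
    Complex.exp (((-Real.pi * (((y : ℝ) + co u j) ^ 2 + (y : ℝ) ^ 2) / R ^ 2 : ℝ) : ℂ)
        + (2 * Real.pi * (y * η j) : ℝ) * Complex.I)) (fun j => (oneD R hR (co u j) (η j)).1)).2]
  rw [← ofReal_norm, norm_prod, ENNReal.ofReal_prod_of_nonneg (fun _ _ => norm_nonneg _)]
  simp only [ofReal_norm]
  refine (Finset.prod_le_prod' fun j _ => (oneD R hR (co u j) (η j)).2).trans (le_of_eq ?_)
  rw [prod_sum_enn (fun j (k : ℤ) => ENNReal.ofReal (Real.exp (-(Real.pi / 2) * (co u j : ℝ) ^ 2 / R ^ 2)) *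
        ENNReal.ofReal (Real.exp (-(Real.pi / 2) * R ^ 2 * (η j - k) ^ 2)))]
  simp only [ENNReal.tsum_mul_left, ENNReal.ofReal_mul hR.le]
  rw [ENNReal.ofReal_pow hR.le, ← Finset.card_univ, ← Finset.prod_const, ← Finset.prod_mul_distrib]
  simp only [mul_assoc]

theorem weyl1 (a : 𝓞 K) (R : ℝ) (hR : 0 < R) (ξ : Idx K → ℝ) :
    ‖theta a R ξ‖ₑ ^ 2 ≤ ENNReal.ofReal (R ^ Fintype.card (Idx K)) *
      ∑' u : 𝓞 K, ∑' k : Idx K → ℤ, ∏ j, (ENNReal.ofReal (Real.exp (-(Real.pi / 2) * (co u j : ℝ) ^ 2 / R ^ 2)) *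
        ENNReal.ofReal (Real.exp (-(Real.pi / 2) * R ^ 2 * (act (2 * a * u) ξ j - k j) ^ 2))) := by
  have hs := summable_norm_thf a R hR ξ
  have hs' : Summable fun x => ‖(starRingEnd ℂ) (thf a R ξ x)‖ := by simpa using hs
  have hsp : Summable fun p : 𝓞 K × 𝓞 K => thf a R ξ p.1 * (starRingEnd ℂ) (thf a R ξ p.2) :=
    summable_mul_of_summable_norm (f := thf a R ξ) (g := fun x => (starRingEnd ℂ) (thf a R ξ x)) hs hs'
  have h1 : ‖theta a R ξ‖ₑ ^ 2 = ‖theta a R ξ * (starRingEnd ℂ) (theta a R ξ)‖ₑ := by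
    rw [enorm_mul, sq]; congr 1
    rw [← ofReal_norm, ← ofReal_norm, Complex.norm_conj]
  have h2 : theta a R ξ * (starRingEnd ℂ) (theta a R ξ) =
      ∑' p : 𝓞 K × 𝓞 K, thf a R ξ p.1 * (starRingEnd ℂ) (thf a R ξ p.2) := by
    rw [theta, Complex.conj_tsum, tsum_mul_tsum_of_summable_norm (f := thf a R ξ) (g := fun x => (starRingEnd ℂ) (thf a R ξ x)) hs hs']
  let e : 𝓞 K × 𝓞 K ≃ 𝓞 K × 𝓞 K :=
    { toFun := fun p => (p.2 + p.1, p.2)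
      invFun := fun p => (p.1 - p.2, p.2)
      left_inv := fun p => by simp
      right_inv := fun p => by simp }
  have hsp2 : Summable fun p : 𝓞 K × 𝓞 K => thf a R ξ (p.2 + p.1) * (starRingEnd ℂ) (thf a R ξ p.2) :=
    (e.summable_iff (f := fun p : 𝓞 K × 𝓞 K => thf a R ξ p.1 * (starRingEnd ℂ) (thf a R ξ p.2))).2 hsp
  rw [h1, h2, ← e.tsum_eq (fun p : 𝓞 K × 𝓞 K => thf a R ξ p.1 * (starRingEnd ℂ) (thf a R ξ p.2))]
  have h3 : ∑' p, (fun p : 𝓞 K × 𝓞 K => thf a R ξ p.1 * (starRingEnd ℂ) (thf a R ξ p.2)) (e p) =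
    ∑' u, ∑' y, thf a R ξ (y + u) * (starRingEnd ℂ) (thf a R ξ y) := Summable.tsum_prod (f := fun p : 𝓞 K × 𝓞 K => thf a R ξ (p.2 + p.1) * (starRingEnd ℂ) (thf a R ξ p.2)) hsp2
  rw [h3, ← ENNReal.tsum_mul_left]
  refine enorm_tsum_le_tsum_enorm.trans (ENNReal.tsum_le_tsum fun u => inner_bound a R hR ξ u)

/-- the small lattice points -/
def Npts (c R : ℝ) (ξ : Idx K → ℝ) : Set (𝓞 K × (Idx K → ℤ)) :=
  {p | (∀ j, |(co p.1 j : ℝ)| ≤ c * R) ∧ ∀ j, |act p.1 ξ j - p.2 j| ≤ c / R}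

noncomputable def NN (c R : ℝ) (ξ : Idx K → ℝ) : ℝ≥0∞ := ∑' _p : Npts (K := K) c R ξ, 1

theorem floor_ineq (t c : ℝ) (hc : 0 < c) : (⌊t / c⌋ : ℝ) ^ 2 / 2 - 1 ≤ t ^ 2 / c ^ 2 := by
  set i : ℤ := ⌊t / c⌋ with hi
  have h1 : (i : ℝ) ≤ t / c := Int.floor_le _
  have h2 : t / c < i + 1 := Int.lt_floor_add_one _
  rw [← div_pow]
  set s := t / c
  rcases le_or_gt 0 i with h | h
  · have : (0 : ℝ) ≤ i := by exact_mod_cast h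
    nlinarith
  · have : (i : ℝ) ≤ -1 := by exact_mod_cast Int.le_sub_one_of_lt h
    nlinarith [sq_nonneg ((i : ℝ) + 2)]

theorem weyl2 (b : 𝓞 K) (hb : b ≠ 0) (c : ℝ) (hc : 0 < c) : ∃ C : ℝ≥0∞, C ≠ ∞ ∧
    ∀ (R : ℝ) (_ : 0 < R) (ξ : Idx K → ℝ),
      ∑' u : 𝓞 K, ∑' k : Idx K → ℤ, ∏ j, (ENNReal.ofReal (Real.exp (-(Real.pi / 2) * (co u j : ℝ) ^ 2 / R ^ 2)) *
        ENNReal.ofReal (Real.exp (-(Real.pi / 2) * R ^ 2 * (act (b * u) ξ j - k j) ^ 2)))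
      ≤ C * NN c R ξ := by
  classical
  obtain ⟨Cm, hCm, hmul, -⟩ := exists_mul_bound K
  have hpi := Real.pi_pos
  set A : ℝ := (∑ j, |(co b j : ℝ)|) + 1 with hA
  have hA0 : 0 < A := by positivity
  have hbA : ∀ j, |(co b j : ℝ)| ≤ A := fun j => by
    have := Finset.single_le_sum (f := fun j => |(co b j : ℝ)|) (fun _ _ => abs_nonneg _) (Finset.mem_univ j)
    simp only [hA]; linarith
  -- cell size
  set c1 : ℝ := min c (c / (Cm * A)) with hc1
  have hc10 : 0 < c1 := lt_min hc (by positivity)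
  have hc1c : c1 ≤ c := min_le_left _ _
  have hc1A : Cm * A * c1 ≤ c := by
    have : c1 ≤ c / (Cm * A) := min_le_right _ _
    rwa [le_div_iff₀ (by positivity), mul_comm] at this
  -- cell weight
  let g : ℤ → ℝ≥0∞ := fun i => ENNReal.ofReal (Real.exp (Real.pi / 2 * c1 ^ 2) * Real.exp (-(Real.pi / 4 * c1 ^ 2) * (i : ℝ) ^ 2))
  have hg : ∑' i, g i ≠ ∞ := by
    have := (summable_gauss (Real.pi / 4 * c1 ^ 2) (by positivity)).mul_left (Real.exp (Real.pi / 2 * c1 ^ 2))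
    exact this.tsum_ofReal_ne_top
  have hgw : ∀ t : ℝ, ENNReal.ofReal (Real.exp (-(Real.pi / 2) * t ^ 2)) ≤ g ⌊t / c1⌋ := by
    intro t
    apply ENNReal.ofReal_le_ofReal
    rw [← Real.exp_add]
    apply Real.exp_le_exp.2
    have h := floor_ineq t c1 hc10
    have h2 : ((⌊t / c1⌋ : ℝ) ^ 2 / 2 - 1) * c1 ^ 2 ≤ t ^ 2 := by
      rwa [le_div_iff₀ (by positivity)] at h
    nlinarith
  refine ⟨(∏ _j : Idx K, ∑' i, g i) * (∏ _j : Idx K, ∑' i, g i), ?_, ?_⟩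
  · exact ENNReal.mul_ne_top (ENNReal.prod_ne_top fun _ _ => hg) (ENNReal.prod_ne_top fun _ _ => hg)
  intro R hR ξ
  let cell : 𝓞 K × (Idx K → ℤ) → (Idx K → ℤ) × (Idx K → ℤ) := fun p =>
    (fun j => ⌊((co p.1 j : ℝ) / R) / c1⌋, fun j => ⌊(R * (act (b * p.1) ξ j - p.2 j)) / c1⌋)
  let G : (Idx K → ℤ) × (Idx K → ℤ) → ℝ≥0∞ := fun q => (∏ j, g (q.1 j)) * ∏ j, g (q.2 j)
  have hfib : ∀ q, ∑' _p : {p // cell p = q}, (1 : ℝ≥0∞) ≤ NN c R ξ := by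
    intro q
    rcases isEmpty_or_nonempty {p // cell p = q} with h | ⟨⟨p0, hp0⟩⟩
    · simp
    · let F : {p // cell p = q} → Npts (K := K) c R ξ := fun p => ⟨(b * (p.1.1 - p0.1), fun j => p.1.2 j - p0.2 j), by
        have hp := p.2.trans hp0.symm
        have hx : ∀ j, |(co (p.1.1 - p0.1) j : ℝ)| ≤ c1 * R := by
          intro j
          have h1 := congrFun (congrArg Prod.fst hp) j
          have h2 := Int.abs_sub_lt_one_of_floor_eq_floor h1
          rw [← sub_div, ← sub_div, abs_div, abs_div, abs_of_pos hR, abs_of_pos hc10, div_lt_one hc10,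
            div_lt_iff₀ hR] at h2
          rw [co_sub]; push_cast; exact h2.le
        constructor
        · intro j
          have := hmul b (p.1.1 - p0.1) A (c1 * R) hA0.le (by positivity) hbA hx j
          calc _ ≤ Cm * A * (c1 * R) := this
            _ = (Cm * A * c1) * R := by ring
            _ ≤ c * R := by gcongr
        · intro j
          have h1 := congrFun (congrArg Prod.snd hp) j
          have h2 := Int.abs_sub_lt_one_of_floor_eq_floor h1
          rw [← sub_div, ← mul_sub, abs_div, abs_mul, abs_of_pos hR, abs_of_pos hc10, div_lt_one hc10] at h2
          rw [mul_sub, sub_act, le_div_iff₀ hR, Pi.sub_apply]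
          push_cast
          refine le_trans (le_of_eq ?_) (h2.le.trans hc1c)
          rw [mul_comm]; congr 2; ring⟩
      have hF : Function.Injective F := by
        intro p p' h
        have h' := congrArg Subtype.val h
        have h1 := congrArg Prod.fst h'
        have h2 := congrArg Prod.snd h'
        simp only [F] at h1 h2
        apply Subtype.ext
        apply Prod.ext
        · have := mul_left_cancel₀ hb h1
          exact sub_left_injective this
        · funext j
          have := congrFun h2 j
          simpa using this
      exact ENNReal.tsum_comp_le_tsum_of_injective hF (fun _ => 1)
  calc _ = ∑' p : 𝓞 K × (Idx K → ℤ), ∏ j, (ENNReal.ofReal (Real.exp (-(Real.pi / 2) * (co p.1 j : ℝ) ^ 2 / R ^ 2)) *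
        ENNReal.ofReal (Real.exp (-(Real.pi / 2) * R ^ 2 * (act (b * p.1) ξ j - p.2 j) ^ 2))) :=
        (ENNReal.tsum_prod' ).symm
    _ ≤ ∑' p, G (cell p) := by
        refine ENNReal.tsum_le_tsum fun p => ?_
        simp only [G]
        rw [← Finset.prod_mul_distrib]
        refine Finset.prod_le_prod' fun j _ => mul_le_mul' ?_ ?_
        · refine le_trans (le_of_eq ?_) (hgw ((co p.1 j : ℝ) / R))
          congr 2; rw [div_pow]; ring
        · refine le_trans (le_of_eq ?_) (hgw (R * (act (b * p.1) ξ j - p.2 j)))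
          congr 2; ring
    _ = ∑' q, ∑' p : {p // cell p = q}, G (cell p.1) := by
        rw [← (Equiv.sigmaFiberEquiv cell).tsum_eq, ENNReal.tsum_sigma']
        rfl
    _ ≤ ∑' q, G q * NN c R ξ := by
        refine ENNReal.tsum_le_tsum fun q => ?_
        have : ∀ p : {p // cell p = q}, G (cell p.1) = G q * 1 := fun p => by rw [p.2, mul_one]
        rw [tsum_congr this, ENNReal.tsum_mul_left]
        exact mul_le_mul_right (hfib q) _
    _ = _ := by
        rw [ENNReal.tsum_mul_right]
        congr 1
        rw [ENNReal.tsum_prod']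
        simp only [G, ENNReal.tsum_mul_left, ENNReal.tsum_mul_right]
        rw [prod_sum_enn (fun (_ : Idx K) i => g i)]

theorem weyl (a : 𝓞 K) (ha : a ≠ 0) (c : ℝ) (hc : 0 < c) : ∃ C : ℝ≥0∞, C ≠ ∞ ∧
    ∀ (R : ℝ) (_ : 0 < R) (ξ : Idx K → ℝ),
      ‖theta a R ξ‖ₑ ^ 2 ≤ C * ENNReal.ofReal (R ^ Fintype.card (Idx K)) * NN c R ξ := by
  obtain ⟨C, hC, h⟩ := weyl2 (2 * a) (mul_ne_zero two_ne_zero ha) c hc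
  refine ⟨C, hC, fun R hR ξ => ?_⟩
  refine (weyl1 a R hR ξ).trans ?_
  rw [mul_comm C, mul_assoc]
  exact mul_le_mul_right (h R hR ξ) _

end HM

end PartPW

section PartPI
open NumberField Module Filter Ideal
open scoped ENNReal Topology
namespace HM
variable (K : Type*) [Field K] [NumberField K]

theorem cnt_summable : Summable fun n : ℕ =>
    (Nat.card {I : Ideal (𝓞 K) // absNorm I = n} : ℝ) * (n : ℝ) ^ (-(3 / 2) : ℝ) := by
  have hlim := NumberField.Ideal.tendsto_norm_le_div_atTop₀ K
  have h1 : Tendsto (fun n : ℕ => (∑ k ∈ Finset.Icc 1 n, (Nat.card {I : Ideal (𝓞 K) // absNorm I = k} : ℝ)) / n)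
      atTop (𝓝 (dedekindZeta_residue K)) := by
    refine (hlim.comp tendsto_natCast_atTop_atTop).congr fun n ↦ ?_
    simp only [Function.comp_apply, Nat.cast_le, ← Nat.cast_sum]
    congr
    rw [← add_left_inj 1, ← card_norm_le_eq_card_norm_le_add_one,
      show Finset.Icc 1 n = Finset.Ioc 0 n from Finset.Icc_succ_left_eq_Ioc _ _,
      show 1 = Nat.card {I : Ideal (𝓞 K) // absNorm I = 0} by simp [Ideal.absNorm_eq_zero_iff],
      Finset.sum_Ioc_add_eq_sum_Icc (n.zero_le),
      ← Finset.card_preimage_eq_sum_card_image_eq (fun k _ ↦ finite_setOfPred_absNorm_eq k)]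
    simp [Set.coe_eq_subtype]
  have h2 : (fun n : ℕ => ∑ k ∈ Finset.Icc 1 n, (Nat.card {I : Ideal (𝓞 K) // absNorm I = k} : ℝ))
      =O[atTop] fun n : ℕ => (n : ℝ) ^ (1 : ℝ) := by
    have h3 := h1.isBigO_one ℝ
    have h4 := h3.mul (Asymptotics.isBigO_refl (fun n : ℕ => (n : ℝ)) atTop)
    refine h4.congr' ?_ ?_
    · filter_upwards [eventually_gt_atTop 0] with n hn
      have : (n : ℝ) ≠ 0 := by positivity
      field_simp
    · filter_upwards with n; simp
  have h5 := LSeriesSummable_of_sum_norm_bigO_and_nonneg (s := ((3 / 2 : ℝ) : ℂ)) h2 (fun _ => Nat.cast_nonneg _) zero_le_one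
    (by rw [Complex.ofReal_re]; norm_num)
  have h6 := h5.norm
  refine h6.of_nonneg_of_le (fun _ => by positivity) (fun n => ?_)
  rw [LSeries.norm_term_eq]
  split_ifs with h
  · subst h; simp
  · rw [Complex.ofReal_re, Complex.norm_real, Real.norm_of_nonneg (by positivity), Real.rpow_neg (by positivity)]
    rfl

theorem ideal_sum : ∑' I : {I : Ideal (𝓞 K) // I ≠ ⊥}, ((absNorm I.1 : ℝ≥0∞)) ^ (-(3 / 2) : ℝ) ≠ ∞ := by
  have h := (cnt_summable K).tsum_ofReal_ne_top
  refine ne_top_of_le_ne_top h ?_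
  rw [← (Equiv.sigmaFiberEquiv (fun I : {I : Ideal (𝓞 K) // I ≠ ⊥} => absNorm I.1)).tsum_eq, ENNReal.tsum_sigma']
  refine ENNReal.tsum_le_tsum fun n => ?_
  have hc : ∀ c : {I : {I : Ideal (𝓞 K) // I ≠ ⊥} // absNorm I.1 = n},
    ((absNorm ((Equiv.sigmaFiberEquiv (fun I : {I : Ideal (𝓞 K) // I ≠ ⊥} => absNorm I.1)) ⟨n, c⟩).1 : ℝ≥0∞)) ^ (-(3 / 2) : ℝ)
      = (n : ℝ≥0∞) ^ (-(3 / 2) : ℝ) := by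
    intro c
    have := c.2
    simp only [Equiv.sigmaFiberEquiv, Equiv.coe_fn_mk]
    rw [this]
  rw [tsum_congr hc]
  have hfin : Finite {I : Ideal (𝓞 K) // absNorm I = n} := finite_setOfPred_absNorm_eq n
  rcases Nat.eq_zero_or_pos n with rfl | hn
  · have : IsEmpty {I : {I : Ideal (𝓞 K) // I ≠ ⊥} // absNorm I.1 = 0} := by
      refine ⟨fun I => I.1.2 (absNorm_eq_zero_iff.1 I.2)⟩
    simp
  · have hinj : Function.Injective (fun I : {I : {I : Ideal (𝓞 K) // I ≠ ⊥} // absNorm I.1 = n} =>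
        (⟨I.1.1, I.2⟩ : {I : Ideal (𝓞 K) // absNorm I = n})) := by
      intro I J h
      apply Subtype.ext; apply Subtype.ext
      simpa using h
    refine (ENNReal.tsum_comp_le_tsum_of_injective hinj (fun _ => (n : ℝ≥0∞) ^ (-(3 / 2) : ℝ))).trans ?_
    have := Fintype.ofFinite {I : Ideal (𝓞 K) // absNorm I = n}
    rw [tsum_fintype, Finset.sum_const, nsmul_eq_mul, ENNReal.ofReal_mul (by positivity), Nat.card_eq_fintype_card, Finset.card_univ,
      ENNReal.ofReal_natCast, ← ENNReal.ofReal_rpow_of_pos (by positivity), ENNReal.ofReal_natCast]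

theorem ideal_tail (ε : ℝ≥0∞) (hε : 0 < ε) : ∃ T0 : ℕ,
    ∑' I : {I : Ideal (𝓞 K) // I ≠ ⊥}, (if absNorm I.1 ≤ T0 then 0 else ((absNorm I.1 : ℝ≥0∞)) ^ (-(3 / 2) : ℝ)) ≤ ε := by
  have h := ENNReal.tendsto_tsum_compl_atTop_zero (ideal_sum K)
  obtain ⟨s, hs⟩ := (h.eventually (gt_mem_nhds hε)).exists
  refine ⟨s.sup fun I => absNorm I.1, ?_⟩
  refine le_trans ?_ hs.le
  have hts := (tsum_subtype {x | x ∉ s} (fun I : {I : Ideal (𝓞 K) // I ≠ ⊥} => ((absNorm I.1 : ℝ≥0∞)) ^ (-(3 / 2) : ℝ)))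
  refine le_trans ?_ hts.ge
  refine ENNReal.tsum_le_tsum fun I => ?_
  split_ifs with hI
  · exact zero_le
  · have : I ∉ s := fun hIs => hI (Finset.le_sup (f := fun I : {I : Ideal (𝓞 K) // I ≠ ⊥} => absNorm I.1) hIs)
    rw [Set.indicator_of_mem (by exact this)]
end HM

end PartPI

section PartPC
open NumberField Module
open scoped ENNReal
namespace HM
variable {K : Type*} [Field K] [NumberField K]

noncomputable abbrev LB (K : Type*) [Field K] [NumberField K] := canonicalEmbedding.latticeBasis K

theorem LB_apply (j : Idx K) (τ : K →+* ℂ) : LB K j τ = τ (bs K j : 𝓞 K) := by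
  rw [LB, canonicalEmbedding.latticeBasis_apply, integralBasis_apply, canonicalEmbedding.apply_at]

open Classical in
/-- complex components of a real functional -/
noncomputable def cmp (σ : K →+* ℂ) (ξ : Idx K → ℝ) : ℂ :=
  ∑ j, (ξ j : ℂ) * (LB K).repr (Pi.single σ 1) j

noncomputable def ext (ξ : Idx K → ℝ) : ((K →+* ℂ) → ℂ) →ₗ[ℂ] ℂ := (LB K).constr ℂ fun j => (ξ j : ℂ)

theorem ext_LB (ξ : Idx K → ℝ) (j) : ext ξ (LB K j) = ξ j := by
  rw [ext, Basis.constr_basis]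

open Classical in
theorem cmp_eq (σ : K →+* ℂ) (ξ : Idx K → ℝ) : cmp σ ξ = ext ξ (Pi.single σ 1) := by
  rw [ext, Basis.constr_apply_fintype, cmp]
  refine Finset.sum_congr rfl fun j _ => ?_
  rw [smul_eq_mul, mul_comm, Basis.equivFun_apply]

theorem sum_cmp (ξ : Idx K → ℝ) (j) : (ξ j : ℂ) = ∑ σ : K →+* ℂ, σ (bs K j : 𝓞 K) * cmp σ ξ := by
  classical
  rw [← ext_LB]
  conv_lhs => rw [← Finset.univ_sum_single (LB K j), map_sum]
  refine Finset.sum_congr rfl fun σ _ => ?_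
  rw [cmp_eq, ← smul_eq_mul, ← map_smul, ← Pi.single_smul, smul_eq_mul, mul_one, LB_apply]

theorem emb_eq (h : 𝓞 K) (τ : K →+* ℂ) : τ h = ∑ i, (co h i : ℂ) * τ (bs K i : 𝓞 K) := by
  conv_lhs => rw [← el_co h, el]
  push_cast
  rw [map_sum]
  refine Finset.sum_congr rfl fun i _ => ?_
  rw [zsmul_eq_mul, map_mul, map_intCast]

theorem ext_act (h : 𝓞 K) (ξ : Idx K → ℝ) (v : (K →+* ℂ) → ℂ) :
    ext (act h ξ) v = ext ξ (fun τ => τ h * v τ) := by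
  let m : ((K →+* ℂ) → ℂ) →ₗ[ℂ] ((K →+* ℂ) → ℂ) :=
    { toFun := fun v τ => τ h * v τ
      map_add' := fun v w => by funext τ; simp [mul_add]
      map_smul' := fun c v => by funext τ; simp; ring }
  have : ext (act h ξ) = (ext ξ).comp m := by
    refine (LB K).ext fun j => ?_
    rw [ext_LB, LinearMap.comp_apply]
    have : m (LB K j) = ∑ i, (co (h * bs K j) i : ℂ) • LB K i := by
      funext τ
      rw [Finset.sum_apply]
      simp only [m, LinearMap.coe_mk, AddHom.coe_mk, LB_apply, Pi.smul_apply, smul_eq_mul]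
      rw [← emb_eq]; push_cast; rw [map_mul]
    rw [this, map_sum, act_apply, pr]
    push_cast
    refine Finset.sum_congr rfl fun i _ => ?_
    rw [map_smul, ext_LB, smul_eq_mul, mul_comm]
  rw [this]; rfl

theorem cmp_act (σ : K →+* ℂ) (h : 𝓞 K) (ξ : Idx K → ℝ) : cmp σ (act h ξ) = σ h * cmp σ ξ := by
  classical
  rw [cmp_eq, ext_act, cmp_eq, ← smul_eq_mul, ← map_smul]
  congr 1
  funext τ
  by_cases hτ : τ = σ
  · subst hτ; simp
  · simp [hτ]

theorem cmp_conj (σ : K →+* ℂ) (ξ : Idx K → ℝ) :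
    cmp (ComplexEmbedding.conjugate σ) ξ = (starRingEnd ℂ) (cmp σ ξ) := by
  classical
  have key : ∀ j, (LB K).repr (Pi.single (ComplexEmbedding.conjugate σ) 1) j =
      (starRingEnd ℂ) ((LB K).repr (Pi.single σ 1) j) := by
    have h1 : (Pi.single (ComplexEmbedding.conjugate σ) 1 : (K →+* ℂ) → ℂ) =
        ∑ j, (starRingEnd ℂ) ((LB K).repr (Pi.single σ 1) j) • LB K j := by
      funext τ
      have h2 := congrFun ((LB K).sum_repr (Pi.single σ 1)) (ComplexEmbedding.conjugate τ)
      have h3 := congrArg (starRingEnd ℂ) h2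
      rw [Finset.sum_apply, map_sum] at h3
      rw [Finset.sum_apply]
      have h4 : (Pi.single (ComplexEmbedding.conjugate σ) 1 : (K →+* ℂ) → ℂ) τ =
        (starRingEnd ℂ) ((Pi.single σ 1 : (K →+* ℂ) → ℂ) (ComplexEmbedding.conjugate τ)) := by
        have : (τ = ComplexEmbedding.conjugate σ) ↔ (ComplexEmbedding.conjugate τ = σ) := by
          constructor
          · rintro rfl; simp
          · rintro rfl; simp
        simp only [Pi.single_apply, this]
        split_ifs <;> simp
      rw [h4, ← h3]
      refine Finset.sum_congr rfl fun j _ => ?_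
      simp only [Pi.smul_apply, smul_eq_mul, map_mul, LB_apply]
      simp [ComplexEmbedding.conjugate_coe_eq]
    intro j
    rw [h1, Basis.repr_sum_self]
  simp only [cmp, key, map_sum, map_mul, Complex.conj_ofReal]

/-- real linear coordinates -/
noncomputable def uu (z : ℂ) : ℝ := z.re + z.im

theorem abs_uu_le (z : ℂ) : |uu z| ≤ 2 * ‖z‖ := by
  have := Complex.abs_re_le_norm z
  have h2 := Complex.abs_im_le_norm z
  have := abs_add_le z.re z.im
  rw [uu]; linarith

theorem norm_lt_of_uu (z : ℂ) (B : ℝ) (h1 : |uu z| < B) (h2 : |uu ((starRingEnd ℂ) z)| < B) : ‖z‖ < 2 * B := by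
  have h3 := Complex.norm_le_abs_re_add_abs_im z
  simp only [uu, Complex.conj_re, Complex.conj_im] at h1 h2
  rw [abs_lt] at h1 h2
  have : |z.re| < B := by rw [abs_lt]; constructor <;> linarith
  have : |z.im| < B := by rw [abs_lt]; constructor <;> linarith
  linarith

theorem abs_norm_eq (x : 𝓞 K) : (|Algebra.norm ℤ x| : ℝ) = ∏ σ : K →+* ℂ, ‖σ x‖ := by
  have h := Algebra.norm_eq_prod_embeddings ℚ ℂ (x : K)
  rw [← Algebra.coe_norm_int] at h
  have h2 := congrArg norm h
  rw [norm_prod, ← Fintype.prod_equiv (RingHom.equivRatAlgHom K ℂ) (fun f => ‖f x‖)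
      (fun φ => ‖φ x‖) fun _ => by simp [RingHom.equivRatAlgHom_apply]] at h2
  rw [← h2]
  simp

theorem absNorm_le_of_mem (b : Ideal (𝓞 K)) (x : 𝓞 K) (hx : x ∈ b) (h0 : x ≠ 0) :
    (Ideal.absNorm b : ℝ) ≤ ∏ σ : K →+* ℂ, ‖σ x‖ := by
  have h := Ideal.absNorm_dvd_absNorm_of_le ((Ideal.span_singleton_le_iff_mem b).2 hx)
  rw [Ideal.absNorm_span_singleton] at h
  have h2 := Nat.le_of_dvd (Int.natAbs_pos.2 (by rwa [Ne, Algebra.norm_eq_zero_iff])) h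
  rw [← abs_norm_eq]
  have : ((Algebra.norm ℤ x).natAbs : ℝ) = |(Algebra.norm ℤ x : ℝ)| := by
    rw [Nat.cast_natAbs]; simp
  rw [← this]; exact_mod_cast h2

theorem card_emb : Fintype.card (K →+* ℂ) = Fintype.card (Idx K) := by
  rw [Embeddings.card, ← RingOfIntegers.rank, Module.finrank_eq_card_chooseBasisIndex]

theorem pig (b : Ideal (𝓞 K)) (hb : b ≠ ⊥) (ρ : (K →+* ℂ) → ℝ) (hρ : ∀ σ, 0 < ρ σ)
    (hsym : ∀ σ, ρ (ComplexEmbedding.conjugate σ) = ρ σ) (S : Finset (𝓞 K))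
    (hS : ∀ h ∈ S, h ∈ b ∧ ∀ σ : K →+* ℂ, ‖σ h‖ ≤ ρ σ) (h0 : 𝓞 K) (h0S : h0 ∈ S) (h00 : h0 ≠ 0) :
    (S.card : ℝ) ≤ 10 ^ Fintype.card (Idx K) * (∏ σ, ρ σ) / Ideal.absNorm b := by
  classical
  set n := Fintype.card (Idx K) with hn
  set P := ∏ σ, ρ σ with hP
  set N : ℝ := (Ideal.absNorm b : ℝ) with hN
  have hn0 : n ≠ 0 := by
    rw [hn, ← card_emb]; exact Fintype.card_ne_zero
  have hP0 : 0 < P := Finset.prod_pos fun σ _ => hρ σ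
  have hN0 : 0 < N := by
    have : Ideal.absNorm b ≠ 0 := by rwa [Ne, Ideal.absNorm_eq_zero_iff]
    positivity
  have hNP : N ≤ P := by
    refine (absNorm_le_of_mem b h0 (hS h0 h0S).1 h00).trans ?_
    exact Finset.prod_le_prod (fun _ _ => norm_nonneg _) fun σ _ => (hS h0 h0S).2 σ
  set t : ℝ := (N / P) ^ ((n : ℝ)⁻¹) / 2 with ht
  have hNP0 : 0 < N / P := by positivity
  have ht0 : 0 < t := by positivity
  have ht1 : t ≤ 1 / 2 := by
    have : (N / P) ^ ((n : ℝ)⁻¹) ≤ 1 := Real.rpow_le_one hNP0.le ((div_le_one hP0).2 hNP) (by positivity)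
    rw [ht]; linarith
  have htn : (2 * t) ^ n = N / P := by
    have : 2 * t = (N / P) ^ ((n : ℝ)⁻¹) := by rw [ht]; ring
    rw [this, Real.rpow_inv_natCast_pow hNP0.le hn0]
  let cell : 𝓞 K → ((K →+* ℂ) → ℤ) := fun h σ => ⌊uu (σ h) / (t * ρ σ)⌋
  have hinj : Set.InjOn cell S := by
    intro h hh h' hh' he
    by_contra hne
    have hd : h - h' ≠ 0 := sub_ne_zero.2 hne
    have hu : ∀ σ : K →+* ℂ, |uu (σ ((h - h' : 𝓞 K) : K))| < t * ρ σ := by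
      intro σ
      have h1 := congrFun he σ
      have h2 := Int.abs_sub_lt_one_of_floor_eq_floor h1
      have hp : 0 < t * ρ σ := mul_pos ht0 (hρ σ)
      rw [← sub_div, abs_div, abs_of_pos hp, div_lt_one hp] at h2
      refine lt_of_eq_of_lt ?_ h2
      congr 1
      push_cast
      simp only [uu, map_sub, Complex.sub_re, Complex.sub_im]; ring
    have hlt : ∀ σ : K →+* ℂ, ‖σ ((h - h' : 𝓞 K) : K)‖ < 2 * t * ρ σ := by
      intro σ
      rw [mul_assoc]
      apply norm_lt_of_uu _ _ (hu σ)
      have := hu (ComplexEmbedding.conjugate σ)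
      rw [hsym, ComplexEmbedding.conjugate_coe_eq] at this
      exact this
    have h3 := absNorm_le_of_mem b (h - h') (b.sub_mem (hS h hh).1 (hS h' hh').1) hd
    have h4 : ∏ σ : K →+* ℂ, ‖σ ((h - h' : 𝓞 K) : K)‖ < ∏ σ : K →+* ℂ, (2 * t * ρ σ) := by
      apply Finset.prod_lt_prod_of_nonempty (fun σ _ => ?_) (fun σ _ => hlt σ) Finset.univ_nonempty
      rw [norm_pos_iff, Ne, map_eq_zero]
      exact_mod_cast hd
    rw [Finset.prod_mul_distrib, Finset.prod_const, Finset.card_univ, card_emb, ← hn, htn, ← hP,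
      div_mul_cancel₀ _ hP0.ne'] at h4
    exact absurd h3 (not_le.2 h4)
  have hmaps : ∀ h ∈ S, cell h ∈ Fintype.piFinset fun _ : K →+* ℂ => Finset.Icc ⌊-(2 / t)⌋ ⌊2 / t⌋ := by
    intro h hh
    rw [Fintype.mem_piFinset]
    intro σ
    have h1 := (abs_uu_le (σ h)).trans (mul_le_mul_of_nonneg_left ((hS h hh).2 σ) zero_le_two)
    have hp : 0 < t * ρ σ := mul_pos ht0 (hρ σ)
    have h2 : |uu (σ h) / (t * ρ σ)| ≤ 2 / t := by
      rw [abs_div, abs_of_pos hp, div_le_div_iff₀ hp ht0]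
      nlinarith
    rw [abs_le] at h2
    rw [Finset.mem_Icc]
    exact ⟨Int.floor_le_floor h2.1, Int.floor_le_floor h2.2⟩
  have hcard := Finset.card_le_card_of_injOn cell hmaps hinj
  rw [Fintype.card_piFinset, Finset.prod_const, Finset.card_univ, card_emb, ← hn] at hcard
  have hc2 : ((Finset.Icc ⌊-(2 / t)⌋ ⌊2 / t⌋).card : ℝ) ≤ 5 / t := by
    have h1 : ⌊-(2 / t)⌋ ≤ ⌊2 / t⌋ + 1 := by
      have : -(2 / t) ≤ 2 / t := by have : 0 < 2 / t := by positivity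
                                    linarith
      have := Int.floor_le_floor this; omega
    have h2 : (((Finset.Icc ⌊-(2 / t)⌋ ⌊2 / t⌋).card : ℤ) : ℝ) = (⌊2 / t⌋ : ℝ) + 1 - ⌊-(2 / t)⌋ := by
      rw [Int.card_Icc_of_le _ _ h1]; push_cast; ring
    have h3 : (((Finset.Icc ⌊-(2 / t)⌋ ⌊2 / t⌋).card : ℤ) : ℝ) = ((Finset.Icc ⌊-(2 / t)⌋ ⌊2 / t⌋).card : ℝ) := by
      norm_cast
    rw [← h3, h2]
    have h4 := Int.floor_le (2 / t)
    have h5 := Int.lt_floor_add_one (-(2 / t))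
    have h6 : 2 ≤ 1 / t := by rw [le_div_iff₀ ht0]; linarith
    have h7 : 5 / t = 2 / t + 2 / t + 1 / t := by ring
    linarith
  calc (S.card : ℝ) ≤ ((Finset.Icc ⌊-(2 / t)⌋ ⌊2 / t⌋).card : ℝ) ^ n := by exact_mod_cast hcard
    _ ≤ (5 / t) ^ n := by gcongr
    _ = 10 ^ n / (2 * t) ^ n := by
        rw [← div_pow]; congr 1; field_simp; norm_num
    _ = _ := by rw [htn]; field_simp

end HM

end PartPC

section PartPD
open NumberField Module
open scoped ENNReal
namespace HM
variable {K : Type*} [Field K] [NumberField K]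

theorem cmp_smul (σ : K →+* ℂ) (c : ℝ) (ξ : Idx K → ℝ) : cmp σ (c • ξ) = c * cmp σ ξ := by
  simp [cmp, Finset.mul_sum, mul_assoc]

theorem cmp_add (σ : K →+* ℂ) (ξ η : Idx K → ℝ) : cmp σ (ξ + η) = cmp σ ξ + cmp σ η := by
  simp [cmp, add_mul, Finset.sum_add_distrib]

theorem exists_cmp_bound (K : Type*) [Field K] [NumberField K] : ∃ C : ℝ, 0 < C ∧
    (∀ (σ : K →+* ℂ) (h : 𝓞 K) (A : ℝ), 0 ≤ A → (∀ j, |(co h j : ℝ)| ≤ A) → ‖σ h‖ ≤ C * A) ∧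
    (∀ (σ : K →+* ℂ) (η : Idx K → ℝ) (B : ℝ), 0 ≤ B → (∀ j, |η j| ≤ B) → ‖cmp σ η‖ ≤ C * B) := by
  classical
  set S1 : ℝ := ∑ σ : K →+* ℂ, ∑ j, ‖σ (bs K j : 𝓞 K)‖ with hS1
  set S2 : ℝ := ∑ σ : K →+* ℂ, ∑ j, ‖(LB K).repr (Pi.single σ 1) j‖ with hS2
  have h1 : 0 ≤ S1 := by positivity
  have h2 : 0 ≤ S2 := by positivity
  refine ⟨S1 + S2 + 1, by positivity, ?_, ?_⟩
  · intro σ h A hA hh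
    have h3 : ∑ j, ‖σ (bs K j : 𝓞 K)‖ ≤ S1 :=
      Finset.single_le_sum (f := fun σ : K →+* ℂ => ∑ j, ‖σ (bs K j : 𝓞 K)‖) (fun _ _ => by positivity) (Finset.mem_univ σ)
    rw [emb_eq]
    calc _ ≤ ∑ i, ‖(co h i : ℂ) * σ (bs K i : 𝓞 K)‖ := norm_sum_le _ _
      _ ≤ ∑ i, A * ‖σ (bs K i : 𝓞 K)‖ := by
          refine Finset.sum_le_sum fun i _ => ?_
          rw [norm_mul]
          refine mul_le_mul_of_nonneg_right ?_ (norm_nonneg _)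
          rw [Complex.norm_intCast]; exact hh i
      _ = (∑ i, ‖σ (bs K i : 𝓞 K)‖) * A := by rw [← Finset.mul_sum, mul_comm]
      _ ≤ _ := by gcongr; linarith
  · intro σ η A hA hh
    have h3 : ∑ j, ‖(LB K).repr (Pi.single σ 1) j‖ ≤ S2 :=
      Finset.single_le_sum (f := fun σ : K →+* ℂ => ∑ j, ‖(LB K).repr (Pi.single σ 1) j‖) (fun _ _ => by positivity) (Finset.mem_univ σ)
    rw [cmp]
    calc _ ≤ ∑ i, ‖(η i : ℂ) * (LB K).repr (Pi.single σ 1) i‖ := by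
            convert norm_sum_le _ _
      _ ≤ ∑ i, A * ‖(LB K).repr (Pi.single σ 1) i‖ := by
          refine Finset.sum_le_sum fun i _ => ?_
          rw [norm_mul]
          refine mul_le_mul_of_nonneg_right ?_ (norm_nonneg _)
          rw [Complex.norm_real]; exact hh i
      _ = (∑ i, ‖(LB K).repr (Pi.single σ 1) i‖) * A := by rw [← Finset.mul_sum, mul_comm]
      _ ≤ _ := by gcongr; linarith

/-- denominator ideal of a functional -/
noncomputable def dn (γ : Idx K → ℝ) : Ideal (𝓞 K) where
  carrier := {h | ∃ z : Idx K → ℤ, act h γ = rv z}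
  zero_mem' := ⟨0, by rw [zero_act]; funext j; simp [rv]⟩
  add_mem' := by
    rintro x y ⟨z, hz⟩ ⟨z', hz'⟩
    exact ⟨z + z', by rw [add_act, hz, hz']; funext j; simp [rv]⟩
  smul_mem' := by
    rintro r x ⟨z, hz⟩
    exact ⟨actZ r z, by rw [smul_eq_mul, ← act_act, hz, act_rv]⟩

theorem mem_dn {γ : Idx K → ℝ} {h : 𝓞 K} : h ∈ dn γ ↔ ∃ z : Idx K → ℤ, act h γ = rv z := Iff.rfl

theorem rv_inj {z z' : Idx K → ℤ} (h : rv z = rv z') : z = z' := by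
  funext j; have := congrFun h j; simpa [rv] using this

noncomputable def g0 (s : Idx K → ℝ) : ℝ := ∏ σ : K →+* ℂ, (1 + ‖cmp σ s‖)⁻¹

theorem exists_inv_mul (h : 𝓞 K) (h0 : h ≠ 0) : ∃ (h' : 𝓞 K) (N : ℕ), N ≠ 0 ∧ h' * h = (N : 𝓞 K) := by
  have := Ideal.absNorm_mem (Ideal.span {h})
  rw [Ideal.mem_span_singleton'] at this
  obtain ⟨h', hh⟩ := this
  refine ⟨h', _, ?_, hh⟩
  rw [Ne, Ideal.absNorm_eq_zero_iff]
  simpa using h0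

theorem natCast_act (n : ℕ) (ξ : Idx K → ℝ) : act (n : 𝓞 K) ξ = (n : ℝ) • ξ := by
  have := intCast_act (n : ℤ) ξ
  simpa using this

theorem act_inj (h : 𝓞 K) (h0 : h ≠ 0) {ξ η : Idx K → ℝ} (he : act h ξ = act h η) : ξ = η := by
  obtain ⟨h', N, hN, hh⟩ := exists_inv_mul h h0
  have := congrArg (act h') he
  rw [act_act, act_act, hh, natCast_act, natCast_act] at this
  exact smul_right_injective _ (by exact_mod_cast hN) this

theorem act_surj (h : 𝓞 K) (h0 : h ≠ 0) (ξ : Idx K → ℝ) : ∃ γ, act h γ = ξ := by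
  obtain ⟨h', N, hN, hh⟩ := exists_inv_mul h h0
  refine ⟨(N : ℝ)⁻¹ • act h' ξ, ?_⟩
  rw [act_smul, act_act, mul_comm, hh, natCast_act, smul_smul, inv_mul_cancel₀ (by exact_mod_cast hN), one_smul]

theorem NN_bound (K : Type*) [Field K] [NumberField K] : ∃ c : ℝ, 0 < c ∧ ∀ (R : ℝ) (_ : 1 ≤ R) (ξ : Idx K → ℝ),
    NN c R ξ ≤ 1 ∨ ∃ γ : Idx K → ℝ, dn γ ≠ ⊥ ∧ NN c R ξ ≤
      ENNReal.ofReal (20 ^ Fintype.card (Idx K) * R ^ Fintype.card (Idx K) * g0 (R ^ 2 • (ξ - γ)) / Ideal.absNorm (dn γ)) := by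
  classical
  obtain ⟨Cm, hCm, hmul, hact⟩ := exists_mul_bound K
  obtain ⟨Cb, hCb, hb1, hb2⟩ := exists_cmp_bound K
  obtain ⟨c, hc, hc1, hc2, hc3⟩ : ∃ c : ℝ, 0 < c ∧ c < 1 ∧ Cb * c ≤ 1 ∧ 2 * Cm * c * c < 1 := by
    refine ⟨min (1 / 2) (min (1 / Cb) (1 / (2 * Cm))), by positivity, ?_, ?_, ?_⟩
    · exact lt_of_le_of_lt (min_le_left _ _) (by norm_num)
    · have : min (1 / 2) (min (1 / Cb) (1 / (2 * Cm))) ≤ 1 / Cb := (min_le_right _ _).trans (min_le_left _ _)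
      rw [le_div_iff₀ hCb] at this; linarith
    · set c := min (1 / 2) (min (1 / Cb) (1 / (2 * Cm))) with hcdef
      have h0 : 0 < c := by positivity
      have h1 : c ≤ 1 / (2 * Cm) := (min_le_right _ _).trans (min_le_right _ _)
      have h2 : c ≤ 1 / 2 := min_le_left _ _
      rw [le_div_iff₀ (by positivity)] at h1
      nlinarith
  refine ⟨c, hc, fun R hR ξ => ?_⟩
  have hR0 : 0 < R := by linarith
  by_cases hex : ∃ p ∈ Npts (K := K) c R ξ, p.1 ≠ 0
  swap
  · left
    push Not at hex
    have hsub : Subsingleton (Npts (K := K) c R ξ) := by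
      refine ⟨fun p p' => ?_⟩
      have hz : ∀ p : Npts (K := K) c R ξ, p.1.2 = 0 := by
        intro p
        funext j
        have h1 := p.2.2 j
        rw [hex _ p.2, zero_act, Pi.zero_apply, zero_sub, abs_neg] at h1
        have h2 : |(p.1.2 j : ℝ)| < 1 := lt_of_le_of_lt h1 (by rw [div_lt_one hR0]; linarith)
        have h3 : |p.1.2 j| < 1 := by exact_mod_cast h2
        simpa using Int.abs_lt_one_iff.1 h3
      apply Subtype.ext; apply Prod.ext
      · rw [hex _ p.2, hex _ p'.2]
      · rw [hz p, hz p']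
    rw [NN]
    rcases isEmpty_or_nonempty (Npts (K := K) c R ξ) with h | ⟨⟨p⟩⟩
    · simp
    · rw [tsum_eq_single p (fun p' hp' => absurd (Subsingleton.elim p' p) hp')]
  right
  obtain ⟨p0, hp0, h00⟩ := hex
  obtain ⟨γ, hγ⟩ := act_surj p0.1 h00 (rv p0.2)
  have key : ∀ p ∈ Npts (K := K) c R ξ, act p.1 γ = rv p.2 := by
    intro p hp
    apply act_inj p0.1 h00
    rw [act_act, mul_comm, ← act_act, hγ, act_rv, act_rv]
    congr 1
    funext j
    have e1 : rv (actZ p.1 p0.2) - rv (actZ p0.1 p.2) =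
        act p0.1 (act p.1 ξ - rv p.2) - act p.1 (act p0.1 ξ - rv p0.2) := by
      rw [act_sub, act_sub, act_act, act_act, act_rv, act_rv, mul_comm p0.1]; abel
    have e2 := congrFun e1 j
    have b1 := hact p0.1 (act p.1 ξ - rv p.2) (c * R) (c / R) (by positivity) (by positivity) hp0.1 hp.2 j
    have b2 := hact p.1 (act p0.1 ξ - rv p0.2) (c * R) (c / R) (by positivity) (by positivity) hp.1 hp0.2 j
    have e3 : Cm * (c * R) * (c / R) = Cm * c * c := by field_simp
    rw [e3] at b1 b2
    have b3 : |rv (actZ p.1 p0.2) j - rv (actZ p0.1 p.2) j| < 1 := by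
      rw [Pi.sub_apply, Pi.sub_apply] at e2
      rw [e2]
      refine lt_of_le_of_lt (abs_sub _ _) ?_
      linarith
    have b4 : |actZ p.1 p0.2 j - actZ p0.1 p.2 j| < 1 := by
      simp only [rv] at b3; exact_mod_cast b3
    have := Int.abs_lt_one_iff.1 b4
    omega
  have hdn : ∀ p ∈ Npts (K := K) c R ξ, p.1 ∈ dn γ := fun p hp => ⟨p.2, key p hp⟩
  have hne : dn γ ≠ ⊥ := by
    intro h
    have := hdn p0 hp0
    rw [h, Ideal.mem_bot] at this
    exact h00 this
  refine ⟨γ, hne, ?_⟩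
  let ρ : (K →+* ℂ) → ℝ := fun σ => 2 * R * (1 + ‖cmp σ (R ^ 2 • (ξ - γ))‖)⁻¹
  have hρ0 : ∀ σ, 0 < ρ σ := fun σ => by positivity
  have hρ : ∀ p ∈ Npts (K := K) c R ξ, ∀ σ : K →+* ℂ, ‖σ (p.1 : K)‖ ≤ ρ σ := by
    intro p hp σ
    have h1 := hb1 σ p.1 (c * R) (by positivity) hp.1
    have h2 := hb2 σ (act p.1 (ξ - γ)) (c / R) (by positivity) (by
      intro j; rw [act_sub, key p hp]; exact hp.2 j)
    rw [cmp_act, norm_mul] at h2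
    have h3 : ‖σ (p.1 : K)‖ * (1 + ‖cmp σ (R ^ 2 • (ξ - γ))‖) ≤ 2 * R := by
      rw [cmp_smul, norm_mul, Complex.norm_real, Real.norm_of_nonneg (by positivity)]
      have h4 : R ^ 2 * (‖σ (p.1 : K)‖ * ‖cmp σ (ξ - γ)‖) ≤ R ^ 2 * (Cb * (c / R)) := by gcongr
      have h5 : R ^ 2 * (Cb * (c / R)) = Cb * c * R := by field_simp
      have h6 : Cb * c * R ≤ R := by nlinarith
      nlinarith
    simp only [ρ]
    rw [← div_eq_mul_inv, le_div_iff₀ (by positivity)]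
    exact h3
  have hsym : ∀ σ, ρ (ComplexEmbedding.conjugate σ) = ρ σ := by
    intro σ; simp only [ρ, cmp_conj, RCLike.norm_conj]
  have hprod : ∏ σ, ρ σ = 2 ^ Fintype.card (Idx K) * R ^ Fintype.card (Idx K) * g0 (R ^ 2 • (ξ - γ)) := by
    simp only [ρ, g0]
    rw [Finset.prod_mul_distrib, Finset.prod_const, Finset.card_univ, card_emb, mul_pow]
  rw [NN, ENNReal.tsum_eq_iSup_sum]
  refine iSup_le fun S => ?_
  rw [Finset.sum_const, nsmul_eq_mul, mul_one]
  let S' := insert p0.1 (S.image fun p => p.1.1)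
  have hcard : S.card ≤ S'.card := by
    rw [← Finset.card_image_of_injective S (f := fun p : Npts (K := K) c R ξ => p.1.1)]
    · exact Finset.card_le_card (Finset.subset_insert _ _)
    · intro p p' h
      apply Subtype.ext; apply Prod.ext h
      apply rv_inj
      rw [← key _ p.2, ← key _ p'.2]
      exact congrArg (fun h => act h γ) h
  have hpig := pig (dn γ) hne ρ hρ0 hsym S' (by
    intro h hh
    rw [Finset.mem_insert, Finset.mem_image] at hh
    rcases hh with rfl | ⟨p, -, rfl⟩
    · exact ⟨hdn _ hp0, hρ _ hp0⟩
    · exact ⟨hdn _ p.2, hρ _ p.2⟩) p0.1 (Finset.mem_insert_self _ _) h00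
  rw [← ENNReal.ofReal_natCast]
  apply ENNReal.ofReal_le_ofReal
  have : (S.card : ℝ) ≤ S'.card := by exact_mod_cast hcard
  refine this.trans (hpig.trans (le_of_eq ?_))
  rw [hprod, ← mul_assoc, ← mul_assoc, ← mul_pow]; norm_num

end HM

end PartPD

section PartPE
open NumberField Module MeasureTheory
open scoped ENNReal
namespace HM
variable {K : Type*} [Field K] [NumberField K]

theorem cmp_continuous (σ : K →+* ℂ) : Continuous (cmp (K := K) σ) := by
  unfold cmp; fun_prop

theorem g0_continuous : Continuous (g0 (K := K)) := by
  unfold g0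
  refine continuous_finsetProd _ fun σ _ => ?_
  refine Continuous.inv₀ ?_ fun s => by positivity
  exact continuous_const.add (cmp_continuous σ).norm

theorem g0_nonneg (s : Idx K → ℝ) : 0 ≤ g0 s := by unfold g0; positivity

/-- real coordinates of the component map -/
noncomputable def UL : (Idx K → ℝ) →ₗ[ℝ] ((K →+* ℂ) → ℝ) where
  toFun s σ := uu (cmp σ s) / 2
  map_add' s t := by funext σ; simp [cmp_add, uu]; ring
  map_smul' c s := by funext σ; simp [cmp_smul, uu]; ring

theorem UL_inj : Function.Injective (UL (K := K)) := by
  rw [← LinearMap.ker_eq_bot, LinearMap.ker_eq_bot']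
  intro s hs
  have h1 : ∀ σ : K →+* ℂ, uu (cmp σ s) = 0 := by
    intro σ
    have := congrFun hs σ
    simpa [UL] using this
  have h2 : ∀ σ : K →+* ℂ, cmp σ s = 0 := by
    intro σ
    have a := h1 σ
    have b := h1 (ComplexEmbedding.conjugate σ)
    rw [cmp_conj] at b
    simp only [uu, Complex.conj_re, Complex.conj_im] at a b
    apply Complex.ext
    · simp only [Complex.zero_re]; linarith
    · simp only [Complex.zero_im]; linarith
  funext j
  have := sum_cmp s j
  simp only [h2, mul_zero, Finset.sum_const_zero] at this
  exact_mod_cast this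

noncomputable def UE : (Idx K → ℝ) ≃L[ℝ] ((K →+* ℂ) → ℝ) :=
  (LinearEquiv.ofInjectiveOfFinrankEq UL UL_inj (by
    rw [Module.finrank_fintype_fun_eq_card, Module.finrank_fintype_fun_eq_card, card_emb])).toContinuousLinearEquiv

theorem UE_apply (s : Idx K → ℝ) (σ : K →+* ℂ) : UE s σ = uu (cmp σ s) / 2 := rfl

noncomputable def Gs (s : Idx K → ℝ) : ℝ≥0∞ := ENNReal.ofReal (g0 s) ^ (5 / 2 : ℝ)

theorem Gs_measurable : Measurable (Gs (K := K)) := by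
  unfold Gs
  exact (g0_continuous.measurable.ennreal_ofReal).pow_const _

theorem Gs_lintegral (K : Type*) [Field K] [NumberField K] : ∫⁻ s : Idx K → ℝ, Gs s ≠ ∞ := by
  let f : ((K →+* ℂ) → ℝ) → ℝ := fun u => ∏ σ, (1 + ‖u σ‖) ^ (-(5 / 2) : ℝ)
  have hf : Integrable f := by
    refine Integrable.fintype_prod (f := fun _ (t : ℝ) => (1 + ‖t‖) ^ (-(5 / 2) : ℝ)) fun _ => ?_
    refine integrable_one_add_norm ?_
    rw [Module.finrank_self]; norm_num
  have hf2 : Integrable (fun s : Idx K → ℝ => f (UE s)) := by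
    have h1 : Integrable f (Measure.map (UE (K := K)) volume) := by
      rw [Measure.isAddLeftInvariant_eq_smul (Measure.map (UE (K := K)) volume) volume]
      exact hf.smul_measure_nnreal
    exact (integrable_map_equiv (UE (K := K)).toHomeomorph.toMeasurableEquiv f).1 h1
  have h2 := hf2.lintegral_lt_top
  refine ne_top_of_le_ne_top h2.ne (lintegral_mono fun s => ?_)
  rw [Gs, ENNReal.ofReal_rpow_of_nonneg (g0_nonneg s) (by norm_num)]
  apply ENNReal.ofReal_le_ofReal
  simp only [f, g0]
  rw [← Real.finsetProd_rpow _ _ (fun σ _ => by positivity)]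
  refine Finset.prod_le_prod (fun σ _ => by positivity) fun σ _ => ?_
  rw [Real.rpow_neg (by positivity), ← Real.inv_rpow (by positivity)]
  refine Real.rpow_le_rpow (by positivity) ?_ (by norm_num)
  apply inv_anti₀ (by positivity)
  rw [UE_apply, Real.norm_eq_abs, abs_div]
  have := abs_uu_le (cmp σ s)
  rw [abs_two]; linarith

/-- small contribution near the centre -/
theorem Gs_small (K : Type*) [Field K] [NumberField K] (ε : ℝ≥0∞) (hε : 0 < ε) : ∃ T : ℕ, 1 ≤ T ∧
    ∫⁻ s : Idx K → ℝ, ENNReal.ofReal (min 1 (4 * Real.pi * (∑ j, |s j|) / T)) * Gs s ≤ ε := by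
  have h : Filter.Tendsto (fun T : ℕ => ∫⁻ s : Idx K → ℝ, ENNReal.ofReal (min 1 (4 * Real.pi * (∑ j, |s j|) / T)) * Gs s)
      Filter.atTop (nhds (∫⁻ s : Idx K → ℝ, 0)) := by
    refine tendsto_lintegral_of_dominated_convergence Gs (fun T => ?_) (fun T => ?_) (Gs_lintegral K) ?_
    · refine Measurable.mul ?_ Gs_measurable
      fun_prop
    · refine Filter.Eventually.of_forall fun s => ?_
      refine mul_le_of_le_one_left' ?_
      rw [← ENNReal.ofReal_one]
      exact ENNReal.ofReal_le_ofReal (min_le_left _ _)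
    · refine Filter.Eventually.of_forall fun s => ?_
      have h1 : Filter.Tendsto (fun T : ℕ => min 1 (4 * Real.pi * (∑ j, |s j|) / (T : ℝ))) Filter.atTop (nhds (min 1 0)) :=
        tendsto_const_nhds.min (tendsto_const_div_atTop_nhds_zero_nat _)
      have h2 := ENNReal.tendsto_ofReal h1
      rw [min_eq_right zero_le_one, ENNReal.ofReal_zero] at h2
      have h3 := ENNReal.Tendsto.mul_const (b := Gs s) h2 (Or.inr ?_)
      · simpa using h3
      · rw [Gs]; exact ENNReal.rpow_ne_top_of_nonneg (by norm_num) ENNReal.ofReal_ne_top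
  rw [lintegral_zero] at h
  obtain ⟨T, hT1, hT2⟩ := ((h.eventually (gt_mem_nhds hε)).and (Filter.eventually_ge_atTop 1)).exists
  exact ⟨T, hT2, hT1.le⟩

end HM

end PartPE

section PartPM
open NumberField Module MeasureTheory
open scoped ENNReal
namespace HM
variable {K : Type*} [Field K] [NumberField K]

theorem ec_int (n : ℤ) : ec n = 1 := by
  simp only [ec]
  rw [Complex.exp_eq_one_iff]
  exact ⟨n, by push_cast; ring⟩

theorem ec_eq_one {t : ℝ} (h : ec t = 1) : ∃ n : ℤ, t = n := by
  simp only [ec] at h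
  rw [Complex.exp_eq_one_iff] at h
  obtain ⟨n, hn⟩ := h
  refine ⟨n, ?_⟩
  have h2 : (2 * Real.pi * Complex.I : ℂ) ≠ 0 := Complex.two_pi_I_ne_zero
  have h3 : (t : ℂ) * (2 * Real.pi * Complex.I : ℂ) = n * (2 * Real.pi * Complex.I : ℂ) := by
    rw [← hn]; push_cast; ring
  exact_mod_cast mul_right_cancel₀ h2 h3

theorem ec_ne_zero (t : ℝ) : ec t ≠ 0 := Complex.exp_ne_zero _

theorem ec_inj {s t : ℝ} (hs : s ∈ Set.Ico (0 : ℝ) 1) (ht : t ∈ Set.Ico (0 : ℝ) 1) (h : ec s = ec t) : s = t := by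
  have h1 : ec (s - t) = 1 := by
    have h2 : ec (s - t) * ec t = 1 * ec t := by rw [← ec_add, one_mul, sub_add_cancel, h]
    exact mul_right_cancel₀ (ec_ne_zero t) h2
  obtain ⟨n, hn⟩ := ec_eq_one h1
  have h3 : (-1 : ℝ) < n := by rw [← hn]; linarith [hs.1, ht.2]
  have h4 : (n : ℝ) < 1 := by rw [← hn]; linarith [hs.2, ht.1]
  have : n = 0 := by
    have a : (-1 : ℤ) < n := by exact_mod_cast h3
    have b : n < 1 := by exact_mod_cast h4
    omega
  rw [this] at hn; push_cast at hn; linarith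

theorem pr_rv (z : Idx K → ℤ) (x : 𝓞 K) : ∃ n : ℤ, pr (rv z) x = n :=
  ⟨∑ j, z j * co x j, by simp [pr, rv]⟩

theorem ec_pr_dn {γ : Idx K → ℝ} {x : 𝓞 K} (hx : x ∈ dn γ) : ec (pr γ x) = 1 := by
  obtain ⟨z, hz⟩ := hx
  have : pr γ x = pr (rv z) 1 := by rw [← hz, pr_act, mul_one]
  obtain ⟨n, hn⟩ := pr_rv z 1
  rw [this, hn, ec_int]

def cube (K : Type*) [Field K] [NumberField K] : Set (Idx K → ℝ) := Set.univ.pi fun _ => Set.Ico 0 1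

theorem cube_meas : MeasurableSet (cube K) := MeasurableSet.univ_pi fun _ => measurableSet_Ico

theorem cube_vol : volume (cube K) = 1 := by
  rw [cube, volume_pi_pi]; simp

/-- fractional functionals -/
abbrev G0 (K : Type*) [Field K] [NumberField K] : Type _ := {γ : Idx K → ℝ // γ ∈ cube K ∧ dn γ ≠ ⊥}

noncomputable def chi (γ : Idx K → ℝ) (I : Ideal (𝓞 K)) (hI : dn γ = I) : AddChar (𝓞 K ⧸ I) ℂ where
  toFun x := ec (pr γ x.out)
  map_zero_eq_one' := by
    have : (0 : 𝓞 K ⧸ I).out ∈ I := by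
      rw [← Ideal.Quotient.eq_zero_iff_mem, Ideal.Quotient.mk_out]
    exact ec_pr_dn (hI.symm.le this)
  map_add_eq_mul' x y := by
    have : (x + y).out - (x.out + y.out) ∈ I := by
      rw [← Ideal.Quotient.eq_zero_iff_mem]; simp
    have h := ec_pr_dn (hI.symm.le this)
    have h2 : pr γ (x + y).out = pr γ ((x + y).out - (x.out + y.out)) + (pr γ x.out + pr γ y.out) := by
      rw [pr_sub, pr_add]; ring
    rw [h2, ec_add, h, one_mul, ec_add]

theorem chi_mk (γ : Idx K → ℝ) (I : Ideal (𝓞 K)) (hI : dn γ = I) (x : 𝓞 K) :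
    chi γ I hI (Ideal.Quotient.mk I x) = ec (pr γ x) := by
  change ec (pr γ (Ideal.Quotient.mk I x).out) = _
  have : (Ideal.Quotient.mk I x).out - x ∈ I := by
    rw [← Ideal.Quotient.eq_zero_iff_mem]; simp
  have h := ec_pr_dn (hI.symm.le this)
  have h2 : pr γ (Ideal.Quotient.mk I x).out = pr γ ((Ideal.Quotient.mk I x).out - x) + pr γ x := by
    rw [pr_sub]; ring
  rw [h2, ec_add, h, one_mul]

theorem fiber_card (I : Ideal (𝓞 K)) (hI : I ≠ ⊥) :
    ENat.card {γ : G0 K // dn γ.1 = I} ≤ (Ideal.absNorm I : ℕ∞) := by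
  classical
  have hfin : Finite (𝓞 K ⧸ I) := Ideal.finiteQuotientOfFreeOfNeBot I hI
  let _ : Fintype (𝓞 K ⧸ I) := Fintype.ofFinite _
  let f : {γ : G0 K // dn γ.1 = I} → AddChar (𝓞 K ⧸ I) ℂ := fun γ => chi γ.1.1 I γ.2
  have hf : Function.Injective f := by
    intro γ γ' h
    apply Subtype.ext; apply Subtype.ext
    funext j
    have := congrArg (fun c : AddChar (𝓞 K ⧸ I) ℂ => c (Ideal.Quotient.mk I (bs K j))) h
    simp only [f, chi_mk, pr_bs] at this
    exact ec_inj (γ.1.2.1 j trivial) (γ'.1.2.1 j trivial) this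
  have h1 := ENat.card_le_card_of_injective hf
  refine h1.trans ?_
  have h2 : Nat.card (AddChar (𝓞 K ⧸ I) ℂ) = Nat.card (𝓞 K ⧸ I) := by
    rw [Nat.card_eq_fintype_card, Nat.card_eq_fintype_card, AddChar.card_eq]
  have h3 : Finite (AddChar (𝓞 K ⧸ I) ℂ) := inferInstance
  rw [ENat.card_eq_coe_natCard, h2]
  rw [Ideal.absNorm_apply, Submodule.cardQuot_apply]

theorem sum_G0 (f : ℕ → ℝ≥0∞) : ∑' γ : G0 K, f (Ideal.absNorm (dn γ.1)) ≤
    ∑' I : {I : Ideal (𝓞 K) // I ≠ ⊥}, (Ideal.absNorm I.1 : ℝ≥0∞) * f (Ideal.absNorm I.1) := by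
  let p : G0 K → {I : Ideal (𝓞 K) // I ≠ ⊥} := fun γ => ⟨dn γ.1, γ.2.2⟩
  rw [← (Equiv.sigmaFiberEquiv p).tsum_eq, ENNReal.tsum_sigma']
  refine ENNReal.tsum_le_tsum fun I => ?_
  have h1 : ∀ γ : {γ : G0 K // p γ = I}, f (Ideal.absNorm (dn ((Equiv.sigmaFiberEquiv p) ⟨I, γ⟩).1)) = f (Ideal.absNorm I.1) := by
    intro γ
    have := γ.2
    have h2 : dn γ.1.1 = I.1 := congrArg Subtype.val this
    change f (Ideal.absNorm (dn γ.1.1)) = _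
    rw [h2]
  rw [tsum_congr h1, ENNReal.tsum_const]
  gcongr
  have h3 : ENat.card {γ : G0 K // p γ = I} ≤ (Ideal.absNorm I.1 : ℕ∞) := by
    refine le_trans (le_of_eq ?_) (fiber_card I.1 I.2)
    refine ENat.card_congr (Equiv.subtypeEquivRight fun γ => ?_)
    simp [p, Subtype.ext_iff]
  exact_mod_cast (ENat.toENNReal_le.2 h3)

theorem G0_countable : Countable (G0 K) := by
  have : ∀ γ : G0 K, ∃ N : ℕ, N ≠ 0 ∧ ∃ z : Idx K → ℤ, (N : ℝ) • γ.1 = rv z := by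
    intro γ
    obtain ⟨h, hh, h0⟩ := Submodule.exists_mem_ne_zero_of_ne_bot γ.2.2
    obtain ⟨h', N, hN, e⟩ := exists_inv_mul h h0
    refine ⟨N, hN, ?_⟩
    have : h' * h ∈ dn γ.1 := Ideal.mul_mem_left _ _ hh
    rw [e] at this
    obtain ⟨z, hz⟩ := this
    exact ⟨z, by rw [← hz, natCast_act]⟩
  choose N hN z hz using this
  have hinj : Function.Injective (fun γ : G0 K => (N γ, z γ)) := by
    intro γ γ' h
    simp only [Prod.mk.injEq] at h
    apply Subtype.ext
    have h1 := hz γ; have h2 := hz γ'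
    rw [← h.2, ← h1, ← h.1] at h2
    exact (smul_right_injective _ (by exact_mod_cast hN γ) h2).symm
  exact hinj.countable

theorem unfold_le (f : (Idx K → ℝ) → ℝ≥0∞) (hf : Measurable f) :
    ∫⁻ ξ in cube K, ∑' z : Idx K → ℤ, f (ξ - rv z) ≤ ∫⁻ ξ, f ξ := by
  rw [lintegral_tsum (f := fun z ξ => f (ξ - rv z)) (fun z => (hf.comp (measurable_id.sub_const (rv z))).aemeasurable)]
  have h1 : ∀ z : Idx K → ℤ, ∫⁻ ξ in cube K, f (ξ - rv z) = ∫⁻ ξ in (fun ξ => ξ + rv z) ⁻¹' cube K, f ξ := by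
    intro z
    have hm : MeasurableSet ((fun ξ => ξ + rv z) ⁻¹' cube K) := cube_meas.preimage (measurable_id.add_const _)
    rw [← lintegral_indicator cube_meas, ← lintegral_indicator hm,
      ← lintegral_add_right_eq_self _ (rv z)]
    refine lintegral_congr fun ξ => ?_
    simp only [Set.indicator, Set.mem_preimage, add_sub_cancel_right]
    rfl
  rw [tsum_congr h1, ← lintegral_iUnion]
  · exact setLIntegral_le_lintegral _ _
  · exact fun z => cube_meas.preimage (measurable_id.add_const _)
  · intro z z' hne
    refine Set.disjoint_left.2 fun ξ h h' => hne ?_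
    funext j
    have a := h j trivial; have b := h' j trivial
    simp only [rv, Pi.add_apply, Set.mem_Ico] at a b
    have h1 : ((z j : ℝ)) < z' j + 1 := by linarith
    have h2 : ((z' j : ℝ)) < z j + 1 := by linarith
    have h3 : z j < z' j + 1 := by exact_mod_cast h1
    have h4 : z' j < z j + 1 := by exact_mod_cast h2
    omega

theorem dn_add_rv (γ : Idx K → ℝ) (z : Idx K → ℤ) : dn (γ + rv z) = dn γ := by
  ext h
  simp only [mem_dn, act_add, act_rv]
  constructor
  · rintro ⟨w, hw⟩
    refine ⟨w - actZ h z, ?_⟩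
    have : rv (w - actZ h z) = rv w - rv (actZ h z) := by funext j; simp [rv]
    rw [this, ← hw, add_sub_cancel_right]
  · rintro ⟨w, hw⟩
    exact ⟨w + actZ h z, by rw [hw]; funext j; simp [rv]⟩

theorem exists_reduce (γ : Idx K → ℝ) (h : dn γ ≠ ⊥) : ∃ (γ0 : G0 K) (z : Idx K → ℤ), γ = γ0.1 + rv z := by
  refine ⟨⟨fun j => Int.fract (γ j), fun j _ => ⟨Int.fract_nonneg _, Int.fract_lt_one _⟩, ?_⟩, fun j => ⌊γ j⌋, ?_⟩
  · have : γ = (fun j => Int.fract (γ j)) + rv (fun j => ⌊γ j⌋) := by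
      funext j; simp [rv]
    rw [this, dn_add_rv] at h; exact h
  · funext j; simp [rv]


/-- the smoothing kernel -/
noncomputable def DD (q H : ℕ) (ξ : Idx K → ℝ) : ℂ :=
  ((H : ℂ) ^ Fintype.card (Idx K))⁻¹ * ∑ k : Idx K → Fin H, ec (q * ∑ j, ξ j * ((k j : ℕ) : ℝ))

noncomputable def Psi (q H : ℕ) (ξ : Idx K → ℝ) : ℝ := ‖DD q H ξ‖ ^ 2

theorem ec_continuous : Continuous ec := by unfold ec; fun_prop

theorem DD_continuous (q H : ℕ) : Continuous (DD (K := K) q H) := by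
  unfold DD
  refine continuous_const.mul (continuous_finsetSum _ fun k _ => ec_continuous.comp ?_)
  fun_prop

theorem Psi_continuous (q H : ℕ) : Continuous (Psi (K := K) q H) := (DD_continuous q H).norm.pow 2

theorem norm_one_sub_ec (t : ℝ) : ‖1 - ec t‖ ≤ 2 * Real.pi * |t| := by
  rw [norm_sub_rev, ec, mul_comm _ Complex.I]
  refine (Real.norm_exp_I_mul_ofReal_sub_one_le).trans ?_
  rw [Real.norm_eq_abs, abs_mul, abs_of_nonneg (by positivity)]

theorem card_k (H : ℕ) : (Finset.univ : Finset (Idx K → Fin H)).card = H ^ Fintype.card (Idx K) := by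
  simp

theorem norm_DD_le (q H : ℕ) (hH : 0 < H) (ξ : Idx K → ℝ) : ‖DD q H ξ‖ ≤ 1 := by
  have hH' : (0 : ℝ) < (H : ℝ) ^ Fintype.card (Idx K) := by positivity
  rw [DD, norm_mul, norm_inv, norm_pow, Complex.norm_natCast, inv_mul_le_iff₀ hH', mul_one]
  refine (norm_sum_le _ _).trans ?_
  simp only [norm_ec, Finset.sum_const, card_k]
  simp

theorem Psi_le (q H : ℕ) (hH : 0 < H) (ξ : Idx K → ℝ) : 1 - Psi q H ξ ≤ 4 * Real.pi * (q * H) * ∑ j, |ξ j| := by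
  have hH' : (0 : ℝ) < (H : ℝ) ^ Fintype.card (Idx K) := by positivity
  have hH2 : (H : ℂ) ^ Fintype.card (Idx K) ≠ 0 := by
    have : (H : ℂ) ≠ 0 := by exact_mod_cast hH.ne'
    exact pow_ne_zero _ this
  have h1 := norm_DD_le q H hH ξ
  have h2 : ‖1 - DD q H ξ‖ ≤ 2 * Real.pi * (q * H) * ∑ j, |ξ j| := by
    have e : 1 - DD q H ξ = ((H : ℂ) ^ Fintype.card (Idx K))⁻¹ * ∑ k : Idx K → Fin H, (1 - ec (q * ∑ j, ξ j * ((k j : ℕ) : ℝ))) := by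
      rw [Finset.sum_sub_distrib, Finset.sum_const, card_k, mul_sub, DD]
      simp [hH2]
    rw [e, norm_mul, norm_inv, norm_pow, Complex.norm_natCast, inv_mul_le_iff₀ hH']
    refine (norm_sum_le _ _).trans ?_
    have h3 : ∀ k ∈ (Finset.univ : Finset (Idx K → Fin H)), ‖1 - ec (q * ∑ j, ξ j * ((k j : ℕ) : ℝ))‖ ≤ 2 * Real.pi * (q * H) * ∑ j, |ξ j| := by
      intro k _
      refine (norm_one_sub_ec _).trans ?_
      rw [abs_mul, Nat.abs_cast, mul_assoc (2 * Real.pi), mul_assoc (q : ℝ)]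
      gcongr
      refine (Finset.abs_sum_le_sum_abs _ _).trans ?_
      rw [Finset.mul_sum]
      refine Finset.sum_le_sum fun j _ => ?_
      rw [abs_mul, Nat.abs_cast, mul_comm]
      gcongr
      exact (k j).2.le
    refine (Finset.sum_le_sum h3).trans ?_
    rw [Finset.sum_const, card_k]; simp
  have h4 : 1 - ‖DD q H ξ‖ ≤ ‖1 - DD q H ξ‖ := by
    have := norm_sub_norm_le (1 : ℂ) (DD q H ξ)
    rwa [norm_one] at this
  rw [Psi]
  nlinarith [norm_nonneg (DD q H ξ), norm_nonneg (1 - DD q H ξ)]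

theorem Psi_periodic (q H : ℕ) (ξ γ : Idx K → ℝ) (z : Idx K → ℤ) (hz : (q : ℝ) • γ = rv z) :
    Psi q H (ξ + γ) = Psi q H ξ := by
  rw [Psi, Psi, DD, DD]
  congr 4
  funext k
  have : (q : ℝ) * ∑ j, (ξ + γ) j * ((k j : ℕ) : ℝ) = q * ∑ j, ξ j * ((k j : ℕ) : ℝ) + ((∑ j, z j * (k j : ℕ) : ℤ) : ℝ) := by
    push_cast
    rw [Finset.mul_sum, Finset.mul_sum, ← Finset.sum_add_distrib]
    refine Finset.sum_congr rfl fun j _ => ?_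
    have := congrFun hz j
    simp only [Pi.smul_apply, smul_eq_mul, rv] at this
    rw [← this, Pi.add_apply]; ring
  rw [this, ec_add, ec_int, mul_one]

theorem Psi_nonneg (q H : ℕ) (ξ : Idx K → ℝ) : 0 ≤ Psi q H ξ := by unfold Psi; positivity

theorem Psi_rv (q H : ℕ) (ξ : Idx K → ℝ) (z : Idx K → ℤ) : Psi q H (ξ - rv z) = Psi q H ξ := by
  have : ξ = (ξ - rv z) + rv z := by simp
  conv_rhs => rw [this]
  refine (Psi_periodic q H _ _ ((q : ℤ) • z) ?_).symm
  funext j; simp [rv]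

theorem scale_lintegral (f : (Idx K → ℝ) → ℝ≥0∞) (c : ℝ) (hc : 0 < c) :
    ∫⁻ s, f (c • s) = ENNReal.ofReal ((c ^ Fintype.card (Idx K))⁻¹) * ∫⁻ s, f s := by
  have h := Measure.map_addHaar_smul (volume : Measure (Idx K → ℝ)) hc.ne'
  have h2 := lintegral_map_equiv (μ := volume) f (MeasurableEquiv.smul₀ (α := Idx K → ℝ) c hc.ne')
  have h3 : (⇑(MeasurableEquiv.smul₀ (α := Idx K → ℝ) c hc.ne')) = (c • ·) := rfl
  rw [h3, h, lintegral_smul_measure] at h2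
  rw [← h2, Module.finrank_fintype_fun_eq_card, abs_of_nonneg (by positivity)]
  rfl

theorem enn_small (C δ : ℝ≥0∞) (hC : C ≠ ∞) (hδ : 0 < δ) : ∃ ε, 0 < ε ∧ C * ε ≤ δ := by
  refine ⟨δ / (C + 1), ENNReal.div_pos hδ.ne' (by simp [hC]), ?_⟩
  rw [← mul_div_assoc]
  refine ENNReal.div_le_of_le_mul ?_
  rw [mul_comm]; gcongr; exact le_self_add

end HM

end PartPM

section PartPM2
open NumberField Module MeasureTheory
open scoped ENNReal
namespace HM
variable {K : Type*} [Field K] [NumberField K]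

theorem Gs_scaled (γ : Idx K → ℝ) (R : ℝ) : Measurable fun ξ : Idx K → ℝ => Gs (R ^ 2 • (ξ - γ)) := by
  refine Gs_measurable.comp ?_
  fun_prop

/-- pointwise bound by the sum over all arcs -/
theorem NN_pow_le (c R : ℝ) (hb : ∀ ξ : Idx K → ℝ, NN c R ξ ≤ 1 ∨ ∃ γ : Idx K → ℝ, dn γ ≠ ⊥ ∧ NN c R ξ ≤
      ENNReal.ofReal (20 ^ Fintype.card (Idx K) * R ^ Fintype.card (Idx K) * g0 (R ^ 2 • (ξ - γ)) / Ideal.absNorm (dn γ)))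
    (hR : 1 ≤ R) (ξ : Idx K → ℝ) :
    NN c R ξ ^ (5 / 2 : ℝ) ≤ 1 + ∑' γ : G0 K, ∑' z : Idx K → ℤ,
      ENNReal.ofReal (20 ^ Fintype.card (Idx K) * R ^ Fintype.card (Idx K)) ^ (5 / 2 : ℝ) *
        (Ideal.absNorm (dn γ.1) : ℝ≥0∞) ^ (-(5 / 2) : ℝ) * Gs (R ^ 2 • (ξ - rv z - γ.1)) := by
  rcases hb ξ with h | ⟨γ, hγ, h⟩
  · refine le_trans ?_ le_self_add
    exact ENNReal.rpow_le_one h (by norm_num)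
  · refine le_trans ?_ le_add_self
    obtain ⟨γ0, z, rfl⟩ := exists_reduce γ hγ
    refine le_trans ?_ (ENNReal.le_tsum γ0)
    refine le_trans ?_ (ENNReal.le_tsum z)
    rw [dn_add_rv] at h
    have hN : (0 : ℝ) < Ideal.absNorm (dn γ0.1) := by
      have : Ideal.absNorm (dn γ0.1) ≠ 0 := by rw [Ne, Ideal.absNorm_eq_zero_iff]; exact γ0.2.2
      exact_mod_cast Nat.pos_of_ne_zero this
    have e : ENNReal.ofReal (20 ^ Fintype.card (Idx K) * R ^ Fintype.card (Idx K) * g0 (R ^ 2 • (ξ - (γ0.1 + rv z))) / Ideal.absNorm (dn γ0.1))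
      = ENNReal.ofReal (20 ^ Fintype.card (Idx K) * R ^ Fintype.card (Idx K)) * (Ideal.absNorm (dn γ0.1) : ℝ≥0∞)⁻¹ *
        ENNReal.ofReal (g0 (R ^ 2 • (ξ - rv z - γ0.1))) := by
      have : ξ - (γ0.1 + rv z) = ξ - rv z - γ0.1 := by abel
      rw [this, div_eq_mul_inv, mul_right_comm, ENNReal.ofReal_mul (by positivity), ENNReal.ofReal_mul (by positivity),
        ENNReal.ofReal_inv_of_pos hN, ENNReal.ofReal_natCast]
    rw [e] at h
    refine (ENNReal.rpow_le_rpow h (by norm_num)).trans ?_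
    rw [ENNReal.mul_rpow_of_nonneg _ _ (by norm_num), ENNReal.mul_rpow_of_nonneg _ _ (by norm_num), Gs,
      ENNReal.inv_rpow, ENNReal.rpow_neg]

theorem R_calc (n : ℕ) (R : ℝ) (hR : 1 ≤ R) :
    ENNReal.ofReal (20 ^ n * R ^ n) ^ (5 / 2 : ℝ) * ENNReal.ofReal ((((R ^ 2) ^ n))⁻¹) =
    ENNReal.ofReal (20 ^ n) ^ (5 / 2 : ℝ) * ENNReal.ofReal (R ^ ((n : ℝ) / 2)) := by
  have hR0 : 0 < R := by linarith
  rw [ENNReal.ofReal_mul (by positivity), ENNReal.mul_rpow_of_nonneg _ _ (by norm_num), mul_assoc]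
  congr 1
  rw [ENNReal.ofReal_rpow_of_nonneg (by positivity) (by norm_num), ← ENNReal.ofReal_mul (by positivity)]
  congr 1
  rw [← pow_mul, ← Real.rpow_natCast, ← Real.rpow_natCast, ← Real.rpow_mul hR0.le, ← Real.rpow_neg hR0.le, ← Real.rpow_add hR0]
  congr 1
  push_cast; ring

/-- contribution of one arc -/
theorem arc (q H : ℕ) (hH : 0 < H) (R : ℝ) (hR : 1 ≤ R) (T : ℕ) (hT : 1 ≤ T) (hRq : R ^ 2 = T * q * H) (γ : Idx K → ℝ) :
    (∫⁻ ξ in cube K, ∑' z : Idx K → ℤ, ENNReal.ofReal (1 - Psi q H ξ) * Gs (R ^ 2 • (ξ - rv z - γ)) ≤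
      ENNReal.ofReal ((((R ^ 2) ^ Fintype.card (Idx K)))⁻¹) * ∫⁻ s : Idx K → ℝ, Gs s) ∧
    ((∃ z : Idx K → ℤ, (q : ℝ) • γ = rv z) →
      ∫⁻ ξ in cube K, ∑' z : Idx K → ℤ, ENNReal.ofReal (1 - Psi q H ξ) * Gs (R ^ 2 • (ξ - rv z - γ)) ≤
      ENNReal.ofReal ((((R ^ 2) ^ Fintype.card (Idx K)))⁻¹) *
        ∫⁻ s : Idx K → ℝ, ENNReal.ofReal (min 1 (4 * Real.pi * (∑ j, |s j|) / T)) * Gs s) := by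
  have hm : Measurable fun ξ : Idx K → ℝ => ENNReal.ofReal (1 - Psi q H ξ) * Gs (R ^ 2 • (ξ - γ)) := by
    refine Measurable.mul ?_ (Gs_scaled γ R)
    exact (measurable_const.sub (Psi_continuous q H).measurable).ennreal_ofReal
  have h0 : ∫⁻ ξ in cube K, ∑' z : Idx K → ℤ, ENNReal.ofReal (1 - Psi q H ξ) * Gs (R ^ 2 • (ξ - rv z - γ)) ≤
      ∫⁻ s : Idx K → ℝ, ENNReal.ofReal (1 - Psi q H (s + γ)) * Gs (R ^ 2 • s) := by
    have h1 := unfold_le _ hm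
    simp only [Psi_rv] at h1
    refine h1.trans (le_of_eq ?_)
    rw [← lintegral_add_right_eq_self _ γ]
    simp only [add_sub_cancel_right]
  have hR2 : 0 < R ^ 2 := by positivity
  refine ⟨h0.trans ?_, fun ⟨z, hz⟩ => h0.trans ?_⟩
  · rw [← scale_lintegral _ _ hR2]
    refine lintegral_mono fun s => mul_le_of_le_one_left' ?_
    rw [← ENNReal.ofReal_one]
    exact ENNReal.ofReal_le_ofReal (by linarith [Psi_nonneg q H (s + γ)])
  · rw [← scale_lintegral (fun s => ENNReal.ofReal (min 1 (4 * Real.pi * (∑ j, |s j|) / T)) * Gs s) _ hR2]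
    refine lintegral_mono fun s => ?_
    refine mul_le_mul_left (ENNReal.ofReal_le_ofReal ?_) _
    rw [Psi_periodic q H s γ z hz]
    refine le_min (by linarith [Psi_nonneg q H s]) ((Psi_le q H hH s).trans (le_of_eq ?_))
    have : ∑ j, |(R ^ 2 • s) j| = R ^ 2 * ∑ j, |s j| := by
      rw [Finset.mul_sum]
      refine Finset.sum_congr rfl fun j _ => ?_
      rw [Pi.smul_apply, smul_eq_mul, abs_mul, abs_of_pos hR2]
    rw [this, hRq]
    have hT' : (T : ℝ) ≠ 0 := by positivity
    field_simp

theorem minor (c : ℝ) (hb : ∀ (R : ℝ) (_ : 1 ≤ R) (ξ : Idx K → ℝ),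
    NN c R ξ ≤ 1 ∨ ∃ γ : Idx K → ℝ, dn γ ≠ ⊥ ∧ NN c R ξ ≤
      ENNReal.ofReal (20 ^ Fintype.card (Idx K) * R ^ Fintype.card (Idx K) * g0 (R ^ 2 • (ξ - γ)) / Ideal.absNorm (dn γ)))
    (δ : ℝ≥0∞) (hδ : 0 < δ) : ∃ T0 T : ℕ, 1 ≤ T ∧ ∀ q H : ℕ, 0 < q → 0 < H → T0.factorial ∣ q → ∀ R : ℝ, 1 ≤ R →
      R ^ 2 = T * q * H →
      ∫⁻ ξ in cube K, ENNReal.ofReal (1 - Psi q H ξ) * NN c R ξ ^ (5 / 2 : ℝ) ≤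
        1 + δ * ENNReal.ofReal (R ^ ((Fintype.card (Idx K) : ℝ) / 2)) := by
  classical
  set n := Fintype.card (Idx K) with hn
  set C0 : ℝ≥0∞ := ENNReal.ofReal (20 ^ n) ^ (5 / 2 : ℝ) with hC0
  have hC0t : C0 ≠ ∞ := ENNReal.rpow_ne_top_of_nonneg (by norm_num) ENNReal.ofReal_ne_top
  set S : ℝ≥0∞ := ∑' I : {I : Ideal (𝓞 K) // I ≠ ⊥}, (Ideal.absNorm I.1 : ℝ≥0∞) ^ (-(3 / 2) : ℝ) with hS
  have hSt : S ≠ ∞ := ideal_sum K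
  set I0 : ℝ≥0∞ := ∫⁻ s : Idx K → ℝ, Gs s with hI0
  have hI0t : I0 ≠ ∞ := Gs_lintegral K
  obtain ⟨ε1, hε1, h1⟩ := enn_small (C0 * S) (δ / 2) (ENNReal.mul_ne_top hC0t hSt) (ENNReal.half_pos hδ.ne')
  obtain ⟨ε2, hε2, h2⟩ := enn_small (C0 * I0) (δ / 2) (ENNReal.mul_ne_top hC0t hI0t) (ENNReal.half_pos hδ.ne')
  obtain ⟨T0, hT0⟩ := ideal_tail K ε2 hε2
  obtain ⟨T, hT, hTs⟩ := Gs_small K ε1 hε1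
  refine ⟨T0, T, hT, fun q H hq hH hdvd R hR hRq => ?_⟩
  set A : ℝ≥0∞ := ENNReal.ofReal (20 ^ n * R ^ n) ^ (5 / 2 : ℝ) with hA
  have hPm : Measurable fun ξ : Idx K → ℝ => ENNReal.ofReal (1 - Psi q H ξ) :=
    (measurable_const.sub (Psi_continuous q H).measurable).ennreal_ofReal
  have hcount := G0_countable (K := K)
  have step1 : ∫⁻ ξ in cube K, ENNReal.ofReal (1 - Psi q H ξ) * NN c R ξ ^ (5 / 2 : ℝ) ≤
      ∫⁻ ξ in cube K, (1 + ∑' γ : G0 K, A * (Ideal.absNorm (dn γ.1) : ℝ≥0∞) ^ (-(5 / 2) : ℝ) *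
        ∑' z : Idx K → ℤ, ENNReal.ofReal (1 - Psi q H ξ) * Gs (R ^ 2 • (ξ - rv z - γ.1))) := by
    refine lintegral_mono fun ξ => ?_
    refine (mul_le_mul_right (NN_pow_le c R (hb R hR) hR ξ) _).trans ?_
    rw [mul_add, mul_one]
    refine add_le_add ?_ ?_
    · rw [← ENNReal.ofReal_one]
      exact ENNReal.ofReal_le_ofReal (by linarith [Psi_nonneg q H ξ])
    · rw [← ENNReal.tsum_mul_left]
      refine ENNReal.tsum_le_tsum fun γ => ?_
      rw [← ENNReal.tsum_mul_left, ← ENNReal.tsum_mul_left]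
      refine ENNReal.tsum_le_tsum fun z => le_of_eq ?_
      ring
  refine step1.trans ?_
  have hzm : ∀ γ : G0 K, Measurable fun ξ : Idx K → ℝ => ∑' z : Idx K → ℤ, ENNReal.ofReal (1 - Psi q H ξ) * Gs (R ^ 2 • (ξ - rv z - γ.1)) := by
    intro γ
    refine Measurable.tsum fun z => hPm.mul ?_
    have := Gs_scaled (rv z + γ.1) R
    simpa only [sub_sub] using this
  rw [lintegral_add_left measurable_const, setLIntegral_const, one_mul, cube_vol,
    lintegral_tsum (fun γ => ((hzm γ).const_mul _).aemeasurable)]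
  refine add_le_add le_rfl ?_
  have step2 : ∀ γ : G0 K, ∫⁻ ξ in cube K, A * (Ideal.absNorm (dn γ.1) : ℝ≥0∞) ^ (-(5 / 2) : ℝ) *
        ∑' z : Idx K → ℤ, ENNReal.ofReal (1 - Psi q H ξ) * Gs (R ^ 2 • (ξ - rv z - γ.1)) ≤
      C0 * ENNReal.ofReal (R ^ ((n : ℝ) / 2)) * ((Ideal.absNorm (dn γ.1) : ℝ≥0∞) ^ (-(5 / 2) : ℝ) * ε1 +
        (if Ideal.absNorm (dn γ.1) ≤ T0 then 0 else (Ideal.absNorm (dn γ.1) : ℝ≥0∞) ^ (-(5 / 2) : ℝ)) * I0) := by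
    intro γ
    rw [lintegral_const_mul _ (hzm γ)]
    obtain ⟨a1, a2⟩ := arc q H hH R hR T hT hRq γ.1
    have key : ∀ X : ℝ≥0∞, A * (Ideal.absNorm (dn γ.1) : ℝ≥0∞) ^ (-(5 / 2) : ℝ) * (ENNReal.ofReal ((((R ^ 2) ^ n))⁻¹) * X) =
        C0 * ENNReal.ofReal (R ^ ((n : ℝ) / 2)) * ((Ideal.absNorm (dn γ.1) : ℝ≥0∞) ^ (-(5 / 2) : ℝ) * X) := by
      intro X
      rw [hC0, ← R_calc n R hR, hA]; ring
    split_ifs with hN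
    · rw [zero_mul, add_zero]
      have hintg : ∃ z : Idx K → ℤ, (q : ℝ) • γ.1 = rv z := by
        have h3 : Ideal.absNorm (dn γ.1) ≠ 0 := by rw [Ne, Ideal.absNorm_eq_zero_iff]; exact γ.2.2
        have h4 : Ideal.absNorm (dn γ.1) ∣ q := (Nat.dvd_factorial (Nat.pos_of_ne_zero h3) hN).trans hdvd
        have h5 : (q : 𝓞 K) ∈ dn γ.1 := by
          obtain ⟨d, rfl⟩ := h4
          push_cast
          exact Ideal.mul_mem_right _ _ (Ideal.absNorm_mem _)
        obtain ⟨z, hz⟩ := h5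
        exact ⟨z, by rw [← hz, natCast_act]⟩
      refine (mul_le_mul_right (a2 hintg) _).trans ?_
      rw [key]
      gcongr
    · refine (mul_le_mul_right a1 _).trans ?_
      rw [key]
      gcongr
      exact le_add_self
  refine (ENNReal.tsum_le_tsum step2).trans ?_
  rw [ENNReal.tsum_mul_left, ENNReal.tsum_add, ENNReal.tsum_mul_right, ENNReal.tsum_mul_right]
  have e : ∀ I : {I : Ideal (𝓞 K) // I ≠ ⊥}, (Ideal.absNorm I.1 : ℝ≥0∞) * (Ideal.absNorm I.1 : ℝ≥0∞) ^ (-(5 / 2) : ℝ) = (Ideal.absNorm I.1 : ℝ≥0∞) ^ (-(3 / 2) : ℝ) := by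
    intro I
    have h3 : Ideal.absNorm I.1 ≠ 0 := by rw [Ne, Ideal.absNorm_eq_zero_iff]; exact I.2
    conv_lhs => rw [← ENNReal.rpow_one (Ideal.absNorm I.1 : ℝ≥0∞), ← ENNReal.rpow_mul, ← ENNReal.rpow_add _ _ (by exact_mod_cast h3) (ENNReal.natCast_ne_top _)]
    norm_num
  have b1 := sum_G0 (K := K) fun N => (N : ℝ≥0∞) ^ (-(5 / 2) : ℝ)
  have b2 := sum_G0 (K := K) fun N => if N ≤ T0 then 0 else (N : ℝ≥0∞) ^ (-(5 / 2) : ℝ)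
  rw [tsum_congr e] at b1
  have b3 := b2.trans (le_trans (le_of_eq (tsum_congr fun I => by rw [mul_ite, mul_zero, e])) hT0)
  calc C0 * ENNReal.ofReal (R ^ ((n : ℝ) / 2)) * _ ≤ C0 * ENNReal.ofReal (R ^ ((n : ℝ) / 2)) * (S * ε1 + ε2 * I0) := by
        gcongr
    _ = (C0 * S * ε1 + C0 * I0 * ε2) * ENNReal.ofReal (R ^ ((n : ℝ) / 2)) := by ring
    _ ≤ (δ / 2 + δ / 2) * ENNReal.ofReal (R ^ ((n : ℝ) / 2)) := by gcongr
    _ = _ := by rw [ENNReal.add_halves]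

end HM

end PartPM2

section PartPF
open NumberField Module MeasureTheory
open scoped ENNReal
namespace HM
variable {K : Type*} [Field K] [NumberField K]

instance : Countable (𝓞 K) := (coEquiv (K := K)).injective.countable

theorem int_ec (n : ℤ) : ∫ t in Set.Ico (0 : ℝ) 1, ec (t * n) = if n = 0 then 1 else 0 := by
  rw [integral_Ico_eq_integral_Ioo, ← integral_Ioc_eq_integral_Ioo, ← intervalIntegral.integral_of_le zero_le_one]
  split_ifs with h
  · simp [h, ec_zero]
  · have hc : (2 * Real.pi * n * Complex.I : ℂ) ≠ 0 := by
      have : (n : ℂ) ≠ 0 := by exact_mod_cast h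
      have h2 : (Real.pi : ℂ) ≠ 0 := by exact_mod_cast Real.pi_ne_zero
      simp [this, h2]
    have e : ∀ t : ℝ, ec (t * n) = Complex.exp ((2 * Real.pi * n * Complex.I : ℂ) * t) := by
      intro t; rw [ec]; congr 1; push_cast; ring
    simp only [e]
    rw [integral_exp_mul_complex hc]
    have e2 : Complex.exp ((2 * Real.pi * n * Complex.I : ℂ) * (1 : ℝ)) = 1 := by
      rw [← e, one_mul, ec_int]
    rw [e2]; simp

open Classical in
theorem int_pr (y : 𝓞 K) : ∫ ξ in cube K, ec (pr ξ y) = if y = 0 then 1 else 0 := by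
  classical
  have h1 : ∀ ξ : Idx K → ℝ, ec (pr ξ y) = ∏ j, ec (ξ j * (co y j : ℝ)) := by
    intro ξ; rw [pr, ec_sum]
  simp only [h1]
  rw [cube, volume_pi, Measure.restrict_pi_pi,
    integral_fintype_prod_eq_prod (fun j (t : ℝ) => ec (t * (co y j : ℝ)))]
  simp only [int_ec]
  split_ifs with h
  · subst h; simp [co_zero]
  · have : ∃ j, co y j ≠ 0 := by
      by_contra! hc; exact h (co_eq_zero hc)
    obtain ⟨j, hj⟩ := this
    exact Finset.prod_eq_zero (Finset.mem_univ j) (by simp [hj])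

variable {m : ℕ}

/-- product weight -/
noncomputable def WW (R : ℝ) (x : Fin m → 𝓞 K) : ℝ := ∏ i, wt R (x i)

/-- the quadratic form -/
noncomputable def qf (a : Fin m → 𝓞 K) (x : Fin m → 𝓞 K) : 𝓞 K := ∑ i, a i * x i ^ 2

noncomputable def FF (a : Fin m → 𝓞 K) (R : ℝ) (ξ : Idx K → ℝ) : ℂ := ∏ i, theta (a i) R ξ

theorem prod_thf (a : Fin m → 𝓞 K) (R : ℝ) (ξ : Idx K → ℝ) (x : Fin m → 𝓞 K) :
    ∏ i, thf (a i) R ξ (x i) = (WW R x : ℂ) * ec (pr ξ (qf a x)) := by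
  simp only [thf, Finset.prod_mul_distrib, WW, qf, pr_sum, ec_sum]
  push_cast; rfl

theorem WW_pos (R : ℝ) (x : Fin m → 𝓞 K) : 0 < WW R x := Finset.prod_pos fun _ _ => wt_pos _ _

theorem summable_WW (R : ℝ) (hR : 0 < R) : Summable fun x : Fin m → 𝓞 K => WW R x := by
  have h := (prod_sum (fun i : Fin m => thf (0 : 𝓞 K) R 0) (fun i => summable_norm_thf _ R hR _)).1
  refine h.congr fun x => ?_
  rw [prod_thf (fun _ => 0), norm_mul, norm_ec, mul_one, Complex.norm_real, Real.norm_of_nonneg (WW_pos _ _).le]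

theorem FF_eq (a : Fin m → 𝓞 K) (R : ℝ) (hR : 0 < R) (ξ : Idx K → ℝ) :
    FF a R ξ = ∑' x : Fin m → 𝓞 K, (WW R x : ℂ) * ec (pr ξ (qf a x)) := by
  have h := (prod_sum (fun i : Fin m => thf (a i) R ξ) (fun i => summable_norm_thf _ R hR _)).2
  rw [FF]; simp only [theta]; rw [← h]
  exact tsum_congr fun x => prod_thf a R ξ x

theorem norm_term (R : ℝ) (x : Fin m → 𝓞 K) (t : ℝ) : ‖(WW R x : ℂ) * ec t‖ = WW R x := by
  rw [norm_mul, norm_ec, mul_one, Complex.norm_real, Real.norm_of_nonneg (WW_pos _ _).le]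

theorem pr_continuous (y : 𝓞 K) : Continuous fun ξ : Idx K → ℝ => pr ξ y := by
  unfold pr; fun_prop

theorem FF_continuous (a : Fin m → 𝓞 K) (R : ℝ) (hR : 0 < R) : Continuous (FF a R) := by
  have : FF a R = fun ξ => ∑' x : Fin m → 𝓞 K, (WW R x : ℂ) * ec (pr ξ (qf a x)) := funext fun ξ => FF_eq a R hR ξ
  rw [this]
  refine continuous_tsum (u := fun x => WW R x) (fun x => ?_) (summable_WW R hR) (fun x ξ => (norm_term _ _ _).le)
  exact continuous_const.mul (ec_continuous.comp (pr_continuous _))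

theorem FF_bound (a : Fin m → 𝓞 K) (R : ℝ) (hR : 0 < R) (ξ : Idx K → ℝ) :
    ‖FF a R ξ‖ ≤ ∑' x : Fin m → 𝓞 K, WW R x := by
  rw [FF_eq a R hR]
  refine tsum_of_norm_bounded (summable_WW R hR).hasSum fun x => (norm_term _ _ _).le

theorem cube_int {f : (Idx K → ℝ) → ℂ} (hf : Continuous f) (C : ℝ) (hC : ∀ ξ, ‖f ξ‖ ≤ C) : IntegrableOn f (cube K) := by
  refine Measure.integrableOn_of_bounded (M := C) ?_ hf.aestronglyMeasurable (Filter.Eventually.of_forall hC)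
  rw [cube_vol]; simp

/-- weighted number of representations -/
noncomputable def rep (a : Fin m → 𝓞 K) (R : ℝ) (y : 𝓞 K) : ℝ :=
  open Classical in ∑' x : Fin m → 𝓞 K, if qf a x = y then WW R x else 0

theorem int_FF (a : Fin m → 𝓞 K) (R : ℝ) (hR : 0 < R) (y : 𝓞 K) :
    ∫ ξ in cube K, FF a R ξ * ec (pr ξ (-y)) = rep a R y := by
  classical
  have h1 : ∀ ξ, FF a R ξ * ec (pr ξ (-y)) = ∑' x : Fin m → 𝓞 K, (WW R x : ℂ) * ec (pr ξ (qf a x - y)) := by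
    intro ξ
    rw [FF_eq a R hR, ← tsum_mul_right]
    refine tsum_congr fun x => ?_
    rw [mul_assoc, ← ec_add, ← pr_add, sub_eq_add_neg]
  simp only [h1]
  have hcont : ∀ x : Fin m → 𝓞 K, Continuous fun ξ => (WW R x : ℂ) * ec (pr ξ (qf a x - y)) := fun x =>
    continuous_const.mul (ec_continuous.comp (pr_continuous _))
  have h2 := integral_tsum_of_summable_integral_norm (μ := volume.restrict (cube K)) (F := fun (x : Fin m → 𝓞 K) ξ => (WW R x : ℂ) * ec (pr ξ (qf a x - y)))
    (fun x => cube_int (hcont x) (WW R x) fun ξ => (norm_term _ _ _).le)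
    (by
      simp only [norm_term, integral_const]
      have : (volume.restrict (cube K)).real Set.univ = 1 := by simp [Measure.real, cube_vol]
      simp only [this, one_smul]
      exact summable_WW R hR)
  rw [← h2, rep, Complex.ofReal_tsum]
  refine tsum_congr fun x => ?_
  rw [integral_const_mul, int_pr]
  simp only [sub_eq_zero]
  split_ifs <;> simp

theorem rep_zero (a : Fin m → 𝓞 K) (R : ℝ) (h : ∀ x, qf a x = 0 → x = 0) : rep a R 0 = 1 := by
  classical
  rw [rep, tsum_eq_single 0]
  · have : qf a 0 = 0 := by simp [qf]
    simp only [this, if_true, WW, wt, Pi.zero_apply, co_zero]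
    simp
  · intro x hx
    rw [if_neg fun hh => hx (h x hh)]

theorem Psi_eq (q H : ℕ) (ξ : Idx K → ℝ) : (Psi q H ξ : ℂ) = ((H : ℂ) ^ Fintype.card (Idx K))⁻¹ ^ 2 *
    ∑ k : Idx K → Fin H, ∑ k' : Idx K → Fin H,
      ec (pr ξ (-((q : 𝓞 K) * (el (fun j => ((k' j : ℕ) : ℤ)) - el (fun j => ((k j : ℕ) : ℤ)))))) := by
  have h1 : ∀ k : Idx K → Fin H, (q : ℝ) * ∑ j, ξ j * ((k j : ℕ) : ℝ) = pr ξ ((q : 𝓞 K) * el (fun j => ((k j : ℕ) : ℤ))) := by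
    intro k
    rw [pr, Finset.mul_sum]
    refine Finset.sum_congr rfl fun j _ => ?_
    rw [co_natCast_mul, co_el]; push_cast; ring
  rw [Psi, Complex.ofReal_pow, ← Complex.mul_conj', DD]
  simp only [h1, map_mul, map_inv₀, map_pow, map_natCast, map_sum, ec_conj]
  rw [mul_mul_mul_comm, ← sq, Finset.sum_mul_sum]
  congr 1
  refine Finset.sum_congr rfl fun k _ => Finset.sum_congr rfl fun k' _ => ?_
  rw [← ec_add]
  congr 1
  rw [mul_sub, neg_sub, pr_sub]; ring

theorem identity (a : Fin m → 𝓞 K) (R : ℝ) (hR : 0 < R) (h : ∀ x, qf a x = 0 → x = 0) (q H : ℕ) (hH : 0 < H) :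
    ENNReal.ofReal (((H : ℝ) ^ Fintype.card (Idx K))⁻¹ ^ 2 * ∑ k : Idx K → Fin H, ∑ k' : Idx K → Fin H,
      rep a R ((q : 𝓞 K) * (el (fun j => ((k' j : ℕ) : ℤ)) - el (fun j => ((k j : ℕ) : ℤ))))) ≤
    1 + ∫⁻ ξ in cube K, ENNReal.ofReal (1 - Psi q H ξ) * ‖FF a R ξ‖ₑ := by
  classical
  have hc := FF_continuous a R hR
  have hb := FF_bound a R hR
  have hP1 : ∀ ξ : Idx K → ℝ, Psi q H ξ ≤ 1 := fun ξ => by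
    have := norm_DD_le q H hH ξ
    rw [Psi]; nlinarith [norm_nonneg (DD q H ξ)]
  have i1 : IntegrableOn (FF a R) (cube K) := cube_int hc _ hb
  have i2 : IntegrableOn (fun ξ => FF a R ξ * (Psi q H ξ : ℂ)) (cube K) := by
    refine cube_int (hc.mul (Complex.continuous_ofReal.comp (Psi_continuous q H))) (∑' x : Fin m → 𝓞 K, WW R x) fun ξ => ?_
    rw [norm_mul, Complex.norm_real, Real.norm_of_nonneg (Psi_nonneg _ _ _)]
    refine le_trans ?_ (hb ξ)
    exact mul_le_of_le_one_right (norm_nonneg _) (hP1 ξ)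
  have e1 : ∫ ξ in cube K, FF a R ξ = 1 := by
    have := int_FF a R hR 0
    rw [rep_zero a R h] at this
    simpa [pr_zero, ec_zero] using this
  have e2 : ∫ ξ in cube K, FF a R ξ * (Psi q H ξ : ℂ) = ((((H : ℝ) ^ Fintype.card (Idx K))⁻¹ ^ 2 * ∑ k : Idx K → Fin H, ∑ k' : Idx K → Fin H,
      rep a R ((q : 𝓞 K) * (el (fun j => ((k' j : ℕ) : ℤ)) - el (fun j => ((k j : ℕ) : ℤ)))) : ℝ) : ℂ) := by
    have hintg : ∀ y : 𝓞 K, IntegrableOn (fun ξ => FF a R ξ * ec (pr ξ y)) (cube K) := by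
      intro y
      refine cube_int (hc.mul (ec_continuous.comp (pr_continuous y))) (∑' x : Fin m → 𝓞 K, WW R x) fun ξ => ?_
      rw [norm_mul, norm_ec, mul_one]; exact hb ξ
    have e3 : ∀ ξ, FF a R ξ * (Psi q H ξ : ℂ) = ((H : ℂ) ^ Fintype.card (Idx K))⁻¹ ^ 2 *
      ∑ k : Idx K → Fin H, ∑ k' : Idx K → Fin H,
       FF a R ξ * ec (pr ξ (-((q : 𝓞 K) * (el (fun j => ((k' j : ℕ) : ℤ)) - el (fun j => ((k j : ℕ) : ℤ)))))) := by
      intro ξ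
      rw [Psi_eq, mul_left_comm, Finset.mul_sum]
      simp only [Finset.mul_sum]
    simp only [e3]
    rw [integral_const_mul, integral_finsetSum _ fun k _ => integrable_finsetSum _ fun k' _ => hintg _]
    push_cast
    congr 1
    refine Finset.sum_congr rfl fun k _ => ?_
    rw [integral_finsetSum _ fun k' _ => hintg _]
    refine Finset.sum_congr rfl fun k' _ => ?_
    exact int_FF a R hR _
  set X : ℝ := _ * ∑ k : Idx K → Fin H, ∑ k' : Idx K → Fin H, rep a R _ with hX
  have hX0 : 0 ≤ X := by
    rw [hX]
    refine mul_nonneg (by positivity) (Finset.sum_nonneg fun k _ => Finset.sum_nonneg fun k' _ => ?_)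
    rw [rep]
    refine tsum_nonneg fun x => ?_
    split_ifs
    exacts [(WW_pos _ _).le, le_rfl]
  have e4 : (1 : ℂ) - X = ∫ ξ in cube K, (FF a R ξ - FF a R ξ * (Psi q H ξ : ℂ)) := by
    rw [integral_sub i1 i2, e1, e2]
  have e5 : ENNReal.ofReal X = ‖(X : ℂ)‖ₑ := by
    rw [← ofReal_norm, Complex.norm_real, Real.norm_of_nonneg hX0]
  rw [e5]
  have e6 : (X : ℂ) = 1 - (1 - X) := by ring
  rw [e6]
  refine (enorm_sub_le).trans ?_
  refine add_le_add (by simp) ?_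
  rw [e4]
  refine (enorm_integral_le_lintegral_enorm _).trans ?_
  refine lintegral_mono fun ξ => le_of_eq ?_
  have : FF a R ξ - FF a R ξ * (Psi q H ξ : ℂ) = ((1 - Psi q H ξ : ℝ) : ℂ) * FF a R ξ := by push_cast; ring
  rw [this, enorm_mul]
  congr 1
  rw [← ofReal_norm, Complex.norm_real, Real.norm_of_nonneg (by linarith [hP1 ξ])]


theorem pair_count (H : ℕ) (v : Idx K → ℤ) (hv : ∀ j, 2 * |v j| ≤ H) :
    ((H : ℝ) / 2) ^ Fintype.card (Idx K) ≤
      ∑ k : Idx K → Fin H, ∑ k' : Idx K → Fin H, (open Classical in if (v = fun j => ((k' j : ℕ) : ℤ) - ((k j : ℕ) : ℤ)) then (1 : ℝ) else 0) := by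
  classical
  rw [← Finset.sum_product', Finset.univ_product_univ, Finset.sum_boole]
  set L : ℕ := H - H / 2 with hL
  have hbd : ∀ j (i : Fin L), ((i : ℕ) + (-v j).toNat < H) ∧ ((i : ℕ) + (v j).toNat < H) := by
    intro j i
    have := hv j; have h2 := i.2
    rcases abs_cases (v j) with h | h <;> omega
  let f : (Idx K → Fin L) → (Idx K → Fin H) × (Idx K → Fin H) := fun i =>
    (fun j => ⟨(i j : ℕ) + (-v j).toNat, (hbd j (i j)).1⟩, fun j => ⟨(i j : ℕ) + (v j).toNat, (hbd j (i j)).2⟩)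
  have hcard : (Finset.univ : Finset (Idx K → Fin L)).card ≤
      (Finset.univ.filter fun p : (Idx K → Fin H) × (Idx K → Fin H) => v = fun j => ((p.2 j : ℕ) : ℤ) - ((p.1 j : ℕ) : ℤ)).card := by
    refine Finset.card_le_card_of_injOn f ?_ ?_
    · intro i _
      simp only [Finset.coe_filter, Finset.mem_univ, true_and, Set.mem_ofPred_eq, f]
      funext j
      push_cast
      have : ((v j).toNat : ℤ) - ((-v j).toNat : ℤ) = v j := Int.toNat_sub_toNat_neg (v j)
      omega
    · intro i _ i' _ h
      funext j
      have := congrFun (congrArg Prod.fst h) j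
      simp only [f, Fin.mk.injEq] at this
      exact Fin.ext (by omega)
  rw [card_k] at hcard
  have hLr : (H : ℝ) / 2 ≤ L := by
    have : H ≤ 2 * L := by omega
    have : (H : ℝ) ≤ 2 * L := by exact_mod_cast this
    linarith
  refine (pow_le_pow_left₀ (by positivity) hLr _).trans ?_
  exact_mod_cast hcard

theorem rep_lower (a : Fin m → 𝓞 K) (R : ℝ) (hR : 0 < R) (q H : ℕ) (hH : 0 < H) (X : Finset (Fin m → 𝓞 K))
    (hX : ∀ x ∈ X, ∃ v : Idx K → ℤ, qf a x = (q : 𝓞 K) * el v ∧ ∀ j, 2 * |v j| ≤ H) :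
    (∑ x ∈ X, WW R x) * ((2 * H : ℝ) ^ Fintype.card (Idx K))⁻¹ ≤
    ((H : ℝ) ^ Fintype.card (Idx K))⁻¹ ^ 2 * ∑ k : Idx K → Fin H, ∑ k' : Idx K → Fin H,
      rep a R ((q : 𝓞 K) * (el (fun j => ((k' j : ℕ) : ℤ)) - el (fun j => ((k j : ℕ) : ℤ)))) := by
  classical
  have hsub : ∀ k k' : Idx K → Fin H, (el (fun j => ((k' j : ℕ) : ℤ)) - el (fun j => ((k j : ℕ) : ℤ)) : 𝓞 K) =
      el (fun j => ((k' j : ℕ) : ℤ) - ((k j : ℕ) : ℤ)) := by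
    intro k k'
    simp [el, sub_mul, Finset.sum_sub_distrib]
  have h1 : ∀ y, ∑ x ∈ X, (if qf a x = y then WW R x else 0) ≤ rep a R y := by
    intro y
    rw [rep]
    have hs : Summable fun x : Fin m → 𝓞 K => if qf a x = y then WW R x else 0 := by
      refine Summable.of_nonneg_of_le (fun x => ?_) (fun x => ?_) (summable_WW R hR)
      · split_ifs
        exacts [(WW_pos _ _).le, le_rfl]
      · split_ifs
        exacts [le_rfl, (WW_pos _ _).le]
    refine le_trans (le_of_eq ?_) (hs.sum_le_tsum X fun x _ => ?_)
    · rfl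
    · split_ifs
      exacts [(WW_pos _ _).le, le_rfl]
  have h2 : (∑ x ∈ X, WW R x) * ((H : ℝ) / 2) ^ Fintype.card (Idx K) ≤ ∑ k : Idx K → Fin H, ∑ k' : Idx K → Fin H,
      rep a R ((q : 𝓞 K) * (el (fun j => ((k' j : ℕ) : ℤ)) - el (fun j => ((k j : ℕ) : ℤ)))) := by
    calc _ = ∑ x ∈ X, WW R x * ((H : ℝ) / 2) ^ Fintype.card (Idx K) := Finset.sum_mul _ _ _
      _ ≤ ∑ x ∈ X, ∑ k : Idx K → Fin H, ∑ k' : Idx K → Fin H,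
          (if qf a x = (q : 𝓞 K) * (el (fun j => ((k' j : ℕ) : ℤ)) - el (fun j => ((k j : ℕ) : ℤ))) then WW R x else 0) := by
        refine Finset.sum_le_sum fun x hx => ?_
        obtain ⟨v, hv1, hv2⟩ := hX x hx
        refine (mul_le_mul_of_nonneg_left (pair_count H v hv2) (WW_pos R x).le).trans ?_
        rw [Finset.mul_sum]
        refine Finset.sum_le_sum fun k _ => ?_
        rw [Finset.mul_sum]
        refine Finset.sum_le_sum fun k' _ => ?_
        by_cases hc : v = fun j => ((k' j : ℕ) : ℤ) - ((k j : ℕ) : ℤ)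
        · rw [if_pos hc, mul_one, if_pos]
          rw [hsub, hv1, hc]
        · rw [if_neg hc, mul_zero]
          split_ifs
          exacts [(WW_pos _ _).le, le_rfl]
      _ = ∑ k : Idx K → Fin H, ∑ k' : Idx K → Fin H, ∑ x ∈ X, 
          (if qf a x = (q : 𝓞 K) * (el (fun j => ((k' j : ℕ) : ℤ)) - el (fun j => ((k j : ℕ) : ℤ))) then WW R x else 0) := by
        rw [Finset.sum_comm]
        refine Finset.sum_congr rfl fun k _ => ?_
        rw [Finset.sum_comm]
      _ ≤ _ := Finset.sum_le_sum fun k _ => Finset.sum_le_sum fun k' _ => h1 _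
  have hH' : (0 : ℝ) < H := by exact_mod_cast hH
  refine le_trans (le_of_eq ?_) (mul_le_mul_of_nonneg_left h2 (by positivity))
  rw [div_pow, mul_pow]
  field_simp

theorem NN_triv (c R : ℝ) (hR : 1 ≤ R) (ξ : Idx K → ℝ) (hb : NN c R ξ ≤ 1 ∨ ∃ γ : Idx K → ℝ, dn γ ≠ ⊥ ∧ NN c R ξ ≤
      ENNReal.ofReal (20 ^ Fintype.card (Idx K) * R ^ Fintype.card (Idx K) * g0 (R ^ 2 • (ξ - γ)) / Ideal.absNorm (dn γ))) :
    NN c R ξ ≤ ENNReal.ofReal (20 ^ Fintype.card (Idx K)) * ENNReal.ofReal (R ^ Fintype.card (Idx K)) := by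
  have hR1 : 1 ≤ R ^ Fintype.card (Idx K) := one_le_pow₀ hR
  have h20 : (1 : ℝ) ≤ 20 ^ Fintype.card (Idx K) := one_le_pow₀ (by norm_num)
  rw [← ENNReal.ofReal_mul (by positivity)]
  rcases hb with h | ⟨γ, hγ, h⟩
  · refine h.trans ?_
    rw [← ENNReal.ofReal_one]
    exact ENNReal.ofReal_le_ofReal (by nlinarith)
  · refine h.trans (ENNReal.ofReal_le_ofReal ?_)
    have hN : (1 : ℝ) ≤ Ideal.absNorm (dn γ) := by
      have : Ideal.absNorm (dn γ) ≠ 0 := by rw [Ne, Ideal.absNorm_eq_zero_iff]; exact hγ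
      exact_mod_cast Nat.one_le_iff_ne_zero.2 this
    have hg : g0 (R ^ 2 • (ξ - γ)) ≤ 1 := by
      rw [g0]
      refine Finset.prod_le_one (fun σ _ => by positivity) fun σ _ => ?_
      exact inv_le_one_of_one_le₀ (by linarith [norm_nonneg (cmp σ (R ^ 2 • (ξ - γ)))])
    refine (div_le_self (mul_nonneg (by positivity) (g0_nonneg _)) hN).trans ?_
    exact mul_le_of_le_one_right (by positivity) hg

/-- Weyl bound for the product -/
theorem FF_weyl (a : Fin m → 𝓞 K) (ha : ∀ i, a i ≠ 0) (hm : 5 ≤ m) (c : ℝ) (hc : 0 < c)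
    (hb : ∀ (R : ℝ) (_ : 1 ≤ R) (ξ : Idx K → ℝ), NN c R ξ ≤ 1 ∨ ∃ γ : Idx K → ℝ, dn γ ≠ ⊥ ∧ NN c R ξ ≤
      ENNReal.ofReal (20 ^ Fintype.card (Idx K) * R ^ Fintype.card (Idx K) * g0 (R ^ 2 • (ξ - γ)) / Ideal.absNorm (dn γ))) :
    ∃ C : ℝ≥0∞, C ≠ ∞ ∧
    ∀ (R : ℝ) (_ : 1 ≤ R) (ξ : Idx K → ℝ), ‖FF a R ξ‖ₑ ≤ C * ENNReal.ofReal (R ^ Fintype.card (Idx K)) ^ ((m : ℝ) - 5 / 2) *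
      NN c R ξ ^ (5 / 2 : ℝ) := by
  choose C hC hw using fun i => weyl (a i) (ha i) c hc
  set D : ℝ≥0∞ := ∑ i, C i with hD
  have hDt : D ≠ ∞ := by rw [hD]; exact ENNReal.sum_ne_top.2 fun i _ => hC i
  set B : ℝ≥0∞ := ENNReal.ofReal (20 ^ Fintype.card (Idx K)) with hB
  have hm' : (5 : ℝ) ≤ m := by exact_mod_cast hm
  refine ⟨D ^ ((m : ℝ) / 2) * B ^ (((m : ℝ) - 5) / 2), ?_, fun R hR ξ => ?_⟩
  · refine ENNReal.mul_ne_top (ENNReal.rpow_ne_top_of_nonneg (by positivity) hDt)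
      (ENNReal.rpow_ne_top_of_nonneg (by linarith) ENNReal.ofReal_ne_top)
  · set r : ℝ≥0∞ := ENNReal.ofReal (R ^ Fintype.card (Idx K)) with hr
    have hr0 : r ≠ 0 := by
      rw [hr, Ne, ENNReal.ofReal_eq_zero, not_le]; positivity
    have hrt : r ≠ ∞ := ENNReal.ofReal_ne_top
    set N := NN c R ξ with hN
    have h1 : ∀ i, ‖theta (a i) R ξ‖ₑ ≤ (D * r * N) ^ (1 / 2 : ℝ) := by
      intro i
      have h2 := hw i R (by linarith) ξ
      have h3 : ‖theta (a i) R ξ‖ₑ ^ 2 ≤ D * r * N := by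
        refine h2.trans ?_
        gcongr
        exact Finset.single_le_sum (f := C) (fun _ _ => zero_le) (Finset.mem_univ i)
      have h4 := ENNReal.rpow_le_rpow h3 (show (0 : ℝ) ≤ 1 / 2 by norm_num)
      rwa [← ENNReal.rpow_natCast, ← ENNReal.rpow_mul, show ((2 : ℕ) : ℝ) * (1 / 2) = 1 by norm_num, ENNReal.rpow_one] at h4
    have h5 : ‖FF a R ξ‖ₑ ≤ (D * r * N) ^ ((m : ℝ) / 2) := by
      have e : ‖FF a R ξ‖ₑ = ∏ i, ‖theta (a i) R ξ‖ₑ := by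
        simp only [enorm_eq_nnnorm, FF, nnnorm_prod]; push_cast; rfl
      rw [e]
      refine (Finset.prod_le_prod' fun i _ => h1 i).trans ?_
      rw [Finset.prod_const, Finset.card_univ, Fintype.card_fin, ← ENNReal.rpow_natCast, ← ENNReal.rpow_mul]
      apply le_of_eq; congr 1; ring
    refine h5.trans ?_
    rw [ENNReal.mul_rpow_of_nonneg _ _ (by positivity), ENNReal.mul_rpow_of_nonneg _ _ (by positivity)]
    have h6 : N ^ ((m : ℝ) / 2) ≤ (B * r) ^ (((m : ℝ) - 5) / 2) * N ^ (5 / 2 : ℝ) := by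
      have e : (m : ℝ) / 2 = ((m : ℝ) - 5) / 2 + 5 / 2 := by ring
      rw [e, ENNReal.rpow_add_of_nonneg _ _ (by linarith) (by norm_num)]
      gcongr
      exact NN_triv c R hR ξ (hb R hR ξ)
    have h7 : r ^ ((m : ℝ) - 5 / 2) = r ^ ((m : ℝ) / 2) * r ^ (((m : ℝ) - 5) / 2) := by
      rw [← ENNReal.rpow_add _ _ hr0 hrt]; congr 1; ring
    refine (mul_le_mul_right h6 _).trans (le_of_eq ?_)
    rw [h7, ENNReal.mul_rpow_of_nonneg _ _ (by linarith)]
    ring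

end HM

end PartPF

section PartPU
open Module
namespace HM
section localq
variable {O : Type*} [CommRing O] [IsDomain O] [IsDiscreteValuationRing O] {m : ℕ}

def bl (a : Fin m → O) (x y : Fin m → O) : O := ∑ i, a i * x i * y i

theorem bl_add_left (a : Fin m → O) (x y z : Fin m → O) : bl a (x + y) z = bl a x z + bl a y z := by
  simp [bl, mul_add, add_mul, Finset.sum_add_distrib]
theorem bl_comm (a : Fin m → O) (x y : Fin m → O) : bl a x y = bl a y x := by
  simp [bl, mul_right_comm]
theorem bl_add_right (a : Fin m → O) (x y z : Fin m → O) : bl a x (y + z) = bl a x y + bl a x z := by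
  rw [bl_comm, bl_add_left, bl_comm a y, bl_comm a z]
theorem bl_smul_left (a : Fin m → O) (c : O) (x y : Fin m → O) : bl a (c • x) y = c * bl a x y := by
  simp only [bl, Finset.mul_sum, Pi.smul_apply, smul_eq_mul]
  exact Finset.sum_congr rfl fun _ _ => by ring
theorem bl_smul_right (a : Fin m → O) (c : O) (x y : Fin m → O) : bl a x (c • y) = c * bl a x y := by
  rw [bl_comm, bl_smul_left, bl_comm]

theorem deep (a : Fin m → O) (ϖ : O) (hϖ : Irreducible ϖ) (k0 : ℕ)
    (hk : ∀ x : Fin m → O, ϖ ^ k0 ∣ bl a x x → ∃ y, x = ϖ • y) (t : ℕ) (x : Fin m → O) (hx : ϖ ^ (k0 + 2 * t) ∣ bl a x x) : ∃ y, x = ϖ ^ (t + 1) • y := by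
  induction t generalizing x with
  | zero => simpa using hk x (by simpa using hx)
  | succ t ih =>
    obtain ⟨y, rfl⟩ := hk x ((pow_dvd_pow ϖ (by omega)).trans hx)
    rw [bl_smul_left, bl_smul_right] at hx
    have e : k0 + 2 * (t + 1) = 1 + (1 + (k0 + 2 * t)) := by ring
    rw [e, pow_add, pow_one, mul_dvd_mul_iff_left hϖ.ne_zero, pow_add, pow_one, mul_dvd_mul_iff_left hϖ.ne_zero] at hx
    obtain ⟨z, rfl⟩ := ih y hx
    exact ⟨z, by rw [smul_smul]; congr 1; ring⟩

/-- approximate root iteration -/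
theorem approx_root (ϖ : O) (A C : O) (hA : ϖ ∣ A) (hC : ϖ ∣ C) (N : ℕ) : ∃ s : O, ϖ ^ N ∣ A * s ^ 2 + s + C := by
  suffices h : ∃ s : O, ϖ ∣ s ∧ ϖ ^ N ∣ A * s ^ 2 + s + C by
    obtain ⟨s, _, h⟩ := h; exact ⟨s, h⟩
  induction N with
  | zero => exact ⟨0, dvd_zero _, by simp⟩
  | succ N ih =>
    obtain ⟨s, hs, h⟩ := ih
    refine ⟨-C - A * s ^ 2, dvd_sub (hC.neg_right) (hA.mul_right _), ?_⟩
    have e2 : A * (-C - A * s ^ 2) ^ 2 + (-C - A * s ^ 2) + C = A * ((A * s ^ 2 + s + C) * ((A * s ^ 2 + s + C) - 2 * s)) := by ring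
    rw [e2, pow_succ, mul_comm (ϖ ^ N)]
    exact mul_dvd_mul hA (h.mul_right _)

theorem cross (a : Fin m → O) (ϖ : O) (hϖ : Irreducible ϖ) (k0 : ℕ)
    (hk : ∀ x : Fin m → O, ϖ ^ k0 ∣ bl a x x → ∃ y, x = ϖ • y) (j : ℕ) (x y : Fin m → O) (hx : ϖ ^ j ∣ bl a x x) (hy : ϖ ^ j ∣ bl a y y) : ϖ ^ j ∣ 2 * bl a x y := by
  by_contra hb
  have hb0 : 2 * bl a x y ≠ 0 := fun h => hb (h ▸ dvd_zero _)
  obtain ⟨β, u, hu⟩ := IsDiscreteValuationRing.eq_unit_mul_pow_irreducible hb0 hϖ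
  have hβ : β < j := by
    by_contra hge
    exact hb (hu ▸ (pow_dvd_pow ϖ (not_lt.1 hge)).mul_left _)
  have hd : ∀ w : O, ϖ ^ j ∣ w → ∃ A, ϖ ∣ A ∧ w = 2 * bl a x y * A := by
    rintro _ ⟨w, rfl⟩
    obtain ⟨d, rfl⟩ := Nat.exists_eq_add_of_lt hβ
    refine ⟨ϖ * (ϖ ^ d * w * (↑u⁻¹ : O)), dvd_mul_right _ _, ?_⟩
    rw [hu]
    have : (u : O) * (↑u⁻¹ : O) = 1 := u.mul_inv
    calc ϖ ^ (β + d + 1) * w = ϖ ^ (β + d + 1) * w * ((u : O) * (↑u⁻¹ : O)) := by rw [this, mul_one]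
      _ = _ := by ring
  obtain ⟨A, hA, eA⟩ := hd _ hx
  obtain ⟨C, hC, eC⟩ := hd _ hy
  obtain ⟨s, hs⟩ := approx_root ϖ A C hA hC (k0 + 2 * j)
  have h1 : bl a (s • x + y) (s • x + y) = 2 * bl a x y * (A * s ^ 2 + s + C) := by
    simp only [bl_add_left, bl_add_right, bl_smul_left, bl_smul_right]
    rw [bl_comm a y x, eA, eC]; ring
  obtain ⟨w, hw⟩ := deep a ϖ hϖ k0 hk j (s • x + y) (h1 ▸ hs.mul_left _)
  have hy2 : y = ϖ ^ (j + 1) • w + (-s) • x := by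
    rw [← hw, neg_smul]; abel
  apply hb
  have : 2 * bl a x y = ϖ ^ (j + 1) * (2 * bl a x w) - 2 * s * bl a x x := by
    conv_lhs => rw [hy2, bl_add_right, bl_smul_right, bl_smul_right]
    ring
  rw [this]
  exact dvd_sub ((pow_dvd_pow ϖ (by omega)).mul_right _) (hx.mul_left _)

/-- the filtration -/
def MM (a : Fin m → O) (ϖ : O) (hϖ : Irreducible ϖ) (k0 : ℕ)
    (hk : ∀ x : Fin m → O, ϖ ^ k0 ∣ bl a x x → ∃ y, x = ϖ • y) (j : ℕ) : Submodule O (Fin m → O) where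
  carrier := {x | ϖ ^ j ∣ bl a x x}
  zero_mem' := by simp [bl]
  add_mem' := by
    intro x y hx hy
    have h := cross a ϖ hϖ k0 hk j x y hx hy
    have e : bl a (x + y) (x + y) = bl a x x + bl a y y + 2 * bl a x y := by
      simp only [bl_add_left, bl_add_right]; rw [bl_comm a y x]; ring
    change ϖ ^ j ∣ bl a (x + y) (x + y)
    rw [e]; exact dvd_add (dvd_add hx hy) h
  smul_mem' := by
    intro c x hx
    change ϖ ^ j ∣ bl a (c • x) (c • x)
    rw [bl_smul_left, bl_smul_right]
    exact (Dvd.dvd.mul_left hx _).mul_left _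

theorem chev {k : Type*} [Field k] [Fintype k] (α1 α2 α3 β12 β13 β23 : k) : ∃ c1 c2 c3 : k, ¬ (c1 = 0 ∧ c2 = 0 ∧ c3 = 0) ∧
    α1 * c1 ^ 2 + α2 * c2 ^ 2 + α3 * c3 ^ 2 + β12 * c1 * c2 + β13 * c1 * c3 + β23 * c2 * c3 = 0 := by
  classical
  let X : Fin 3 → MvPolynomial (Fin 3) k := MvPolynomial.X
  let M : k → Fin 3 → Fin 3 → MvPolynomial (Fin 3) k := fun c i j => MvPolynomial.C c * X i * X j
  have hM : ∀ c i j, (M c i j).totalDegree ≤ 2 := by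
    intro c i j
    refine (MvPolynomial.totalDegree_mul _ _).trans ?_
    have h1 := MvPolynomial.totalDegree_mul (MvPolynomial.C (σ := Fin 3) c) (X i)
    rw [MvPolynomial.totalDegree_C, MvPolynomial.totalDegree_X] at h1
    rw [MvPolynomial.totalDegree_X]; omega
  let P : MvPolynomial (Fin 3) k := M α1 0 0 + M α2 1 1 + M α3 2 2 + M β12 0 1 + M β13 0 2 + M β23 1 2
  have hP : P.totalDegree ≤ 2 := by
    refine (MvPolynomial.totalDegree_add _ _).trans (max_le ?_ (hM _ _ _))
    refine (MvPolynomial.totalDegree_add _ _).trans (max_le ?_ (hM _ _ _))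
    refine (MvPolynomial.totalDegree_add _ _).trans (max_le ?_ (hM _ _ _))
    refine (MvPolynomial.totalDegree_add _ _).trans (max_le ?_ (hM _ _ _))
    exact (MvPolynomial.totalDegree_add _ _).trans (max_le (hM _ _ _) (hM _ _ _))
  have hev : ∀ c : Fin 3 → k, MvPolynomial.eval c P = α1 * c 0 ^ 2 + α2 * c 1 ^ 2 + α3 * c 2 ^ 2 + β12 * c 0 * c 1 + β13 * c 0 * c 2 + β23 * c 1 * c 2 := by
    intro c; simp [P, M, X]; ring
  obtain ⟨p, hp⟩ := CharP.exists k
  have hpp : p.Prime := (CharP.char_is_prime_or_zero k p).resolve_right (CharP.char_ne_zero_of_finite k p)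
  have hdvd := char_dvd_card_solutions (σ := Fin 3) p (f := P) (by simp; omega)
  have h0 : MvPolynomial.eval (0 : Fin 3 → k) P = 0 := by rw [hev]; simp
  have hpos : 0 < Fintype.card {x : Fin 3 → k // MvPolynomial.eval x P = 0} := Fintype.card_pos_iff.2 ⟨⟨0, h0⟩⟩
  have h1 : 1 < Fintype.card {x : Fin 3 → k // MvPolynomial.eval x P = 0} :=
    lt_of_lt_of_le hpp.one_lt (Nat.le_of_dvd hpos hdvd)
  obtain ⟨⟨c, hc⟩, hne⟩ := Fintype.exists_ne_of_one_lt_card h1 ⟨0, h0⟩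
  refine ⟨c 0, c 1, c 2, ?_, by rw [← hev, hc]⟩
  rintro ⟨e0, e1, e2⟩
  apply hne
  apply Subtype.ext
  funext i
  fin_cases i <;> simp_all

variable [Finite (IsLocalRing.ResidueField O)]

theorem dep (a : Fin m → O) (ϖ : O) (hϖ : Irreducible ϖ) (k0 : ℕ)
    (hk : ∀ x : Fin m → O, ϖ ^ k0 ∣ bl a x x → ∃ y, x = ϖ • y) (j : ℕ) (x y z : Fin m → O) (hx : ϖ ^ j ∣ bl a x x) (hy : ϖ ^ j ∣ bl a y y) (hz : ϖ ^ j ∣ bl a z z) :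
    ∃ c1 c2 c3 : O, (IsUnit c1 ∨ IsUnit c2 ∨ IsUnit c3) ∧
      ϖ ^ (j + 1) ∣ bl a (c1 • x + c2 • y + c3 • z) (c1 • x + c2 • y + c3 • z) := by
  let _ : Fintype (IsLocalRing.ResidueField O) := Fintype.ofFinite _
  obtain ⟨β12, h12⟩ := cross a ϖ hϖ k0 hk j x y hx hy
  obtain ⟨β13, h13⟩ := cross a ϖ hϖ k0 hk j x z hx hz
  obtain ⟨β23, h23⟩ := cross a ϖ hϖ k0 hk j y z hy hz
  obtain ⟨α1, h1⟩ := hx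
  obtain ⟨α2, h2⟩ := hy
  obtain ⟨α3, h3⟩ := hz
  let r := IsLocalRing.residue O
  obtain ⟨c1, c2, c3, hc, he⟩ := chev (r α1) (r α2) (r α3) (r β12) (r β13) (r β23)
  obtain ⟨c1, rfl⟩ := IsLocalRing.residue_surjective c1
  obtain ⟨c2, rfl⟩ := IsLocalRing.residue_surjective c2
  obtain ⟨c3, rfl⟩ := IsLocalRing.residue_surjective c3
  refine ⟨c1, c2, c3, ?_, ?_⟩
  · by_contra hn
    push Not at hn
    apply hc
    simp only [IsLocalRing.residue_eq_zero_iff, IsLocalRing.mem_maximalIdeal, mem_nonunits_iff]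
    exact hn
  · have e : bl a (c1 • x + c2 • y + c3 • z) (c1 • x + c2 • y + c3 • z) =
        ϖ ^ j * (α1 * c1 ^ 2 + α2 * c2 ^ 2 + α3 * c3 ^ 2 + β12 * c1 * c2 + β13 * c1 * c3 + β23 * c2 * c3) := by
      simp only [bl_add_left, bl_add_right, bl_smul_left, bl_smul_right]
      rw [bl_comm a y x, bl_comm a z x, bl_comm a z y]
      linear_combination c1 ^ 2 * h1 + c2 ^ 2 * h2 + c3 ^ 2 * h3 + c1 * c2 * h12 + c1 * c3 * h13 + c2 * c3 * h23
    rw [e, pow_succ]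
    refine mul_dvd_mul_left _ ?_
    have : r (α1 * c1 ^ 2 + α2 * c2 ^ 2 + α3 * c3 ^ 2 + β12 * c1 * c2 + β13 * c1 * c3 + β23 * c2 * c3) = 0 := by
      simpa [r] using he
    rw [IsLocalRing.residue_eq_zero_iff, (IsDiscreteValuationRing.irreducible_iff_uniformizer ϖ).1 hϖ, Ideal.mem_span_singleton] at this
    exact this

theorem two_gen (a : Fin m → O) (ϖ : O) (hϖ : Irreducible ϖ) (k0 : ℕ)
    (hk : ∀ x : Fin m → O, ϖ ^ k0 ∣ bl a x x → ∃ y, x = ϖ • y) (j : ℕ) : ∃ x y : Fin m → O, x ∈ MM a ϖ hϖ k0 hk j ∧ y ∈ MM a ϖ hϖ k0 hk j ∧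
    MM a ϖ hϖ k0 hk j ≤ Submodule.span O {x, y} ⊔ MM a ϖ hϖ k0 hk (j + 1) := by
  by_contra! hcon
  set M := MM a ϖ hϖ k0 hk j with hM
  set M' := MM a ϖ hϖ k0 hk (j + 1) with hM'
  have h0 := hcon 0 0 M.zero_mem M.zero_mem
  obtain ⟨x, hxM, hx⟩ := Set.not_subset.1 h0
  have h1 := hcon x 0 hxM M.zero_mem
  obtain ⟨y, hyM, hy⟩ := Set.not_subset.1 h1
  have h2 := hcon x y hxM hyM
  obtain ⟨z, hzM, hz⟩ := Set.not_subset.1 h2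
  obtain ⟨c1, c2, c3, hc, hd⟩ := dep a ϖ hϖ k0 hk j x y z hxM hyM hzM
  have hd' : c1 • x + c2 • y + c3 • z ∈ M' := hd
  have key : ∀ (c : O) (w : Fin m → O) (S : Submodule O (Fin m → O)), IsUnit c → c • w ∈ S → w ∈ S := by
    rintro _ w S ⟨u, rfl⟩ h
    have := S.smul_mem (↑u⁻¹ : O) h
    rwa [smul_smul, Units.inv_mul, one_smul] at this
  have memx : x ∈ Submodule.span O {x, y} := Submodule.subset_span (by simp)
  have memy : y ∈ Submodule.span O {x, y} := Submodule.subset_span (by simp)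
  have memx' : x ∈ Submodule.span O {x, (0 : Fin m → O)} := Submodule.subset_span (by simp)
  by_cases u3 : IsUnit c3
  · apply hz
    refine key c3 z _ u3 ?_
    have : c3 • z = -(c1 • x + c2 • y) + (c1 • x + c2 • y + c3 • z) := by abel
    rw [this]
    refine Submodule.add_mem_sup (Submodule.neg_mem _ (Submodule.add_mem _ (Submodule.smul_mem _ _ memx) (Submodule.smul_mem _ _ memy))) hd'
  have n3 : ϖ ∣ c3 := by
    have : c3 ∈ IsLocalRing.maximalIdeal O := u3
    rwa [(IsDiscreteValuationRing.irreducible_iff_uniformizer ϖ).1 hϖ, Ideal.mem_span_singleton] at this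
  have small : ∀ (c : O) (w : Fin m → O), w ∈ M → ϖ ∣ c → c • w ∈ M' := by
    rintro _ w hw ⟨d, rfl⟩
    change ϖ ^ (j + 1) ∣ bl a _ _
    rw [bl_smul_left, bl_smul_right]
    have : ϖ ^ j ∣ bl a w w := hw
    obtain ⟨v, hv⟩ := this
    exact ⟨ϖ * d * d * v, by rw [hv]; ring⟩
  have n2u : ∀ c, ¬ IsUnit c → ϖ ∣ c := by
    intro c hc
    have : c ∈ IsLocalRing.maximalIdeal O := hc
    rwa [(IsDiscreteValuationRing.irreducible_iff_uniformizer ϖ).1 hϖ, Ideal.mem_span_singleton] at this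
  have hd2 : c1 • x + c2 • y ∈ M' := by
    have := M'.sub_mem hd' (small c3 z hzM n3)
    rwa [add_sub_cancel_right] at this
  by_cases u2 : IsUnit c2
  · apply hy
    refine key c2 y _ u2 ?_
    have : c2 • y = -(c1 • x) + (c1 • x + c2 • y) := by abel
    rw [this]
    exact Submodule.add_mem_sup (Submodule.neg_mem _ (Submodule.smul_mem _ _ memx')) hd2
  have hd1 : c1 • x ∈ M' := by
    have := M'.sub_mem hd2 (small c2 y hyM (n2u c2 u2))
    rwa [add_sub_cancel_right] at this
  apply hx
  exact (le_sup_right : M' ≤ _) (key c1 x _ (by tauto) hd1)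

theorem rank_bound (a : Fin m → O) (ϖ : O) (hϖ : Irreducible ϖ) (k0 : ℕ)
    (hk : ∀ x : Fin m → O, ϖ ^ k0 ∣ bl a x x → ∃ y, x = ϖ • y) : m ≤ 4 := by
  classical
  set M := MM a ϖ hϖ k0 hk with hM
  obtain ⟨x, y, hx, hy, h1⟩ := two_gen a ϖ hϖ k0 hk k0
  obtain ⟨x', y', hx', hy', h2⟩ := two_gen a ϖ hϖ k0 hk (k0 + 1)
  set S : Finset (Fin m → O) := {x, y, x', y'} with hS
  have h3 : M (k0 + 2) ≤ (Ideal.span {ϖ}) • M k0 := by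
    intro w hw
    have hw' : ϖ ^ (k0 + 2) ∣ bl a w w := hw
    obtain ⟨v, rfl⟩ := hk w ((pow_dvd_pow ϖ (by omega)).trans hw')
    rw [Submodule.ideal_span_singleton_smul]
    refine Submodule.smul_mem_pointwise_smul v ϖ _ ?_
    rw [bl_smul_left, bl_smul_right, show k0 + 2 = 1 + (1 + k0) by ring, pow_add, pow_one, mul_dvd_mul_iff_left hϖ.ne_zero,
      pow_add, pow_one, mul_dvd_mul_iff_left hϖ.ne_zero] at hw'
    exact hw'
  have h4 : M k0 ≤ Submodule.span O (S : Set (Fin m → O)) ⊔ (Ideal.span {ϖ}) • M k0 := by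
    refine h1.trans (sup_le ?_ (h2.trans (sup_le ?_ (h3.trans le_sup_right))))
    · refine le_trans (Submodule.span_mono ?_) le_sup_left
      intro w hw; simp [hS]; simp at hw; tauto
    · refine le_trans (Submodule.span_mono ?_) le_sup_left
      intro w hw; simp [hS]; simp at hw; tauto
  have h5 : M k0 ≤ Submodule.span O (S : Set (Fin m → O)) := by
    refine Submodule.le_of_le_smul_of_le_jacobson_bot (I := Ideal.span {ϖ}) (IsNoetherian.noetherian _) ?_ h4
    rw [IsLocalRing.jacobson_eq_maximalIdeal ⊥ bot_ne_top, Ideal.span_singleton_le_iff_mem]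
    exact hϖ.not_isUnit
  let f : (Fin m → O) →ₗ[O] Submodule.span O (S : Set (Fin m → O)) :=
    LinearMap.codRestrict _ (ϖ ^ k0 • LinearMap.id) (fun w => h5 (by
      change ϖ ^ k0 ∣ bl a (ϖ ^ k0 • w) (ϖ ^ k0 • w)
      rw [bl_smul_left]; exact dvd_mul_right _ _))
  have hf : Function.Injective f := by
    intro w w' h
    have h' : ϖ ^ k0 • w = ϖ ^ k0 • w' := congrArg Subtype.val h
    exact smul_right_injective _ (pow_ne_zero _ hϖ.ne_zero) h'
  have h6 := LinearMap.finrank_le_finrank_of_injective hf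
  have h7 := finrank_span_finset_le_card (R := O) S
  have h7' : Module.finrank O (Submodule.span O (S : Set (Fin m → O))) ≤ S.card := h7
  have h8 : S.card ≤ 4 := Finset.card_le_four
  rw [Module.finrank_fin_fun] at h6
  omega

end localq

/-- approximate local isotropy in five variables -/
theorem local_iso {O : Type*} [CommRing O] [IsDomain O] [IsDiscreteValuationRing O] [Finite (IsLocalRing.ResidueField O)]
    {m : ℕ} (hm : 5 ≤ m) (a : Fin m → O) (ϖ : O) (hϖ : Irreducible ϖ) (k : ℕ) :
    ∃ x : Fin m → O, ϖ ^ k ∣ ∑ i, a i * x i ^ 2 ∧ ∃ i, ¬ ϖ ∣ x i := by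
  by_contra! hcon
  have hk : ∀ x : Fin m → O, ϖ ^ k ∣ bl a x x → ∃ y, x = ϖ • y := by
    intro x hx
    have : bl a x x = ∑ i, a i * x i ^ 2 := by simp only [bl]; exact Finset.sum_congr rfl fun _ _ => by ring
    rw [this] at hx
    choose y hy using hcon x hx
    exact ⟨y, funext hy⟩
  have := rank_bound a ϖ hϖ k hk
  omega

end HM

end PartPU

section PartPU2
open NumberField Module

namespace HM

variable {K : Type*} [Field K] [NumberField K]

theorem prime_iso (v : Ideal (𝓞 K)) [hv : v.IsPrime] (h0 : v ≠ ⊥) {m : ℕ} (hm : 5 ≤ m) (a : Fin m → 𝓞 K) (k : ℕ) :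
    ∃ x : Fin m → 𝓞 K, qf a x ∈ v ^ k ∧ ∃ i, x i ∉ v := by
  classical
  have hmax : v.IsMaximal := hv.isMaximal h0
  let O := Localization.AtPrime v
  have _ : IsDiscreteValuationRing O := IsLocalization.AtPrime.isDiscreteValuationRing_of_dedekind_domain (𝓞 K) h0 O
  have _ : Finite (𝓞 K ⧸ v) := Ideal.finiteQuotientOfFreeOfNeBot v h0
  have _ : Finite (IsLocalRing.ResidueField O) :=
    Finite.of_equiv _ (IsLocalization.AtPrime.equivQuotMaximalIdeal v O).toEquiv
  obtain ⟨ϖ, hϖ⟩ := IsDiscreteValuationRing.exists_irreducible O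
  have hmaxI : IsLocalRing.maximalIdeal O = Ideal.span {ϖ} := hϖ.maximalIdeal_eq
  have hmap : Ideal.map (algebraMap (𝓞 K) O) v = IsLocalRing.maximalIdeal O := IsLocalization.AtPrime.map_eq_maximalIdeal v O
  have hback : ∀ y : 𝓞 K, ϖ ^ k ∣ algebraMap (𝓞 K) O y → y ∈ v ^ k := by
    intro y hy
    rw [← Ideal.mem_span_singleton, ← Ideal.span_singleton_pow, ← hmaxI, ← hmap, ← Ideal.map_pow,
      IsLocalization.algebraMap_mem_map_algebraMap_iff v.primeCompl] at hy
    obtain ⟨s, hs, h⟩ := hy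
    exact (Ideal.IsMaximal.mul_mem_pow v h).resolve_left hs
  obtain ⟨x', hx', i, hi⟩ := local_iso hm (fun i => algebraMap (𝓞 K) O (a i)) ϖ hϖ k
  obtain ⟨s, hs⟩ := IsLocalization.exist_integer_multiples_of_finite v.primeCompl x'
  choose x hx using hs
  refine ⟨x, hback _ ?_, i, ?_⟩
  · have : algebraMap (𝓞 K) O (qf a x) = (algebraMap (𝓞 K) O s) ^ 2 * ∑ i, algebraMap (𝓞 K) O (a i) * x' i ^ 2 := by
      simp only [qf, map_sum, map_mul, map_pow, hx, Finset.mul_sum, Algebra.smul_def]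
      exact Finset.sum_congr rfl fun _ _ => by ring
    rw [this]; exact hx'.mul_left _
  · intro hmem
    have h1 : algebraMap (𝓞 K) O (x i) ∈ Ideal.span {ϖ} := by
      rw [← hmaxI, ← hmap]; exact Ideal.mem_map_of_mem _ hmem
    rw [hx, Algebra.smul_def, Ideal.mem_span_singleton] at h1
    have hu : IsUnit (algebraMap (𝓞 K) O s) := IsLocalization.map_units O s
    exact hi ((hϖ.prime.dvd_or_dvd h1).resolve_left fun h => hϖ.not_isUnit (isUnit_of_dvd_unit h hu))

theorem exists_notMem_pow (v : Ideal (𝓞 K)) (hv : v ≠ ⊤) (y : 𝓞 K) (hy : y ≠ 0) : ∃ e, ∀ e' ≥ e, y ∉ v ^ e' := by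
  by_contra! h
  have : y ∈ (⨅ i : ℕ, v ^ i) := by
    rw [Ideal.mem_iInf]; intro i
    obtain ⟨e', he, h'⟩ := h i
    exact Ideal.pow_le_pow_right he h'
  rw [Ideal.iInf_pow_eq_bot_of_isDomain v hv] at this
  exact hy this

/-- reflection trick -/
theorem reflect {m : ℕ} (a x : Fin m → 𝓞 K) (i j : Fin m) (hij : i ≠ j) :
    ∃ z : Fin m → 𝓞 K, qf a z = (a i + a j) ^ 2 * qf a x ∧ z i = (a j - a i) * x i - 2 * a j * x j := by
  let w : Fin m → 𝓞 K := Pi.single i 1 + Pi.single j 1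
  have h1 : ∀ f : Fin m → 𝓞 K, ∑ l, f l * w l = f i + f j := by
    intro f
    simp only [w, Pi.add_apply, mul_add, Finset.sum_add_distrib, Pi.single_apply, mul_ite, mul_one, mul_zero]
    simp
  have wi : w i = 1 := by simp [w, hij]
  have wj : w j = 1 := by simp [w, hij]
  refine ⟨fun l => (a i + a j) * x l - 2 * (a i * x i + a j * x j) * w l, ?_, by simp only [wi]; ring⟩
  have e : qf a (fun l => (a i + a j) * x l - 2 * (a i * x i + a j * x j) * w l) = (a i + a j) ^ 2 * qf a x
     - 4 * (a i + a j) * (a i * x i + a j * x j) * (∑ l, (a l * x l) * w l) + 4 * (a i * x i + a j * x j) ^ 2 * (∑ l, (a l * w l) * w l) := by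
    simp only [qf, Finset.mul_sum, ← Finset.sum_sub_distrib, ← Finset.sum_add_distrib]
    exact Finset.sum_congr rfl fun _ _ => by ring
  rw [e, h1, h1, wi, wj]; ring

theorem prime_iso2 (v : Ideal (𝓞 K)) [hv : v.IsPrime] (h0 : v ≠ ⊥) {m : ℕ} (hm : 5 ≤ m) (a : Fin m → 𝓞 K)
    (ha : ∀ i, a i ≠ 0) (i : Fin m) :
    ∃ e, ∀ e' ≥ e, ∀ k, ∃ x : Fin m → 𝓞 K, qf a x ∈ v ^ k ∧ 2 * a i * x i ∉ v ^ e' := by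
  have h2 : ∀ j, ∃ e, ∀ e' ≥ e, 2 * a i * (2 * a j) ∉ v ^ e' := fun j =>
    exists_notMem_pow v hv.ne_top _ (by simp [ha])
  choose f hf using h2
  obtain ⟨e0, he0⟩ := exists_notMem_pow v hv.ne_top (2 * a i) (by simp [ha])
  refine ⟨max e0 (Finset.univ.sup f), fun e' he k => ?_⟩
  obtain ⟨x, hx, j, hj⟩ := prime_iso v h0 hm a k
  by_cases hc : 2 * a i * x i ∉ v ^ e'
  · exact ⟨x, hx, hc⟩
  rw [not_not] at hc
  have hij : i ≠ j := by
    rintro rfl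
    exact he0 e' (le_trans (le_max_left _ _) he) ((Ideal.IsPrime.mem_pow_mul v hc).resolve_right hj)
  obtain ⟨z, hz, hz1⟩ := reflect a x i j hij
  refine ⟨z, by rw [hz]; exact Ideal.mul_mem_left _ _ hx, fun hc2 => ?_⟩
  have h3 : 2 * a i * (2 * a j) * x j ∈ v ^ e' := by
    have : 2 * a i * (2 * a j) * x j = (a j - a i) * (2 * a i * x i) - 2 * a i * z i := by rw [hz1]; ring
    rw [this]
    exact Ideal.sub_mem _ (Ideal.mul_mem_left _ _ hc) hc2
  refine hf j e' (le_trans (le_trans (Finset.le_sup (Finset.mem_univ j)) (le_max_right _ _)) he) ((Ideal.IsPrime.mem_pow_mul v h3).resolve_right hj)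

/-- divisibility by prime powers -/
theorem mem_of_prime_pow (I J : Ideal (𝓞 K)) (hI : I ≠ ⊥) (h : ∀ v : Ideal (𝓞 K), v.IsPrime → v ≠ ⊥ → ∀ n, I ≤ v ^ n → J ≤ v ^ n) : J ≤ I := by
  classical
  by_cases hJ : J = ⊥
  · simp [hJ]
  rw [← Ideal.dvd_iff_le, UniqueFactorizationMonoid.dvd_iff_normalizedFactors_le_normalizedFactors hI hJ, Multiset.le_iff_count]
  intro p
  by_cases hp : p ∈ UniqueFactorizationMonoid.normalizedFactors I
  · have hp1 := UniqueFactorizationMonoid.prime_of_normalized_factor p hp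
    have hpp := Ideal.isPrime_of_prime hp1
    have key : ∀ (L : Ideal (𝓞 K)) (_ : L ≠ ⊥) (n : ℕ), L ≤ p ^ n ↔ n ≤ Multiset.count p (UniqueFactorizationMonoid.normalizedFactors L) := by
      intro L hL n
      rw [← Ideal.dvd_iff_le, pow_dvd_iff_le_emultiplicity,
        UniqueFactorizationMonoid.emultiplicity_eq_count_normalizedFactors hp1.irreducible hL, normalize_eq]
      exact Nat.cast_le
    exact (key J hJ _).1 (h p hpp hp1.ne_zero _ ((key I hI _).2 le_rfl))
  · rw [Multiset.count_eq_zero_of_notMem hp]; exact Nat.zero_le _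

end HM

end PartPU2

section PartPS1
open NumberField Module

namespace HM

variable {K : Type*} [Field K] [NumberField K]

theorem good_start (B : ℕ) (hB : B ≠ 0) {m : ℕ} (hm : 5 ≤ m) (a : Fin m → 𝓞 K) (ha : ∀ i, a i ≠ 0) (i : Fin m) :
    ∃ (E : ℕ) (x : Fin m → 𝓞 K) (t s : 𝓞 K), (B : 𝓞 K) ^ (2 * E + 1) ∣ qf a x ∧
      2 * a i * x i * t = (B : 𝓞 K) ^ E * (1 - B * s) := by
  classical
  have hB' : (B : 𝓞 K) ≠ 0 := by exact_mod_cast hB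
  have hspan : (Ideal.span {(B : 𝓞 K)}) ≠ ⊥ := by simpa using hB
  set S : Finset (Ideal (𝓞 K)) := (UniqueFactorizationMonoid.normalizedFactors (Ideal.span {(B : 𝓞 K)})).toFinset with hS
  have hSp : ∀ v ∈ S, Prime v := fun v hv =>
    UniqueFactorizationMonoid.prime_of_normalized_factor v (Multiset.mem_toFinset.1 hv)
  have hmemS : ∀ v : Ideal (𝓞 K), v.IsPrime → v ≠ ⊥ → (B : 𝓞 K) ∈ v → v ∈ S := by
    intro v hv hv0 h
    rw [hS, Multiset.mem_toFinset, UniqueFactorizationMonoid.mem_normalizedFactors_iff hspan]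
    exact ⟨Ideal.prime_of_isPrime hv0 hv, Ideal.dvd_iff_le.2 ((Ideal.span_singleton_le_iff_mem _).2 h)⟩
  have h1 : ∀ v : Ideal (𝓞 K), ∃ e, v ∈ S → ∀ e' ≥ e, ∀ k, ∃ x : Fin m → 𝓞 K, qf a x ∈ v ^ k ∧ 2 * a i * x i ∉ v ^ e' := by
    intro v
    by_cases hv : v ∈ S
    · have := Ideal.isPrime_of_prime (hSp v hv)
      obtain ⟨e, he⟩ := prime_iso2 v (hSp v hv).ne_zero hm a ha i
      exact ⟨e, fun _ => he⟩
    · exact ⟨0, fun h => absurd h hv⟩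
  choose e he using h1
  set E := S.sup e with hE
  set I : Ideal (𝓞 K) := Ideal.span {(B : 𝓞 K) ^ (2 * E + 1)} with hI
  have hI0 : I ≠ ⊥ := by simp [hI, hB]
  set k := max (Ideal.absNorm I) E with hk
  have h2 : ∀ v : S, ∃ x : Fin m → 𝓞 K, qf a x ∈ v.1 ^ k ∧ 2 * a i * x i ∉ v.1 ^ E := fun v =>
    he v.1 v.2 E (Finset.le_sup v.2) k
  choose X hX1 hX2 using h2
  have h3 : ∀ l : Fin m, ∃ y : 𝓞 K, ∀ (v : Ideal (𝓞 K)) (hv : v ∈ S), y - X ⟨v, hv⟩ l ∈ v ^ k := fun l =>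
    IsDedekindDomain.exists_forall_sub_mem_ideal (fun v : Ideal (𝓞 K) => v) (fun _ => k) hSp (fun _ _ _ _ h => h) (fun v => X v l)
  choose y hy using h3
  have hq : ∀ v (_ : v ∈ S), qf a y ∈ v ^ k := by
    intro v hv
    have : qf a y = (∑ l, a l * (y l + X ⟨v, hv⟩ l) * (y l - X ⟨v, hv⟩ l)) + qf a (X ⟨v, hv⟩) := by
      simp only [qf, ← Finset.sum_add_distrib]
      exact Finset.sum_congr rfl fun _ _ => by ring
    rw [this]
    refine Ideal.add_mem _ (Ideal.sum_mem _ fun l _ => Ideal.mul_mem_left _ _ (hy l v hv)) (hX1 ⟨v, hv⟩)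
  have hn : ∀ v (_ : v ∈ S), 2 * a i * y i ∉ v ^ E := by
    intro v hv hc
    refine hX2 ⟨v, hv⟩ ?_
    have : 2 * a i * X ⟨v, hv⟩ i = 2 * a i * y i - 2 * a i * (y i - X ⟨v, hv⟩ i) := by ring
    rw [this]
    exact Ideal.sub_mem _ hc (Ideal.mul_mem_left _ _ (Ideal.pow_le_pow_right (le_max_right _ _) (hy i v hv)))
  have hd : (B : 𝓞 K) ^ (2 * E + 1) ∣ qf a y := by
    rw [← Ideal.mem_span_singleton, ← Ideal.span_singleton_le_iff_mem]
    refine mem_of_prime_pow _ _ hI0 fun v hv hv0 n hle => ?_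
    rcases Nat.eq_zero_or_pos n with rfl | hnp
    · simp
    have hBv : (B : 𝓞 K) ∈ v := hv.mem_of_pow_mem _ ((hle.trans (Ideal.pow_le_self hnp.ne')) (Ideal.mem_span_singleton_self _))
    have hvS := hmemS v hv hv0 hBv
    rw [Ideal.span_singleton_le_iff_mem]
    refine Ideal.pow_le_pow_right ?_ (hq v hvS)
    refine le_trans ?_ (le_max_left _ _)
    have hN : Ideal.absNorm v ^ n ∣ Ideal.absNorm I := by
      rw [← map_pow]; exact Ideal.absNorm_dvd_absNorm_of_le hle
    have hN2 : 2 ≤ Ideal.absNorm v := by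
      have e0 : Ideal.absNorm v ≠ 0 := by rw [Ne, Ideal.absNorm_eq_zero_iff]; exact hv0
      have e1 : Ideal.absNorm v ≠ 1 := by rw [Ne, Ideal.absNorm_eq_one_iff]; exact hv.ne_top
      omega
    have hN3 : Ideal.absNorm I ≠ 0 := by rw [Ne, Ideal.absNorm_eq_zero_iff]; exact hI0
    calc n ≤ 2 ^ n := (Nat.lt_two_pow_self).le
      _ ≤ Ideal.absNorm v ^ n := Nat.pow_le_pow_left hN2 n
      _ ≤ _ := Nat.le_of_dvd (Nat.pos_of_ne_zero hN3) hN
  have hJ : (B : 𝓞 K) ^ E ∈ Ideal.span {2 * a i * y i} ⊔ Ideal.span {(B : 𝓞 K) ^ (E + 1)} := by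
    rw [← Ideal.span_singleton_le_iff_mem]
    refine mem_of_prime_pow _ _ ?_ fun v hv hv0 n hle => ?_
    · intro h
      rw [sup_eq_bot_iff] at h
      simp [hB] at h
    rcases Nat.eq_zero_or_pos n with rfl | hnp
    · simp
    have hBv : (B : 𝓞 K) ∈ v := hv.mem_of_pow_mem _ (((le_sup_right.trans hle).trans (Ideal.pow_le_self hnp.ne')) (Ideal.mem_span_singleton_self _))
    have hvS := hmemS v hv hv0 hBv
    have hy' : 2 * a i * y i ∈ v ^ n := (le_sup_left.trans hle) (Ideal.mem_span_singleton_self _)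
    have hnE : n ≤ E := by
      by_contra hc
      exact hn v hvS (Ideal.pow_le_pow_right (by omega) hy')
    rw [Ideal.span_singleton_le_iff_mem]
    exact Ideal.pow_le_pow_right hnE (Ideal.pow_mem_pow hBv E)
  obtain ⟨u, hu, w, hw, huw⟩ := Submodule.mem_sup.1 hJ
  obtain ⟨t, rfl⟩ := Ideal.mem_span_singleton.1 hu
  obtain ⟨s, rfl⟩ := Ideal.mem_span_singleton.1 hw
  exact ⟨E, y, t, s, hd, by linear_combination huw⟩

theorem hensel {O : Type*} [CommRing O] (B s c g : O) (j : ℕ) : ∃ z : O, B ^ j ∣ (1 - B * s) * z + B * c * z ^ 2 + g := by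
  induction j with
  | zero => exact ⟨0, by simp⟩
  | succ j ih =>
    obtain ⟨z, w, h⟩ := ih
    refine ⟨z - ((1 - B * s) * z + B * c * z ^ 2 + g), ?_⟩
    rw [h]
    refine ⟨s * w + c * w * (B ^ j * w - 2 * z) , ?_⟩
    have e : g = B ^ j * w - (1 - B * s) * z - B * c * z ^ 2 := by linear_combination h
    rw [e]; ring

/-- solutions of the form modulo `q` -/
abbrev Sol {m : ℕ} (a : Fin m → 𝓞 K) (q : ℕ) : Type _ :=
  {r : Fin m → 𝓞 K ⧸ Ideal.span {(q : 𝓞 K)} // ∑ i, Ideal.Quotient.mk _ (a i) * r i ^ 2 = 0}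

theorem card_quot (q : ℕ) : Nat.card (𝓞 K ⧸ Ideal.span {(q : 𝓞 K)}) = q ^ Fintype.card (Idx K) := by
  have : Ideal.absNorm (Ideal.span {(q : 𝓞 K)}) = q ^ Fintype.card (Idx K) := by
    rw [Ideal.absNorm_span_natCast, Module.finrank_eq_card_chooseBasisIndex]
  rw [← this, Ideal.absNorm_apply, Submodule.cardQuot_apply]

theorem finite_quot (q : ℕ) (hq : q ≠ 0) : Finite (𝓞 K ⧸ Ideal.span {(q : 𝓞 K)}) :=
  Ideal.finiteQuotientOfFreeOfNeBot _ (by simpa using hq)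

theorem count_B (B : ℕ) (hB : B ≠ 0) {m : ℕ} (hm : 5 ≤ m) (a : Fin m → 𝓞 K) (ha : ∀ i, a i ≠ 0) :
    ∃ D : ℕ, ∀ j : ℕ, (B ^ j) ^ (Fintype.card (Idx K) * (m - 1)) ≤ Nat.card (Sol a (B ^ (D + j))) := by
  classical
  obtain ⟨m, rfl⟩ : ∃ m', m = m' + 1 := ⟨m - 1, by omega⟩
  obtain ⟨E, x, t, s, ⟨g, hg⟩, ht⟩ := good_start B hB hm a ha 0
  refine ⟨2 * E + 1, fun j => ?_⟩
  set D := 2 * E + 1 with hD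
  have hB' : (B : 𝓞 K) ≠ 0 := by exact_mod_cast hB
  let A := 𝓞 K ⧸ Ideal.span {((B ^ j : ℕ) : 𝓞 K)}
  let A' := 𝓞 K ⧸ Ideal.span {((B ^ (D + j) : ℕ) : 𝓞 K)}
  have _ := finite_quot (K := K) (B ^ j) (pow_ne_zero _ hB)
  have _ := finite_quot (K := K) (B ^ (D + j)) (pow_ne_zero _ hB)
  -- lifting
  have key : ∀ u : Fin m → A, ∃ y0 : 𝓞 K, (B : 𝓞 K) ^ (D + j) ∣ a 0 * y0 ^ 2 + ∑ i : Fin m, a i.succ * (x i.succ + (B : 𝓞 K) ^ D * (u i).out) ^ 2 := by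
    intro u
    set g' := g + ∑ i : Fin m, a i.succ * (2 * x i.succ * (u i).out + (B : 𝓞 K) ^ D * (u i).out ^ 2) with hg'
    obtain ⟨z, w, hz⟩ := hensel (B : 𝓞 K) s (a 0 * t ^ 2) g' j
    refine ⟨x 0 + t * (B : 𝓞 K) ^ (E + 1) * z, w, ?_⟩
    have e1 : ∑ i : Fin m, a i.succ * (x i.succ + (B : 𝓞 K) ^ D * (u i).out) ^ 2 = ∑ i : Fin m, a i.succ * x i.succ ^ 2 +
      (B : 𝓞 K) ^ D * ∑ i : Fin m, a i.succ * (2 * x i.succ * (u i).out + (B : 𝓞 K) ^ D * (u i).out ^ 2) := by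
      rw [Finset.mul_sum, ← Finset.sum_add_distrib]
      exact Finset.sum_congr rfl fun _ _ => by ring
    have e2 : ∑ i : Fin m, a i.succ * x i.succ ^ 2 = (B : 𝓞 K) ^ D * g - a 0 * x 0 ^ 2 := by
      rw [← hg, qf, Fin.sum_univ_succ]; ring
    rw [e1, e2, pow_add _ D j, mul_assoc _ _ w, ← hz, hg', hD]
    linear_combination ((B : 𝓞 K) ^ (E + 1) * z) * ht
  choose y0 hy0 using key
  let f : (Fin m → A) → Sol a (B ^ (D + j)) := fun u => ⟨Fin.cons (Ideal.Quotient.mk _ (y0 u)) fun i => Ideal.Quotient.mk _ (x i.succ + (B : 𝓞 K) ^ D * (u i).out), by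
    rw [Fin.sum_univ_succ]
    simp only [Fin.cons_zero, Fin.cons_succ, ← map_pow, ← map_mul, ← map_sum, ← map_add]
    rw [Ideal.Quotient.eq_zero_iff_mem, Ideal.mem_span_singleton]
    push_cast
    exact hy0 u⟩
  have hf : Function.Injective f := by
    intro u u' h
    funext i
    have h1 := congrFun (congrArg Subtype.val h) i.succ
    simp only [f, Fin.cons_succ] at h1
    rw [Ideal.Quotient.mk_eq_mk_iff_sub_mem, Ideal.mem_span_singleton] at h1
    obtain ⟨w, hw⟩ := h1
    have h2 : (B : 𝓞 K) ^ D * ((u i).out - (u' i).out) = (B : 𝓞 K) ^ D * ((B : 𝓞 K) ^ j * w) := by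
      push_cast at hw
      rw [pow_add] at hw
      linear_combination hw
    have h3 := mul_left_cancel₀ (pow_ne_zero D hB') h2
    rw [← Ideal.Quotient.mk_out (u i), ← Ideal.Quotient.mk_out (u' i), Ideal.Quotient.mk_eq_mk_iff_sub_mem, Ideal.mem_span_singleton]
    push_cast
    exact ⟨w, h3⟩
  have := Nat.card_le_card_of_injective f hf
  refine le_trans (le_of_eq ?_) this
  rw [Nat.card_fun, card_quot]
  simp [pow_mul]

end HM

end PartPS1

section PartPS2
open NumberField Module
open scoped ENNReal

namespace HM

variable {K : Type*} [Field K] [NumberField K]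

/-- conductor of a character -/
def ann {A : Type*} [CommRing A] (ψ : AddChar A ℂ) : Ideal A where
  carrier := {h | ∀ r, ψ (h * r) = 1}
  zero_mem' := fun r => by simp
  add_mem' := fun {x y} hx hy r => by rw [add_mul, AddChar.map_add_eq_mul, hx r, hy r, one_mul]
  smul_mem' := fun c x hx r => by
    change ψ (c * x * r) = 1
    rw [show c * x * r = x * (c * r) by ring]; exact hx _

theorem mem_ann {A : Type*} [CommRing A] (ψ : AddChar A ℂ) (h : A) : h ∈ ann ψ ↔ ∀ r, ψ (h * r) = 1 := Iff.rfl

theorem gauss_bound {A : Type*} [CommRing A] [Fintype A] (ψ : AddChar A ℂ) (b : A) (hb : IsUnit (2 * b)) :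
    ‖∑ r, ψ (b * r ^ 2)‖ ^ 2 ≤ Nat.card A * Nat.card (ann ψ) := by
  classical
  have h1 : (((‖∑ r, ψ (b * r ^ 2)‖ ^ 2 : ℝ)) : ℂ) = ∑ h, ψ (b * h ^ 2) * ∑ s, ψ ((2 * b * h) * s) := by
    rw [Complex.ofReal_pow, ← Complex.mul_conj', map_sum, Finset.sum_mul_sum, Finset.sum_comm]
    have : ∀ s, ∑ r, ψ (b * r ^ 2) * (starRingEnd ℂ) (ψ (b * s ^ 2)) = ∑ h, ψ (b * h ^ 2) * ψ ((2 * b * h) * s) := by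
      intro s
      rw [← Equiv.sum_comp (Equiv.addRight s)]
      refine Finset.sum_congr rfl fun h _ => ?_
      rw [← AddChar.map_neg_eq_conj, ← AddChar.map_add_eq_mul, ← AddChar.map_add_eq_mul]
      congr 1
      simp; ring
    simp_rw [this, Finset.mul_sum]
    rw [Finset.sum_comm]
  have h2 : ∀ h, ∑ s, ψ ((2 * b * h) * s) = if h ∈ ann ψ then (Nat.card A : ℂ) else 0 := by
    intro h
    have e : ∑ s, ψ ((2 * b * h) * s) = ∑ s, (AddChar.mulShift ψ (2 * b * h)) s := rfl
    rw [e, AddChar.sum_eq_ite]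
    have : AddChar.mulShift ψ (2 * b * h) = 0 ↔ h ∈ ann ψ := by
      rw [← Ideal.unit_mul_mem_iff_mem (ann ψ) hb, mem_ann]
      constructor
      · intro h r
        have := DFunLike.congr_fun h r
        simpa using this
      · intro h
        ext r
        simpa using h r
    simp [this]
  have h3 : ‖∑ r, ψ (b * r ^ 2)‖ ^ 2 = ‖∑ h, ψ (b * h ^ 2) * ∑ s, ψ ((2 * b * h) * s)‖ := by
    rw [← h1, Complex.norm_real, Real.norm_of_nonneg (by positivity)]
  rw [h3]
  refine (norm_sum_le _ _).trans ?_
  have h4 : ∀ h, ‖ψ (b * h ^ 2) * ∑ s, ψ ((2 * b * h) * s)‖ = if h ∈ ann ψ then (Nat.card A : ℝ) else 0 := by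
    intro h
    rw [norm_mul, AddChar.norm_apply, one_mul, h2]
    split_ifs <;> simp
  simp_rw [h4]
  rw [← Finset.sum_filter, Finset.sum_const, nsmul_eq_mul, mul_comm]
  gcongr
  rw [Nat.card_eq_fintype_card, ← Fintype.card_subtype]

theorem map_sum_char {A ι : Type*} [AddCommGroup A] (ψ : AddChar A ℂ) (s : Finset ι) (f : ι → A) :
    ψ (∑ i ∈ s, f i) = ∏ i ∈ s, ψ (f i) := by
  classical
  induction s using Finset.induction_on with
  | empty => simp
  | insert a s ha ih => rw [Finset.sum_insert ha, Finset.prod_insert ha, AddChar.map_add_eq_mul, ih]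

/-- counting identity -/
theorem count_id {A : Type*} [CommRing A] [Fintype A] {m : ℕ} (b : Fin m → A) :
    ((Nat.card {r : Fin m → A // ∑ i, b i * r i ^ 2 = 0} : ℂ)) * Nat.card A =
      ∑ ψ : AddChar A ℂ, ∏ i, ∑ r, ψ (b i * r ^ 2) := by
  classical
  have h1 : ∀ ψ : AddChar A ℂ, ∏ i, ∑ r, ψ (b i * r ^ 2) = ∑ r : Fin m → A, ψ (∑ i, b i * r i ^ 2) := by
    intro ψ
    rw [Finset.prod_univ_sum]
    simp only [Fintype.piFinset_univ]
    refine Finset.sum_congr rfl fun r _ => ?_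
    exact (map_sum_char ψ _ _).symm
  simp_rw [h1]
  rw [Finset.sum_comm]
  simp_rw [AddChar.sum_apply_eq_ite]
  rw [← Finset.sum_filter, Finset.sum_const, nsmul_eq_mul, ← Fintype.card_subtype]
  simp [Nat.card_eq_fintype_card]


section
variable (q : ℕ)

/-- conductor ideal -/
noncomputable def cond (ψ : AddChar (𝓞 K ⧸ Ideal.span {(q : 𝓞 K)}) ℂ) : Ideal (𝓞 K) := (ann ψ).comap (Ideal.Quotient.mk _)

theorem q_mem_cond (ψ : AddChar (𝓞 K ⧸ Ideal.span {(q : 𝓞 K)}) ℂ) : Ideal.span {(q : 𝓞 K)} ≤ cond q ψ := by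
  intro x hx
  change Ideal.Quotient.mk _ x ∈ ann ψ
  rw [Ideal.Quotient.eq_zero_iff_mem.2 hx]; exact zero_mem _

theorem card_cond (hq : q ≠ 0) (ψ : AddChar (𝓞 K ⧸ Ideal.span {(q : 𝓞 K)}) ℂ) :
    Ideal.absNorm (cond q ψ) * Nat.card (ann ψ) = Nat.card (𝓞 K ⧸ Ideal.span {(q : 𝓞 K)}) := by
  have _ := finite_quot (K := K) q hq
  have h1 : Ideal.absNorm (cond q ψ) = Nat.card ((𝓞 K ⧸ Ideal.span {(q : 𝓞 K)}) ⧸ ann ψ) := by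
    rw [Ideal.absNorm_apply, Submodule.cardQuot_apply]
    have hs : Function.Surjective ((Ideal.Quotient.mk (ann ψ)).comp (Ideal.Quotient.mk (Ideal.span {(q : 𝓞 K)}))) :=
      Ideal.Quotient.mk_surjective.comp Ideal.Quotient.mk_surjective
    have hk : RingHom.ker ((Ideal.Quotient.mk (ann ψ)).comp (Ideal.Quotient.mk (Ideal.span {(q : 𝓞 K)}))) = cond q ψ := by
      ext x
      rw [RingHom.mem_ker, RingHom.comp_apply, Ideal.Quotient.eq_zero_iff_mem]; rfl
    rw [← hk]
    exact Nat.card_congr (RingHom.quotientKerEquivOfSurjective hs).toEquiv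
  rw [h1, mul_comm]
  exact (Submodule.card_eq_card_quotient_mul_card (ann ψ)).symm

theorem cond_fiber (hq : q ≠ 0) (I : Ideal (𝓞 K)) (hI : I ≠ ⊥) :
    ENat.card {ψ : AddChar (𝓞 K ⧸ Ideal.span {(q : 𝓞 K)}) ℂ // cond q ψ = I} ≤ (Ideal.absNorm I : ℕ∞) := by
  classical
  have hfin : Finite (𝓞 K ⧸ I) := Ideal.finiteQuotientOfFreeOfNeBot I hI
  let _ : Fintype (𝓞 K ⧸ I) := Fintype.ofFinite _
  have key : ∀ ψ : {ψ : AddChar (𝓞 K ⧸ Ideal.span {(q : 𝓞 K)}) ℂ // cond q ψ = I}, ∀ x ∈ I, ψ.1 (Ideal.Quotient.mk _ x) = 1 := by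
    intro ψ x hx
    rw [← ψ.2] at hx
    have := hx 1
    rwa [mul_one] at this
  have key2 : ∀ ψ : {ψ : AddChar (𝓞 K ⧸ Ideal.span {(q : 𝓞 K)}) ℂ // cond q ψ = I}, ∀ x y : 𝓞 K, x - y ∈ I →
      ψ.1 (Ideal.Quotient.mk _ x) = ψ.1 (Ideal.Quotient.mk _ y) := by
    intro ψ x y h
    have : x = (x - y) + y := by ring
    rw [this, map_add, AddChar.map_add_eq_mul, key ψ _ h, one_mul]
  let f : {ψ : AddChar (𝓞 K ⧸ Ideal.span {(q : 𝓞 K)}) ℂ // cond q ψ = I} → AddChar (𝓞 K ⧸ I) ℂ := fun ψ =>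
    { toFun := fun x => ψ.1 (Ideal.Quotient.mk _ x.out)
      map_zero_eq_one' := by
        have : (0 : 𝓞 K ⧸ I).out ∈ I := by
          rw [← Ideal.Quotient.eq_zero_iff_mem, Ideal.Quotient.mk_out]
        exact key ψ _ this
      map_add_eq_mul' := fun x y => by
        rw [← AddChar.map_add_eq_mul, ← map_add]
        apply key2
        rw [← Ideal.Quotient.eq_zero_iff_mem]; simp }
  have hf : Function.Injective f := by
    intro ψ ψ' h
    apply Subtype.ext
    ext x
    obtain ⟨x, rfl⟩ := Ideal.Quotient.mk_surjective x
    have h1 := congrArg (fun c : AddChar (𝓞 K ⧸ I) ℂ => c (Ideal.Quotient.mk I x)) h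
    have h2 : x - (Ideal.Quotient.mk I x).out ∈ I := by
      rw [← Ideal.Quotient.eq_zero_iff_mem]; simp
    rw [key2 ψ _ _ h2, key2 ψ' _ _ h2]
    exact h1
  have h1 := ENat.card_le_card_of_injective hf
  refine h1.trans ?_
  have h2 : Nat.card (AddChar (𝓞 K ⧸ I) ℂ) = Nat.card (𝓞 K ⧸ I) := by
    rw [Nat.card_eq_fintype_card, Nat.card_eq_fintype_card, AddChar.card_eq]
  have h3 : Finite (AddChar (𝓞 K ⧸ I) ℂ) := inferInstance
  rw [ENat.card_eq_coe_natCard, h2]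
  rw [Ideal.absNorm_apply, Submodule.cardQuot_apply]

theorem cond_ne_bot (hq : q ≠ 0) (ψ : AddChar (𝓞 K ⧸ Ideal.span {(q : 𝓞 K)}) ℂ) : cond q ψ ≠ ⊥ := by
  intro h
  have := q_mem_cond q ψ
  rw [h, le_bot_iff] at this
  simp [hq] at this

theorem sum_cond (hq : q ≠ 0) (f : ℕ → ℝ≥0∞) : ∑' ψ : AddChar (𝓞 K ⧸ Ideal.span {(q : 𝓞 K)}) ℂ, f (Ideal.absNorm (cond q ψ)) ≤
    ∑' I : {I : Ideal (𝓞 K) // I ≠ ⊥}, (Ideal.absNorm I.1 : ℝ≥0∞) * f (Ideal.absNorm I.1) := by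
  let p : AddChar (𝓞 K ⧸ Ideal.span {(q : 𝓞 K)}) ℂ → {I : Ideal (𝓞 K) // I ≠ ⊥} := fun γ => ⟨cond q γ, cond_ne_bot q hq γ⟩
  rw [← (Equiv.sigmaFiberEquiv p).tsum_eq, ENNReal.tsum_sigma']
  refine ENNReal.tsum_le_tsum fun I => ?_
  have h1 : ∀ γ : {γ : AddChar (𝓞 K ⧸ Ideal.span {(q : 𝓞 K)}) ℂ // p γ = I}, f (Ideal.absNorm (cond q ((Equiv.sigmaFiberEquiv p) ⟨I, γ⟩))) = f (Ideal.absNorm I.1) := by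
    intro γ
    have := γ.2
    have h2 : cond q γ.1 = I.1 := congrArg Subtype.val this
    change f (Ideal.absNorm (cond q γ.1)) = _
    rw [h2]
  rw [tsum_congr h1, ENNReal.tsum_const]
  gcongr
  have h3 : ENat.card {γ : AddChar (𝓞 K ⧸ Ideal.span {(q : 𝓞 K)}) ℂ // p γ = I} ≤ (Ideal.absNorm I.1 : ℕ∞) := by
    refine le_trans (le_of_eq ?_) (cond_fiber q hq I.1 I.2)
    refine ENat.card_congr (Equiv.subtypeEquivRight fun γ => ?_)
    simp [p, Subtype.ext_iff]
  exact_mod_cast (ENat.toENNReal_le.2 h3)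

theorem prod_gauss (hq : q ≠ 0) {m : ℕ} (hm : 5 ≤ m) (b : Fin m → 𝓞 K ⧸ Ideal.span {(q : 𝓞 K)}) (hb : ∀ i, IsUnit (2 * b i))
    [Fintype (𝓞 K ⧸ Ideal.span {(q : 𝓞 K)})]
    (ψ : AddChar (𝓞 K ⧸ Ideal.span {(q : 𝓞 K)}) ℂ) :
    ‖∏ i, ∑ r, ψ (b i * r ^ 2)‖ ≤ (Nat.card (𝓞 K ⧸ Ideal.span {(q : 𝓞 K)}) : ℝ) ^ m * (Ideal.absNorm (cond q ψ) : ℝ) ^ (-(5 / 2) : ℝ) := by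
  set N : ℝ := (Ideal.absNorm (cond q ψ) : ℝ) with hN
  set C : ℝ := (Nat.card (𝓞 K ⧸ Ideal.span {(q : 𝓞 K)}) : ℝ) with hC
  have hN1 : 1 ≤ N := by
    have : Ideal.absNorm (cond q ψ) ≠ 0 := by rw [Ne, Ideal.absNorm_eq_zero_iff]; exact cond_ne_bot q hq ψ
    rw [hN]; exact_mod_cast Nat.pos_of_ne_zero this
  have hcc : N * Nat.card (ann ψ) = C := by rw [hN, hC, ← card_cond q hq ψ]; push_cast; rfl
  have hC0 : 0 ≤ C := by positivity
  have h1 : ∀ i, ‖∑ r, ψ (b i * r ^ 2)‖ ≤ C * N ^ (-(1 / 2) : ℝ) := by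
    intro i
    have := gauss_bound ψ (b i) (hb i)
    rw [← hC] at this
    refine le_of_sq_le_sq ?_ (by positivity)
    refine this.trans (le_of_eq ?_)
    have e : (N ^ (-(1 / 2) : ℝ)) ^ 2 = N⁻¹ := by
      rw [← Real.rpow_natCast, ← Real.rpow_mul (by linarith), ← Real.rpow_neg_one]; norm_num
    rw [mul_pow, e, pow_two, mul_assoc]
    congr 1
    rw [← hcc]; field_simp
  rw [norm_prod]
  refine (Finset.prod_le_prod (fun _ _ => norm_nonneg _) fun i _ => h1 i).trans ?_
  rw [Finset.prod_const, Finset.card_univ, Fintype.card_fin, mul_pow]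
  gcongr
  rw [← Real.rpow_natCast, ← Real.rpow_mul (by linarith)]
  refine Real.rpow_le_rpow_of_exponent_le hN1 ?_
  have : (5 : ℝ) ≤ m := by exact_mod_cast hm
  linarith

end

end HM

end PartPS2

section PartPS3
open NumberField Module
open scoped ENNReal

namespace HM

variable {K : Type*} [Field K] [NumberField K]

theorem count_q2 {m : ℕ} (hm : 5 ≤ m) (a : Fin m → 𝓞 K) (ha : ∀ i, a i ≠ 0) : ∃ P : ℕ, ∀ q : ℕ, q ≠ 0 →
    Nat.Coprime P.factorial q → (q ^ Fintype.card (Idx K)) ^ (m - 1) ≤ 2 * Nat.card (Sol a q) := by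
  classical
  obtain ⟨P1, hP1⟩ := ideal_tail K (1 / 2) (by simp)
  have h0 : ∀ i, ∃ (h' : 𝓞 K) (N : ℕ), N ≠ 0 ∧ h' * (2 * a i) = (N : 𝓞 K) := fun i => exists_inv_mul _ (by simp [ha])
  choose h' N hN hh' using h0
  refine ⟨max P1 (Finset.univ.sup N), fun q hq hcop => ?_⟩
  set P := max P1 (Finset.univ.sup N) with hP
  have _ := finite_quot (K := K) q hq
  let _ : Fintype (𝓞 K ⧸ Ideal.span {(q : 𝓞 K)}) := Fintype.ofFinite _
  set C := Nat.card (𝓞 K ⧸ Ideal.span {(q : 𝓞 K)}) with hC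
  have hC0 : 0 < C := Nat.card_pos
  have hunit : ∀ i, IsUnit (2 * Ideal.Quotient.mk (Ideal.span {(q : 𝓞 K)}) (a i)) := by
    intro i
    have h1 : N i ∣ P.factorial := Nat.dvd_factorial (Nat.pos_of_ne_zero (hN i)) ((Finset.le_sup (Finset.mem_univ i)).trans (le_max_right _ _))
    have h2 : Nat.Coprime (N i) q := hcop.coprime_dvd_left h1
    have h3 : IsUnit (Ideal.Quotient.mk (Ideal.span {(q : 𝓞 K)}) (N i : 𝓞 K)) := by
      have h4 : IsCoprime (N i : ℤ) (q : ℤ) := Nat.isCoprime_iff_coprime.2 h2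
      obtain ⟨u, v, huv⟩ := h4
      refine IsUnit.of_mul_eq_one_right (Ideal.Quotient.mk _ (u : 𝓞 K)) ?_
      rw [← map_mul, ← map_one (Ideal.Quotient.mk _), Ideal.Quotient.mk_eq_mk_iff_sub_mem, Ideal.mem_span_singleton]
      have := congrArg (Int.cast : ℤ → 𝓞 K) huv
      push_cast at this
      exact ⟨-v, by linear_combination this⟩
    rw [← hh' i, map_mul] at h3
    have := isUnit_of_mul_isUnit_right h3
    rwa [map_mul, map_ofNat] at this
  have hbig : ∀ ψ : AddChar (𝓞 K ⧸ Ideal.span {(q : 𝓞 K)}) ℂ, ψ ≠ 1 → P1 < Ideal.absNorm (cond q ψ) := by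
    intro ψ hψ
    by_contra hc
    rw [not_lt] at hc
    have hn0 : Ideal.absNorm (cond q ψ) ≠ 0 := by rw [Ne, Ideal.absNorm_eq_zero_iff]; exact cond_ne_bot q hq ψ
    have hd : Ideal.absNorm (cond q ψ) ∣ q ^ Fintype.card (Idx K) := by
      have := Ideal.absNorm_dvd_absNorm_of_le (q_mem_cond q ψ)
      rwa [Ideal.absNorm_span_natCast, Module.finrank_eq_card_chooseBasisIndex] at this
    have hd2 : Ideal.absNorm (cond q ψ) ∣ P.factorial := Nat.dvd_factorial (Nat.pos_of_ne_zero hn0) (hc.trans (le_max_left _ _))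
    have h1 := Nat.eq_one_of_dvd_coprimes (hcop.pow_right _) hd2 hd
    rw [Ideal.absNorm_eq_one_iff, Ideal.eq_top_iff_one] at h1
    apply hψ
    have h2 : (1 : 𝓞 K ⧸ Ideal.span {(q : 𝓞 K)}) ∈ ann ψ := by
      have : Ideal.Quotient.mk _ (1 : 𝓞 K) ∈ ann ψ := h1
      rwa [map_one] at this
    ext r
    have := h2 r
    rw [one_mul] at this
    simpa using this
  set b : Fin m → 𝓞 K ⧸ Ideal.span {(q : 𝓞 K)} := fun i => Ideal.Quotient.mk _ (a i) with hb
  have hid := count_id b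
  set c := Nat.card {r : Fin m → 𝓞 K ⧸ Ideal.span {(q : 𝓞 K)} // ∑ i, b i * r i ^ 2 = 0} with hc
  rw [← Finset.add_sum_erase _ _ (Finset.mem_univ (1 : AddChar (𝓞 K ⧸ Ideal.span {(q : 𝓞 K)}) ℂ))] at hid
  have hmain : ∏ i : Fin m, ∑ r, (1 : AddChar (𝓞 K ⧸ Ideal.span {(q : 𝓞 K)}) ℂ) (b i * r ^ 2) = (C : ℂ) ^ m := by
    simp [hC, Nat.card_eq_fintype_card]
  rw [hmain] at hid
  -- tail
  have htail : ∑ ψ ∈ Finset.univ.erase (1 : AddChar (𝓞 K ⧸ Ideal.span {(q : 𝓞 K)}) ℂ), ‖∏ i, ∑ r, ψ (b i * r ^ 2)‖ ≤ (C : ℝ) ^ m * (1 / 2) := by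
    set f : ℕ → ℝ≥0∞ := fun n => if n ≤ P1 then 0 else (n : ℝ≥0∞) ^ (-(5 / 2) : ℝ) with hf
    have e1 : ∑ ψ ∈ Finset.univ.erase (1 : AddChar (𝓞 K ⧸ Ideal.span {(q : 𝓞 K)}) ℂ), ENNReal.ofReal ((Ideal.absNorm (cond q ψ) : ℝ) ^ (-(5 / 2) : ℝ)) ≤ 1 / 2 := by
      calc _ ≤ ∑ ψ ∈ Finset.univ.erase (1 : AddChar (𝓞 K ⧸ Ideal.span {(q : 𝓞 K)}) ℂ), f (Ideal.absNorm (cond q ψ)) := by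
            refine Finset.sum_le_sum fun ψ hψ => ?_
            have h1 := hbig ψ (Finset.ne_of_mem_erase hψ)
            simp only [hf, if_neg (not_le.2 h1)]
            rw [← ENNReal.ofReal_rpow_of_pos (by exact_mod_cast (by omega : 0 < Ideal.absNorm (cond q ψ))), ENNReal.ofReal_natCast]
        _ ≤ ∑ ψ : AddChar (𝓞 K ⧸ Ideal.span {(q : 𝓞 K)}) ℂ, f (Ideal.absNorm (cond q ψ)) :=
            Finset.sum_le_sum_of_subset (Finset.subset_univ _)
        _ = ∑' ψ : AddChar (𝓞 K ⧸ Ideal.span {(q : 𝓞 K)}) ℂ, f (Ideal.absNorm (cond q ψ)) := (tsum_fintype _).symm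
        _ ≤ _ := sum_cond q hq f
        _ ≤ _ := by
            refine le_trans (ENNReal.tsum_le_tsum fun I => ?_) hP1
            simp only [hf]
            split_ifs with h
            · simp
            · have hn0 : Ideal.absNorm I.1 ≠ 0 := by rw [Ne, Ideal.absNorm_eq_zero_iff]; exact I.2
              nth_rewrite 1 [← ENNReal.rpow_one (Ideal.absNorm I.1 : ℝ≥0∞)]
              rw [← ENNReal.rpow_add _ _ (by exact_mod_cast hn0) (by simp)]
              norm_num
    rw [← ENNReal.ofReal_sum_of_nonneg (fun _ _ => by positivity)] at e1
    have e2 : ∑ ψ ∈ Finset.univ.erase (1 : AddChar (𝓞 K ⧸ Ideal.span {(q : 𝓞 K)}) ℂ), ((Ideal.absNorm (cond q ψ) : ℝ) ^ (-(5 / 2) : ℝ)) ≤ 1 / 2 := by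
      have : (1 / 2 : ℝ≥0∞) = ENNReal.ofReal (1 / 2) := by
        rw [ENNReal.ofReal_div_of_pos (by norm_num)]; simp
      rw [this] at e1
      exact (ENNReal.ofReal_le_ofReal_iff (by norm_num)).1 e1
    calc _ ≤ ∑ ψ ∈ Finset.univ.erase (1 : AddChar (𝓞 K ⧸ Ideal.span {(q : 𝓞 K)}) ℂ), (C : ℝ) ^ m * (Ideal.absNorm (cond q ψ) : ℝ) ^ (-(5 / 2) : ℝ) :=
          Finset.sum_le_sum fun ψ _ => prod_gauss q hq hm b hunit ψ
      _ ≤ _ := by rw [← Finset.mul_sum]; gcongr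
  have h5 : (C : ℝ) ^ m ≤ 2 * (c * C) := by
    have h6 : (C : ℂ) ^ m = c * C - ∑ ψ ∈ Finset.univ.erase (1 : AddChar (𝓞 K ⧸ Ideal.span {(q : 𝓞 K)}) ℂ), ∏ i, ∑ r, ψ (b i * r ^ 2) := by
      linear_combination -hid
    have h7 : (C : ℝ) ^ m ≤ c * C + (C : ℝ) ^ m * (1 / 2) := by
      calc (C : ℝ) ^ m = ‖(C : ℂ) ^ m‖ := by simp
        _ ≤ ‖(c * C : ℂ)‖ + _ := by rw [h6]; exact norm_sub_le _ _
        _ ≤ c * C + (C : ℝ) ^ m * (1 / 2) := by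
            refine add_le_add (by simp) ((norm_sum_le _ _).trans htail)
    linarith
  have h8 : C ^ (m - 1) * C ≤ 2 * c * C := by
    rw [← pow_succ, show m - 1 + 1 = m by omega, mul_assoc]
    exact_mod_cast h5
  rw [← card_quot (K := K), ← hC]
  exact Nat.le_of_mul_le_mul_right h8 hC0

theorem sol_mul {m : ℕ} (a : Fin m → 𝓞 K) (q1 q2 : ℕ) (h1 : q1 ≠ 0) (h2 : q2 ≠ 0) (hc : Nat.Coprime q1 q2) :
    Nat.card (Sol a q1) * Nat.card (Sol a q2) ≤ Nat.card (Sol a (q1 * q2)) := by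
  classical
  have _ := finite_quot (K := K) q1 h1
  have _ := finite_quot (K := K) q2 h2
  have _ := finite_quot (K := K) (q1 * q2) (mul_ne_zero h1 h2)
  obtain ⟨u, v, huv⟩ := Nat.isCoprime_iff_coprime.2 hc
  have huv' := congrArg (Int.cast : ℤ → 𝓞 K) huv
  push_cast at huv'
  rw [← Nat.card_prod]
  let g : Sol a q1 × Sol a q2 → Fin m → 𝓞 K := fun r i => (r.1.1 i).out * (v * q2) + (r.2.1 i).out * (u * q1)
  have hg1 : ∀ r i, Ideal.Quotient.mk (Ideal.span {(q1 : 𝓞 K)}) (g r i) = r.1.1 i := by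
    intro r i
    rw [← Ideal.Quotient.mk_out (r.1.1 i), Ideal.Quotient.mk_eq_mk_iff_sub_mem, Ideal.mem_span_singleton]
    exact ⟨u * (r.2.1 i).out - u * (r.1.1 i).out, by simp only [g]; linear_combination (r.1.1 i).out * huv'⟩
  have hg2 : ∀ r i, Ideal.Quotient.mk (Ideal.span {(q2 : 𝓞 K)}) (g r i) = r.2.1 i := by
    intro r i
    rw [← Ideal.Quotient.mk_out (r.2.1 i), Ideal.Quotient.mk_eq_mk_iff_sub_mem, Ideal.mem_span_singleton]
    exact ⟨v * (r.1.1 i).out - v * (r.2.1 i).out, by simp only [g]; linear_combination (r.2.1 i).out * huv'⟩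
  have hd1 : ∀ r, (q1 : 𝓞 K) ∣ qf a (g r) := by
    intro r
    rw [← Ideal.mem_span_singleton, ← Ideal.Quotient.eq_zero_iff_mem, qf]
    simp only [map_sum, map_mul, map_pow, hg1]
    exact r.1.2
  have hd2 : ∀ r, (q2 : 𝓞 K) ∣ qf a (g r) := by
    intro r
    rw [← Ideal.mem_span_singleton, ← Ideal.Quotient.eq_zero_iff_mem, qf]
    simp only [map_sum, map_mul, map_pow, hg2]
    exact r.2.2
  have hcop : IsCoprime (q1 : 𝓞 K) (q2 : 𝓞 K) := ⟨u, v, huv'⟩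
  let f : Sol a q1 × Sol a q2 → Sol a (q1 * q2) := fun r => ⟨fun i => Ideal.Quotient.mk _ (g r i), by
    simp only [← map_sum, ← map_mul, ← map_pow]
    rw [Ideal.Quotient.eq_zero_iff_mem, Ideal.mem_span_singleton]
    push_cast
    exact hcop.mul_dvd (hd1 r) (hd2 r)⟩
  refine Nat.card_le_card_of_injective f ?_
  intro r r' h
  have h3 : ∀ i, ((q1 * q2 : ℕ) : 𝓞 K) ∣ g r i - g r' i := by
    intro i
    have := congrFun (congrArg Subtype.val h) i
    simp only [f] at this
    rwa [Ideal.Quotient.mk_eq_mk_iff_sub_mem, Ideal.mem_span_singleton] at this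
  push_cast at h3
  refine Prod.ext (Subtype.ext (funext fun i => ?_)) (Subtype.ext (funext fun i => ?_))
  · rw [← hg1 r, ← hg1 r', Ideal.Quotient.mk_eq_mk_iff_sub_mem, Ideal.mem_span_singleton]
    exact (dvd_mul_right _ _).trans (h3 i)
  · rw [← hg2 r, ← hg2 r', Ideal.Quotient.mk_eq_mk_iff_sub_mem, Ideal.mem_span_singleton]
    exact (dvd_mul_left _ _).trans (h3 i)

theorem split_nat (B N : ℕ) (hN : N ≠ 0) : ∃ k q2 : ℕ, q2 ≠ 0 ∧ Nat.Coprime B q2 ∧ N ∣ B ^ k * q2 := by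
  induction N using Nat.recOnMul with
  | zero => exact absurd rfl hN
  | one => exact ⟨0, 1, one_ne_zero, Nat.coprime_one_right _, one_dvd _⟩
  | prime p hp =>
    by_cases h : p ∣ B
    · exact ⟨1, 1, one_ne_zero, Nat.coprime_one_right _, by simpa using h⟩
    · exact ⟨0, p, hp.ne_zero, ((Nat.Prime.coprime_iff_not_dvd hp).2 h).symm, by simp⟩
  | mul a b iha ihb =>
    obtain ⟨k, q, hq, hc, hd⟩ := iha (fun h => hN (by simp [h]))
    obtain ⟨k', q', hq', hc', hd'⟩ := ihb (fun h => hN (by simp [h]))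
    refine ⟨k + k', q * q', mul_ne_zero hq hq', hc.mul_right hc', ?_⟩
    rw [pow_add, mul_mul_mul_comm]; exact mul_dvd_mul hd hd'

/-- singular series lower bound -/
theorem sing_series {m : ℕ} (hm : 5 ≤ m) (a : Fin m → 𝓞 K) (ha : ∀ i, a i ≠ 0) : ∃ κ : ℝ, 0 < κ ∧ ∀ N : ℕ, N ≠ 0 →
    ∃ q : ℕ, 0 < q ∧ N ∣ q ∧ κ * (q : ℝ) ^ (Fintype.card (Idx K) * (m - 1)) ≤ Nat.card (Sol a q) := by
  obtain ⟨P, hP⟩ := count_q2 hm a ha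
  have hB := Nat.factorial_ne_zero P
  set B := P.factorial with hBd
  obtain ⟨D, hD⟩ := count_B B hB hm a ha
  set e := Fintype.card (Idx K) * (m - 1) with he
  have hB0 : (0 : ℝ) < B := by exact_mod_cast Nat.pos_of_ne_zero hB
  refine ⟨(((B : ℝ) ^ D) ^ e * 2)⁻¹, by positivity, fun N hN => ?_⟩
  obtain ⟨k, q2, hq2, hc, hd⟩ := split_nat B N hN
  refine ⟨B ^ (D + k) * q2, Nat.pos_of_ne_zero (mul_ne_zero (pow_ne_zero _ hB) hq2), hd.trans (mul_dvd_mul (pow_dvd_pow _ (by omega)) dvd_rfl), ?_⟩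
  have h1 := hD k
  have h2 := hP q2 hq2 hc
  have h3 := sol_mul a (B ^ (D + k)) q2 (pow_ne_zero _ hB) hq2 (hc.pow_left _)
  have h1' : ((B : ℝ) ^ k) ^ e ≤ Nat.card (Sol a (B ^ (D + k))) := by exact_mod_cast h1
  have h2' : (q2 : ℝ) ^ e ≤ 2 * Nat.card (Sol a q2) := by rw [he, pow_mul]; exact_mod_cast h2
  have h3' : (Nat.card (Sol a (B ^ (D + k))) : ℝ) * Nat.card (Sol a q2) ≤ Nat.card (Sol a (B ^ (D + k) * q2)) := by exact_mod_cast h3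
  refine le_trans ?_ h3'
  rw [inv_mul_le_iff₀ (by positivity)]
  push_cast
  rw [pow_add, mul_pow, mul_pow]
  calc (((B : ℝ) ^ D) ^ e * ((B : ℝ) ^ k) ^ e) * (q2 : ℝ) ^ e ≤ (((B : ℝ) ^ D) ^ e * Nat.card (Sol a (B ^ (D + k)))) * (2 * Nat.card (Sol a q2)) := by
        gcongr
    _ = _ := by ring

end HM

end PartPS3

section PartPJ
open NumberField Module NumberField.mixedEmbedding NumberField.InfinitePlace

namespace HM

variable {K : Type*} [Field K] [NumberField K]

/-- coordinates to mixed space -/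
noncomputable def Mphi : (Idx K → ℝ) ≃L[ℝ] mixedSpace K :=
  ((mixedEmbedding.latticeBasis K).equivFun.symm).toContinuousLinearEquiv

theorem Mphi_apply (p : Idx K → ℝ) : Mphi p = ∑ j, p j • mixedEmbedding K (bs K j : 𝓞 K) := by
  change (mixedEmbedding.latticeBasis K).equivFun.symm p = _
  rw [Basis.equivFun_symm_apply]
  refine Finset.sum_congr rfl fun j _ => ?_
  rw [mixedEmbedding.latticeBasis_apply, integralBasis_apply]

theorem Mphi_co (x : 𝓞 K) : Mphi (fun j => (co x j : ℝ)) = mixedEmbedding K x := by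
  rw [Mphi_apply]
  conv_rhs => rw [← el_co x, el]
  change _ = mixedEmbedding K (algebraMap (𝓞 K) K _)
  rw [map_sum, map_sum]
  refine Finset.sum_congr rfl fun j _ => ?_
  rw [zsmul_eq_mul, map_mul, map_mul, map_intCast, map_intCast, ← zsmul_eq_mul]
  exact Int.cast_smul_eq_zsmul ℝ _ _

open scoped Classical in
theorem exists_sqrt (S : mixedSpace K) (hS : ∀ w, 0 < S.1 w) : ∃ Z : mixedSpace K, Z ^ 2 = S ∧ ‖Z‖ ≤ ‖S‖ + 1 := by
  have h1 : ∀ w, ∃ z : ℂ, z ^ 2 = S.2 w := fun w => IsAlgClosed.exists_pow_nat_eq _ (by norm_num)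
  choose z hz using h1
  refine ⟨(fun w => Real.sqrt (S.1 w), z), ?_, ?_⟩
  · refine Prod.ext (funext fun w => ?_) (funext fun w => ?_)
    · exact Real.sq_sqrt (hS w).le
    · exact hz w
  · have key : ∀ (t s : ℝ), t ^ 2 = s → s ≤ ‖S‖ → t ≤ ‖S‖ + 1 := by
      intro t s h1 h2
      nlinarith [norm_nonneg S]
    have hS1 : ∀ w, ‖S.1 w‖ ≤ ‖S‖ := fun w => (norm_le_pi_norm S.1 w).trans (norm_fst_le S)
    have hS2 : ∀ w, ‖S.2 w‖ ≤ ‖S‖ := fun w => (norm_le_pi_norm S.2 w).trans (norm_snd_le S)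
    refine norm_prod_le_iff.2 ⟨(pi_norm_le_iff_of_nonneg (by positivity)).2 fun w => ?_, (pi_norm_le_iff_of_nonneg (by positivity)).2 fun w => ?_⟩
    · refine key _ _ ?_ (hS1 w)
      rw [← norm_pow]; simp only [Real.sq_sqrt (hS w).le]
    · refine key _ _ ?_ (hS2 w)
      rw [← norm_pow, hz w]

/-- indefinite at every real place -/
def Indef {m : ℕ} (a : Fin m → 𝓞 K) : Prop :=
  ∀ σ : K →+* ℝ, ¬ ((∀ i, 0 < σ (a i : 𝓞 K)) ∨ (∀ i, σ (a i : 𝓞 K) < 0))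

open scoped Classical in
theorem section_exists {m : ℕ} (a : Fin (m + 1) → 𝓞 K) (ha : ∀ i, a i ≠ 0) (hi : Indef a) :
    ∃ (P : Fin m → Idx K → ℝ) (ρ B : ℝ), 0 < ρ ∧ ρ ≤ 1 ∧ 0 ≤ B ∧ (∀ i j, |P i j| ≤ B) ∧ ∀ p : Fin m → Idx K → ℝ,
      (∀ i j, |p i j - P i j| ≤ ρ) → ∃ Z : mixedSpace K, ‖Z‖ ≤ B ∧
        mixedEmbedding K (a 0 : 𝓞 K) * Z ^ 2 + ∑ i : Fin m, mixedEmbedding K (a i.succ : 𝓞 K) * (Mphi (p i)) ^ 2 = 0 := by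
  classical
  have hak : ∀ i, ((a i : 𝓞 K) : K) ≠ 0 := fun i => by simpa using ha i
  have h1 : ∀ w : {w : InfinitePlace K // IsReal w}, ∃ i : Fin m, embedding_of_isReal w.2 (a 0 : 𝓞 K) * embedding_of_isReal w.2 (a i.succ : 𝓞 K) < 0 := by
    intro w
    set σ := embedding_of_isReal w.2
    have hs : ∀ i, σ (a i : 𝓞 K) ≠ 0 := fun i => by simpa using hak i
    have := hi σ
    by_contra! hcon
    apply this
    rcases lt_or_gt_of_ne (hs 0) with h | h
    · right
      refine Fin.cases h fun i => ?_
      have := hcon i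
      exact lt_of_le_of_ne (by nlinarith) (hs i.succ)
    · left
      refine Fin.cases h fun i => ?_
      have := hcon i
      exact lt_of_le_of_ne (by nlinarith) (hs i.succ).symm
  choose I hI using h1
  set β := mixedEmbedding K ((a 0 : 𝓞 K) : K)⁻¹ with hβ
  have hβ1 : mixedEmbedding K (a 0 : 𝓞 K) * β = 1 := by rw [hβ, ← map_mul, mul_inv_cancel₀ (hak 0), map_one]
  let S : (Fin m → Idx K → ℝ) → mixedSpace K := fun p => - β * ∑ i : Fin m, mixedEmbedding K (a i.succ : 𝓞 K) * (Mphi (p i)) ^ 2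
  have hS : Continuous S := by
    have : ∀ i : Fin m, Continuous fun p : Fin m → Idx K → ℝ => Mphi (p i) := fun i => Mphi.continuous.comp (continuous_apply i)
    fun_prop
  let P : Fin m → Idx K → ℝ := fun i => Mphi.symm ((fun w => if I w = i then 1 else 0), 0)
  have hU : IsOpen {p | ∀ w, 0 < (S p).1 w} := by
    simp only [Set.ofPred_forall]
    refine isOpen_iInter_of_finite fun w => isOpen_lt continuous_const ?_
    exact (continuous_apply w).comp (continuous_fst.comp hS)
  have hP : P ∈ {p | ∀ w, 0 < (S p).1 w} := by
    intro w
    have e : (S P).1 w = - (embedding_of_isReal w.2 (a 0 : 𝓞 K))⁻¹ * embedding_of_isReal w.2 (a (I w).succ : 𝓞 K) := by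
      simp only [S, P, ContinuousLinearEquiv.apply_symm_apply]
      simp [hβ, Prod.fst_sum, ite_pow]
    rw [e]
    have h2 := hI w
    have hs : embedding_of_isReal w.2 (a 0 : 𝓞 K) ≠ 0 := by simpa using hak 0
    have : - (embedding_of_isReal w.2 (a 0 : 𝓞 K))⁻¹ * embedding_of_isReal w.2 (a (I w).succ : 𝓞 K) =
      -(embedding_of_isReal w.2 (a 0 : 𝓞 K) * embedding_of_isReal w.2 (a (I w).succ : 𝓞 K)) * ((embedding_of_isReal w.2 (a 0 : 𝓞 K))⁻¹) ^ 2 := by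
      field_simp
    rw [this]
    have h3 : 0 < ((embedding_of_isReal w.2 (a 0 : 𝓞 K))⁻¹) ^ 2 := by positivity
    exact mul_pos (by linarith) h3
  obtain ⟨ρ, hρ, hball⟩ := Metric.isOpen_iff.1 hU P hP
  obtain ⟨C, hC⟩ := (isCompact_closedBall P 1).exists_bound_of_continuousOn hS.continuousOn
  have hC0 : 0 ≤ C := (norm_nonneg _).trans (hC P (Metric.mem_closedBall_self zero_le_one))
  refine ⟨P, min (ρ / 2) 1, max (C + 1) ‖P‖, by positivity, min_le_right _ _, by positivity, fun i j => ?_, fun p hp => ?_⟩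
  · refine le_trans ?_ (le_max_right _ _)
    exact (norm_le_pi_norm (P i) j).trans (norm_le_pi_norm P i)
  · have hd : dist p P ≤ min (ρ / 2) 1 := by
      rw [dist_pi_le_iff (by positivity)]
      intro i
      rw [dist_pi_le_iff (by positivity)]
      exact hp i
    have hpos : ∀ w, 0 < (S p).1 w := hball (lt_of_le_of_lt hd (lt_of_le_of_lt (min_le_left _ _) (by linarith)))
    obtain ⟨Z, hZ, hZn⟩ := exists_sqrt (S p) hpos
    refine ⟨Z, hZn.trans (le_trans ?_ (le_max_left _ _)), ?_⟩
    · have := hC p (hd.trans (min_le_right _ _))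
      linarith
    · rw [hZ]
      simp only [S]
      linear_combination (-∑ i : Fin m, mixedEmbedding K (a i.succ : 𝓞 K) * (Mphi (p i)) ^ 2) * hβ1

/-- point of a box in a residue class -/
noncomputable def bx (q : ℕ) (R : ℝ) (p : Idx K → ℝ) (r : 𝓞 K) {N : ℕ} (i : Idx K → Fin N) : 𝓞 K :=
  r + (q : 𝓞 K) * el fun j => ⌈(R * p j - co r j) / q⌉ + ((i j : ℕ) : ℤ)

theorem bx_dvd (q : ℕ) (R : ℝ) (p : Idx K → ℝ) (r : 𝓞 K) {N : ℕ} (i : Idx K → Fin N) : (q : 𝓞 K) ∣ bx q R p r i - r :=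
  ⟨_, by rw [bx, add_sub_cancel_left]⟩

theorem bx_inj (q : ℕ) (hq : 0 < q) (R : ℝ) (p : Idx K → ℝ) (r : 𝓞 K) {N : ℕ} : Function.Injective (bx q R p r (N := N)) := by
  intro i i' h
  unfold bx at h
  have h1 := mul_left_cancel₀ (by exact_mod_cast hq.ne') (add_left_cancel h)
  have h2 := congrArg co h1
  rw [co_el, co_el] at h2
  funext j
  have h3 := congrFun h2 j
  apply Fin.ext
  simpa using h3

theorem bx_near (q : ℕ) (hq : 0 < q) (R : ℝ) (p : Idx K → ℝ) (r : 𝓞 K) {N : ℕ} (i : Idx K → Fin N) (j) :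
    |(co (bx q R p r i) j : ℝ) - R * p j| ≤ q * N := by
  have e : (co (bx q R p r i) j : ℝ) = co r j + q * (⌈(R * p j - co r j) / q⌉ + ((i j : ℕ) : ℝ)) := by
    rw [bx, co_add, co_natCast_mul, co_el]; push_cast; rfl
  have hq' : (0 : ℝ) < q := by exact_mod_cast hq
  have h1 := Int.le_ceil ((R * p j - co r j) / q)
  have h2 := Int.ceil_lt_add_one ((R * p j - co r j) / q)
  rw [div_le_iff₀ hq'] at h1
  have h2' : (⌈(R * p j - co r j) / q⌉ : ℝ) * q < R * p j - co r j + q := by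
    have := mul_lt_mul_of_pos_right h2 hq'
    rwa [add_mul, one_mul, div_mul_cancel₀ _ hq'.ne'] at this
  have h3 : ((i j : ℕ) : ℝ) + 1 ≤ N := by exact_mod_cast (i j).2
  have h4 : (0 : ℝ) ≤ ((i j : ℕ) : ℝ) := by positivity
  rw [e, abs_le]
  constructor <;> nlinarith

open scoped Classical in
theorem Mphi_bound (K : Type*) [Field K] [NumberField K] : ∃ L : ℝ, 0 ≤ L ∧
    (∀ (p : Idx K → ℝ) (c : ℝ), 0 ≤ c → (∀ j, |p j| ≤ c) → ‖Mphi p‖ ≤ L * c) ∧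
    (∀ (Z : mixedSpace K) (j), |Mphi.symm Z j| ≤ L * ‖Z‖) := by
  refine ⟨max ‖((Mphi (K := K)) : (Idx K → ℝ) →L[ℝ] mixedSpace K)‖ ‖((Mphi (K := K)).symm : mixedSpace K →L[ℝ] (Idx K → ℝ))‖, by positivity, ?_, ?_⟩
  · intro p c hc hp
    refine (ContinuousLinearMap.le_opNorm ((Mphi (K := K)) : (Idx K → ℝ) →L[ℝ] mixedSpace K) p).trans ?_
    exact mul_le_mul (le_max_left _ _) ((pi_norm_le_iff_of_nonneg hc).2 hp) (norm_nonneg _) (by positivity)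
  · intro Z j
    refine (norm_le_pi_norm (Mphi.symm Z) j).trans ?_
    refine (ContinuousLinearMap.le_opNorm ((Mphi (K := K)).symm : mixedSpace K →L[ℝ] (Idx K → ℝ)) Z).trans ?_
    exact mul_le_mul_of_nonneg_right (le_max_right _ _) (norm_nonneg _)

theorem floor_half {x : ℝ} (hx : 2 ≤ x) : x / 2 ≤ (⌊x⌋₊ : ℝ) := by
  have := Nat.lt_floor_add_one x
  linarith

theorem arch_count {m : ℕ} (a : Fin (m + 1) → 𝓞 K) (ha : ∀ i, a i ≠ 0) (hi : Indef a) :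
    ∃ κ C1 : ℝ, 0 < κ ∧ 0 ≤ C1 ∧ ∀ T : ℕ, 1 ≤ T → ∀ q : ℕ, 0 < q → ∃ R0 : ℝ, 1 ≤ R0 ∧ ∀ R, R0 ≤ R →
      ∀ r : Fin (m + 1) → 𝓞 K, ∃ X : Finset (Fin (m + 1) → 𝓞 K),
        (∀ x ∈ X, ∀ i, (q : 𝓞 K) ∣ x i - r i) ∧ (∀ x ∈ X, ∀ i j, |(co (x i) j : ℝ)| ≤ C1 * R) ∧
        (∀ x ∈ X, ∀ j, 2 * (T : ℝ) * |(co (qf a x) j : ℝ)| ≤ R ^ 2) ∧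
        κ * (R / q) ^ (Fintype.card (Idx K) * (m + 1)) * ((T : ℝ) ^ Fintype.card (Idx K))⁻¹ ≤ X.card := by
  classical
  obtain ⟨P, ρ, B, hρ, hρ1, hB, hPB, hsec⟩ := section_exists a ha hi
  obtain ⟨L, hL, hL1, hL2⟩ := Mphi_bound K
  set α := mixedEmbedding K (a 0 : 𝓞 K) with hα
  set A : ℝ := L * (‖α‖ * (L * (L + 2 * B))) with hA
  have hA0 : 0 ≤ A := by positivity
  set ρ0 : ℝ := 1 / (2 * (A + 1)) with hρ0
  have hρ00 : 0 < ρ0 := by positivity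
  have hρ01 : ρ0 ≤ 1 := by
    rw [hρ0, div_le_one (by positivity)]; linarith
  have hAρ : 2 * (A * ρ0) ≤ 1 := by
    rw [hρ0, mul_one_div, ← mul_div_assoc, div_le_one (by positivity)]; linarith
  set n := Fintype.card (Idx K) with hn
  refine ⟨(ρ / 2) ^ (n * m) * (ρ0 / 2) ^ n, 1 + B + L * B, by positivity, by positivity, fun T hT q hq => ?_⟩
  have hT' : (1 : ℝ) ≤ T := by exact_mod_cast hT
  have hq' : (0 : ℝ) < q := by exact_mod_cast hq
  refine ⟨max 1 (max (2 * q / ρ) (2 * (q * T) / ρ0)), le_max_left _ _, fun R hR r => ?_⟩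
  have hR1 : 1 ≤ R := (le_max_left _ _).trans hR
  have hR2 : 2 * q / ρ ≤ R := (le_max_left _ _).trans ((le_max_right _ _).trans hR)
  have hR3 : 2 * (q * T) / ρ0 ≤ R := (le_max_right _ _).trans ((le_max_right _ _).trans hR)
  have hRpos : 0 < R := by linarith
  set N1 := ⌊ρ * R / q⌋₊ with hN1
  set N0 := ⌊ρ0 * R / (q * T)⌋₊ with hN0
  have h1a : ρ * R / q / 2 ≤ N1 := by
    apply floor_half
    rw [le_div_iff₀ hq']
    rw [div_le_iff₀ hρ] at hR2
    linarith
  have h0a : ρ0 * R / (q * T) / 2 ≤ N0 := by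
    apply floor_half
    rw [le_div_iff₀ (by positivity)]
    rw [div_le_iff₀ hρ00] at hR3
    linarith
  have h1b : (q : ℝ) * N1 ≤ ρ * R := by
    have := Nat.floor_le (show 0 ≤ ρ * R / q by positivity)
    rw [le_div_iff₀ hq'] at this
    linarith
  have h0b : (q : ℝ) * N0 ≤ ρ0 * R / T := by
    have := Nat.floor_le (show 0 ≤ ρ0 * R / (q * T) by positivity)
    rw [le_div_iff₀ (by positivity)] at this
    rw [le_div_iff₀ (by positivity)]
    linarith
  let y : (Fin m → Idx K → Fin N1) → Fin m → 𝓞 K := fun k i => bx q R (P i) (r i.succ) (k i)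
  have hy : ∀ k i j, |(co (y k i) j : ℝ) - R * P i j| ≤ ρ * R := fun k i j => (bx_near q hq R _ _ _ j).trans h1b
  have hZ : ∀ k, ∃ Z : mixedSpace K, ‖Z‖ ≤ B ∧
        α * Z ^ 2 + ∑ i : Fin m, mixedEmbedding K (a i.succ : 𝓞 K) * (Mphi (fun j => (co (y k i) j : ℝ) / R)) ^ 2 = 0 := by
    intro k
    apply hsec
    intro i j
    have e : (co (y k i) j : ℝ) / R - P i j = ((co (y k i) j : ℝ) - R * P i j) / R := by field_simp
    rw [e, abs_div, abs_of_pos hRpos, div_le_iff₀ hRpos]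
    exact hy k i j
  choose Z hZB hZ using hZ
  let F : (Fin m → Idx K → Fin N1) × (Idx K → Fin N0) → Fin (m + 1) → 𝓞 K := fun k =>
    Fin.cons (bx q R (Mphi.symm (Z k.1)) (r 0) k.2) (y k.1)
  have hF0 : ∀ k, F k 0 = bx q R (Mphi.symm (Z k.1)) (r 0) k.2 := fun k => rfl
  have hFs : ∀ k i, F k (Fin.succ i) = y k.1 i := fun k i => rfl
  have hF0n : ∀ k j, |(co (F k 0) j : ℝ) - R * Mphi.symm (Z k.1) j| ≤ ρ0 * R / T := fun k j =>
    (bx_near q hq R _ _ _ j).trans h0b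
  have hρR : ρ0 * R / T ≤ R := by
    rw [div_le_iff₀ (by positivity)]
    exact mul_le_mul hρ01 le_rfl hRpos.le zero_le_one |>.trans (by nlinarith)
  have hFinj : Function.Injective F := by
    rintro ⟨k, k0⟩ ⟨l, l0⟩ h
    have hkl : k = l := by
      funext i
      have := congrFun h i.succ
      exact bx_inj q hq R _ _ this
    subst hkl
    have := congrFun h 0
    have h2 : k0 = l0 := bx_inj q hq R _ _ this
    rw [h2]
  refine ⟨Finset.univ.image F, ?_, ?_, ?_, ?_⟩
  · simp only [Finset.mem_image, Finset.mem_univ, true_and, forall_exists_index]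
    rintro x k rfl
    refine Fin.cases ?_ fun i => ?_
    · exact bx_dvd _ _ _ _ _
    · exact bx_dvd _ _ _ _ _
  · simp only [Finset.mem_image, Finset.mem_univ, true_and, forall_exists_index]
    rintro x k rfl
    refine Fin.cases (fun j => ?_) fun i j => ?_
    · have h1 := hF0n k j
      have h2 : |R * Mphi.symm (Z k.1) j| ≤ R * (L * B) := by
        rw [abs_mul, abs_of_pos hRpos]
        exact mul_le_mul_of_nonneg_left ((hL2 _ j).trans (mul_le_mul_of_nonneg_left (hZB _) hL)) hRpos.le
      have h3 := abs_sub_abs_le_abs_sub (co (F k 0) j : ℝ) (R * Mphi.symm (Z k.1) j)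
      nlinarith [mul_nonneg hB hRpos.le]
    · have h1 := hy k.1 i j
      rw [hFs]
      have h2 : |R * P i j| ≤ R * B := by
        rw [abs_mul, abs_of_pos hRpos]
        exact mul_le_mul_of_nonneg_left (hPB i j) hRpos.le
      have h3 := abs_sub_abs_le_abs_sub (co (y k.1 i) j : ℝ) (R * P i j)
      have h4 : ρ * R ≤ R := by nlinarith
      nlinarith [mul_nonneg (mul_nonneg hL hB) hRpos.le]
  · simp only [Finset.mem_image, Finset.mem_univ, true_and, forall_exists_index]
    rintro x k rfl j
    have hD : ‖mixedEmbedding K (F k 0 : 𝓞 K) - R • Z k.1‖ ≤ L * (ρ0 * R / T) := by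
      have e : mixedEmbedding K (F k 0 : 𝓞 K) - R • Z k.1 = Mphi (fun j => (co (F k 0) j : ℝ) - R * Mphi.symm (Z k.1) j) := by
        have : (fun j => (co (F k 0) j : ℝ) - R * Mphi.symm (Z k.1) j) = (fun j => (co (F k 0) j : ℝ)) - R • Mphi.symm (Z k.1) := rfl
        rw [this, map_sub, Mphi_co, map_smul, ContinuousLinearEquiv.apply_symm_apply]
      rw [e]
      exact hL1 _ _ (by positivity) (hF0n k)
    set D := mixedEmbedding K (F k 0 : 𝓞 K) - R • Z k.1 with hDd
    have hys : ∀ i, mixedEmbedding K (y k.1 i : 𝓞 K) = R • Mphi (fun j => (co (y k.1 i) j : ℝ) / R) := by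
      intro i
      rw [← map_smul, ← Mphi_co]
      congr 1
      funext j
      simp only [Pi.smul_apply, smul_eq_mul]
      field_simp
    have hq1 : mixedEmbedding K (qf a (F k) : 𝓞 K) = α * (D * (D + (2 * R) • Z k.1)) := by
      have e1 : mixedEmbedding K (qf a (F k) : 𝓞 K) = α * mixedEmbedding K (F k 0 : 𝓞 K) ^ 2 + ∑ i : Fin m, mixedEmbedding K (a i.succ : 𝓞 K) * mixedEmbedding K (y k.1 i : 𝓞 K) ^ 2 := by
        unfold qf
        rw [Fin.sum_univ_succ]
        simp only [map_add, map_sum, map_mul, map_pow, hα, hFs]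
      have e2 : ∑ i : Fin m, mixedEmbedding K (a i.succ : 𝓞 K) * mixedEmbedding K (y k.1 i : 𝓞 K) ^ 2 = (R ^ 2) • (- (α * Z k.1 ^ 2)) := by
        rw [← eq_neg_of_add_eq_zero_right (hZ k.1), Finset.smul_sum]
        refine Finset.sum_congr rfl fun i _ => ?_
        rw [hys, smul_pow, mul_smul_comm]
      have e3 : mixedEmbedding K (F k 0 : 𝓞 K) = D + R • Z k.1 := by rw [hDd]; ring
      rw [e1, e2, e3]
      simp only [Algebra.smul_def, map_pow, map_mul, map_ofNat]
      ring
    have hn1 : ‖mixedEmbedding K (qf a (F k) : 𝓞 K)‖ ≤ ‖α‖ * (L * (ρ0 * R / T) * (R * (L + 2 * B))) := by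
      rw [hq1]
      refine (norm_mul_le _ _).trans (mul_le_mul_of_nonneg_left ?_ (norm_nonneg _))
      refine (norm_mul_le _ _).trans (mul_le_mul hD ?_ (norm_nonneg _) (by positivity))
      refine (norm_add_le _ _).trans ?_
      have h1 : ‖(2 * R) • Z k.1‖ ≤ 2 * R * B := by
        rw [_root_.norm_smul, Real.norm_of_nonneg (by positivity)]
        exact mul_le_mul_of_nonneg_left (hZB _) (by positivity)
      have h2 : L * (ρ0 * R / T) ≤ L * R := mul_le_mul_of_nonneg_left hρR hL
      linarith
    have hc : |(co (qf a (F k)) j : ℝ)| ≤ L * (‖α‖ * (L * (ρ0 * R / T) * (R * (L + 2 * B)))) := by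
      have := hL2 (mixedEmbedding K (qf a (F k) : 𝓞 K)) j
      rw [← Mphi_co, ContinuousLinearEquiv.symm_apply_apply, Mphi_co] at this
      exact this.trans (mul_le_mul_of_nonneg_left hn1 hL)
    have e : L * (‖α‖ * (L * (ρ0 * R / T) * (R * (L + 2 * B)))) = A * ρ0 * R ^ 2 / T := by rw [hA]; ring
    rw [e, le_div_iff₀ (by positivity)] at hc
    nlinarith [sq_nonneg R]
  · rw [Finset.card_image_of_injective _ hFinj, Finset.card_univ, Fintype.card_prod]
    simp only [Fintype.card_fun, Fintype.card_fin, ← hn]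
    push_cast
    have h1 : (ρ * R / q / 2) ^ (n * m) ≤ ((N1 : ℝ) ^ n) ^ m := by
      rw [← pow_mul]; exact pow_le_pow_left₀ (by positivity) h1a _
    have h0 : (ρ0 * R / (q * T) / 2) ^ n ≤ (N0 : ℝ) ^ n := pow_le_pow_left₀ (by positivity) h0a _
    refine le_trans (le_of_eq ?_) (mul_le_mul h1 h0 (by positivity) (by positivity))
    rw [mul_add, mul_one, pow_add]
    have e1 : ρ * R / q / 2 = (ρ / 2) * (R / q) := by ring
    have e2 : ρ0 * R / (q * T) / 2 = (ρ0 / 2) * (R / q) * (T : ℝ)⁻¹ := by field_simp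
    rw [e1, e2, mul_pow, mul_pow, mul_pow, inv_pow]
    ring

end HM

end PartPJ

section PartPK
open NumberField Module MeasureTheory
open scoped ENNReal

namespace HM

variable {K : Type*} [Field K] [NumberField K]

theorem union_res {m : ℕ} (a : Fin m → 𝓞 K) (q : ℕ) (hq : 0 < q) (Bd : ℝ) (p : (Fin m → 𝓞 K) → Prop)
    (h : ∀ r : Fin m → 𝓞 K, ∃ X : Finset (Fin m → 𝓞 K), (∀ x ∈ X, ∀ i, (q : 𝓞 K) ∣ x i - r i) ∧ (∀ x ∈ X, p x) ∧ Bd ≤ X.card) :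
    ∃ X : Finset (Fin m → 𝓞 K), (∀ x ∈ X, p x) ∧ (∀ x ∈ X, (q : 𝓞 K) ∣ qf a x) ∧ Nat.card (Sol a q) * Bd ≤ X.card := by
  classical
  have hfin : Finite (𝓞 K ⧸ Ideal.span {(q : 𝓞 K)}) := finite_quot q hq.ne'
  have : Fintype (Sol a q) := Fintype.ofFinite _
  choose X h1 h2 h3 using h
  let rr : Sol a q → Fin m → 𝓞 K := fun s i => Quotient.out (s.1 i)
  have hrr : ∀ s i, Ideal.Quotient.mk (Ideal.span {(q : 𝓞 K)}) (rr s i) = s.1 i := fun s i => Quotient.out_eq _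
  have hx : ∀ s, ∀ x ∈ X (rr s), ∀ i, Ideal.Quotient.mk (Ideal.span {(q : 𝓞 K)}) (x i) = s.1 i := by
    intro s x hx i
    rw [← hrr, Ideal.Quotient.eq, Ideal.mem_span_singleton]
    exact h1 _ x hx i
  refine ⟨Finset.univ.biUnion fun s => X (rr s), ?_, ?_, ?_⟩
  · intro x hx
    obtain ⟨s, -, hs⟩ := Finset.mem_biUnion.1 hx
    exact h2 _ x hs
  · intro x hx'
    obtain ⟨s, -, hs⟩ := Finset.mem_biUnion.1 hx'
    rw [← Ideal.mem_span_singleton, ← Ideal.Quotient.eq_zero_iff_mem, qf, map_sum]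
    rw [← s.2]
    refine Finset.sum_congr rfl fun i _ => ?_
    rw [map_mul, map_pow, hx s x hs]
  · rw [Finset.card_biUnion]
    · push_cast
      rw [Nat.card_eq_fintype_card, ← nsmul_eq_mul, ← Finset.card_univ]
      exact Finset.card_nsmul_le_sum _ _ _ fun s _ => h3 _
    · intro s _ t _ hst
      refine Finset.disjoint_left.2 fun x hs ht => hst ?_
      apply Subtype.ext
      funext i
      rw [← hx s x hs i, ← hx t x ht i]

theorem WW_lower {m : ℕ} (R C1 : ℝ) (hR : 0 < R) (x : Fin m → 𝓞 K)
    (hx : ∀ i j, |(co (x i) j : ℝ)| ≤ C1 * R) :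
    Real.exp (-Real.pi * (Fintype.card (Idx K) * C1 ^ 2)) ^ m ≤ WW R x := by
  have : ∀ i, Real.exp (-Real.pi * (Fintype.card (Idx K) * C1 ^ 2)) ≤ wt R (x i) := by
    intro i
    unfold wt
    apply Real.exp_le_exp.2
    have h1 : ∑ j, (co (x i) j : ℝ) ^ 2 ≤ Fintype.card (Idx K) * (C1 * R) ^ 2 := by
      rw [← nsmul_eq_mul]
      exact Finset.sum_le_card_nsmul _ _ _ fun j _ => by
        rw [← sq_abs]; exact pow_le_pow_left₀ (abs_nonneg _) (hx i j) 2
    rw [le_div_iff₀ (by positivity)]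
    nlinarith [Real.pi_pos]
  have h := Finset.prod_le_prod (s := Finset.univ) (fun i _ => (Real.exp_pos _).le) (fun (i : Fin m) _ => this i)
  simpa [WW] using h

theorem isotropic_int {m : ℕ} (hm : 4 ≤ m) (a : Fin (m + 1) → 𝓞 K) (ha : ∀ i, a i ≠ 0) (hi : Indef a) :
    ∃ x, x ≠ 0 ∧ qf a x = 0 := by
  classical
  by_contra! hcon
  have haniso : ∀ x, qf a x = 0 → x = 0 := fun x hx => by
    by_contra h
    exact hcon x h hx
  obtain ⟨c, hc, hb⟩ := NN_bound K
  obtain ⟨C, hC, hweyl⟩ := FF_weyl a ha (by omega) c hc hb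
  obtain ⟨κ2, hκ2, hsing⟩ := sing_series (by omega) a ha
  obtain ⟨κ1, C1, hκ1, hC1, harch⟩ := arch_count a ha hi
  set n := Fintype.card (Idx K) with hn
  have hn1 : 1 ≤ n := Fintype.card_pos
  set w0 := Real.exp (-Real.pi * (n * C1 ^ 2)) ^ (m + 1) with hw0
  have hw0p : 0 < w0 := by positivity
  set κ := κ1 * κ2 * w0 * ((2 : ℝ) ^ n)⁻¹ with hκ
  have hκp : 0 < κ := by positivity
  obtain ⟨δ, hδ, hCδ⟩ := enn_small C (ENNReal.ofReal (κ / 2)) hC (by simpa using hκp)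
  obtain ⟨T0, T, hT, hminor⟩ := minor c hb δ hδ
  obtain ⟨q, hq, hT0q, hsol⟩ := hsing T0.factorial T0.factorial_ne_zero
  obtain ⟨R0, hR0, hX⟩ := harch T hT q hq
  have hT' : (1 : ℝ) ≤ T := by exact_mod_cast hT
  have hq' : (1 : ℝ) ≤ q := by exact_mod_cast hq
  -- choose H
  set M : ℝ := max R0 ((2 * (1 + C.toReal) / κ) ^ 2 + 1) with hM
  have hM1 : 1 ≤ M := hR0.trans (le_max_left _ _)
  set H : ℕ := ⌈M ^ 2⌉₊ with hH
  have hHM : M ^ 2 ≤ H := Nat.le_ceil _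
  have hHr : (0 : ℝ) < H := by nlinarith
  have hHp : 0 < H := by exact_mod_cast hHr
  set R := Real.sqrt (T * q * H) with hR
  have hRsq : R ^ 2 = T * q * H := Real.sq_sqrt (by positivity)
  have hMR : M ≤ R := by
    apply Real.le_sqrt_of_sq_le
    refine hHM.trans ?_
    have : 1 ≤ (T : ℝ) * q := one_le_mul_of_one_le_of_one_le hT' hq'
    nlinarith
  have hR1 : 1 ≤ R := hM1.trans hMR
  have hRp : 0 < R := by linarith
  obtain ⟨X, hXp, hXq, hXc⟩ := union_res a q hq (κ1 * (R / q) ^ (n * (m + 1)) * ((T : ℝ) ^ n)⁻¹)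
    (fun x => (∀ i j, |(co (x i) j : ℝ)| ≤ C1 * R) ∧ ∀ j, 2 * (T : ℝ) * |(co (qf a x) j : ℝ)| ≤ R ^ 2)
    (fun r => by
      obtain ⟨X, x1, x2, x3, x4⟩ := hX R ((le_max_left _ _).trans hMR) r
      exact ⟨X, x1, fun x hx => ⟨x2 x hx, x3 x hx⟩, x4⟩)
  have hlow := rep_lower a R hRp q H hHp X (fun x hx => by
    obtain ⟨y, hy⟩ := hXq x hx
    refine ⟨co y, by rw [el_co, hy], fun j => ?_⟩
    have h1 := (hXp x hx).2 j
    rw [hy, co_natCast_mul, hRsq] at h1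
    push_cast at h1
    rw [abs_mul, Nat.abs_cast] at h1
    have h2 : ((T : ℝ) * q) * (2 * |(co y j : ℝ)|) ≤ (T * q) * H := by linarith
    have h3 := le_of_mul_le_mul_left h2 (by positivity)
    exact_mod_cast h3)
  have hid := identity a R hRp haniso q H hHp
  have hsumW : w0 * X.card ≤ ∑ x ∈ X, WW R x := by
    rw [mul_comm, ← nsmul_eq_mul]
    exact Finset.card_nsmul_le_sum _ _ _ fun x hx => WW_lower R C1 hRp x (hXp x hx).1
  have hmain : κ * R ^ (n * (m - 1)) ≤ (∑ x ∈ X, WW R x) * ((2 * H : ℝ) ^ n)⁻¹ := by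
    have h1 : κ2 * (q : ℝ) ^ (n * m) * (κ1 * (R / q) ^ (n * (m + 1)) * ((T : ℝ) ^ n)⁻¹) ≤ X.card :=
      (mul_le_mul_of_nonneg_right hsol (by positivity)).trans hXc
    have h2 := mul_le_mul_of_nonneg_right ((mul_le_mul_of_nonneg_left h1 hw0p.le).trans hsumW)
      (show 0 ≤ ((2 * H : ℝ) ^ n)⁻¹ by positivity)
    refine le_trans (le_of_eq ?_) h2
    obtain ⟨m', rfl⟩ : ∃ m', m = m' + 1 := ⟨m - 1, by omega⟩
    have e : R ^ (n * (m' + 1 + 1)) = R ^ (n * m') * (T * q * H) ^ n := by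
      rw [← hRsq, ← pow_mul, ← pow_add]; ring_nf
    have e2 : (q : ℝ) ^ (n * (m' + 1 + 1)) = q ^ (n * (m' + 1)) * q ^ n := by
      rw [← pow_add]; ring_nf
    rw [hκ, div_pow, e, e2, Nat.add_sub_cancel, mul_pow, mul_pow, mul_pow]
    field_simp
  have hintg : ∫⁻ ξ in cube K, ENNReal.ofReal (1 - Psi q H ξ) * ‖FF a R ξ‖ₑ ≤
      C * ENNReal.ofReal (R ^ n) ^ (((m + 1 : ℕ) : ℝ) - 5 / 2) * (1 + δ * ENNReal.ofReal (R ^ ((n : ℝ) / 2))) := by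
    have hfin : C * ENNReal.ofReal (R ^ n) ^ (((m + 1 : ℕ) : ℝ) - 5 / 2) ≠ ∞ := by
      refine ENNReal.mul_ne_top hC ?_
      exact ENNReal.rpow_ne_top_of_ne_zero (by simpa using by positivity) ENNReal.ofReal_ne_top
    calc _ ≤ ∫⁻ ξ in cube K, C * ENNReal.ofReal (R ^ n) ^ (((m + 1 : ℕ) : ℝ) - 5 / 2) * (ENNReal.ofReal (1 - Psi q H ξ) * NN c R ξ ^ (5 / 2 : ℝ)) := by
          refine lintegral_mono fun ξ => ?_
          refine (mul_le_mul_right (hweyl R hR1 ξ) _).trans (le_of_eq ?_)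
          ring
      _ = C * ENNReal.ofReal (R ^ n) ^ (((m + 1 : ℕ) : ℝ) - 5 / 2) * ∫⁻ ξ in cube K, (ENNReal.ofReal (1 - Psi q H ξ) * NN c R ξ ^ (5 / 2 : ℝ)) :=
          lintegral_const_mul' _ _ hfin
      _ ≤ _ := mul_le_mul_right (hminor q H hq hHp hT0q R hR1 hRsq) _
  have hfinal := (ENNReal.ofReal_le_ofReal (hmain.trans hlow)).trans (hid.trans (add_le_add_right hintg 1))
  -- real form
  set s : ℝ := (n : ℝ) * ((m : ℝ) - 3 / 2) with hs
  have es : ENNReal.ofReal (R ^ n) ^ (((m + 1 : ℕ) : ℝ) - 5 / 2) = ENNReal.ofReal (R ^ s) := by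
    have hmm : (4 : ℝ) ≤ m := by exact_mod_cast hm
    rw [ENNReal.ofReal_rpow_of_pos (by positivity), ← Real.rpow_natCast, ← Real.rpow_mul hRp.le]
    congr 2
    rw [hs]; push_cast; ring
  have hst : R ^ s * R ^ ((n : ℝ) / 2) = R ^ (n * (m - 1)) := by
    rw [← Real.rpow_add hRp, ← Real.rpow_natCast]
    congr 1
    rw [hs, Nat.cast_mul, Nat.cast_sub (by omega)]; push_cast; ring
  rw [es] at hfinal
  have hup : (1 : ℝ≥0∞) + C * ENNReal.ofReal (R ^ s) * (1 + δ * ENNReal.ofReal (R ^ ((n : ℝ) / 2))) ≤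
      ENNReal.ofReal (1 + C.toReal * R ^ s + κ / 2 * R ^ (n * (m - 1))) := by
    rw [ENNReal.ofReal_add (by positivity) (by positivity), ENNReal.ofReal_add (by positivity) (by positivity),
      ENNReal.ofReal_one, ENNReal.ofReal_mul (by positivity), ENNReal.ofReal_toReal hC, mul_add, mul_one, ← add_assoc]
    refine add_le_add_right ?_ _
    rw [← hst, ENNReal.ofReal_mul (by positivity), ENNReal.ofReal_mul (by positivity)]
    calc C * ENNReal.ofReal (R ^ s) * (δ * ENNReal.ofReal (R ^ ((n : ℝ) / 2))) = (C * δ) * (ENNReal.ofReal (R ^ s) * ENNReal.ofReal (R ^ ((n : ℝ) / 2))) := by ring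
      _ ≤ _ := mul_le_mul_left hCδ _
  have hreal := (ENNReal.ofReal_le_ofReal_iff (by positivity)).1 (hfinal.trans hup)
  rw [← hst] at hreal
  have hs0 : 0 ≤ s := by
    have hmm : (4 : ℝ) ≤ m := by exact_mod_cast hm
    rw [hs]; exact mul_nonneg (by positivity) (by linarith)
  have hRs : 1 ≤ R ^ s := Real.one_le_rpow hR1 hs0
  have hhalf : 2 * (1 + C.toReal) / κ < R ^ ((n : ℝ) / 2) := by
    have h1 : R ^ ((1 : ℝ) / 2) ≤ R ^ ((n : ℝ) / 2) := by
      apply Real.rpow_le_rpow_of_exponent_le hR1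
      have : (1 : ℝ) ≤ n := by exact_mod_cast hn1
      linarith
    refine lt_of_lt_of_le ?_ h1
    rw [← Real.sqrt_eq_rpow]
    apply Real.lt_sqrt_of_sq_lt
    have : (2 * (1 + C.toReal) / κ) ^ 2 + 1 ≤ R := (le_max_right _ _).trans hMR
    linarith
  rw [div_lt_iff₀ hκp] at hhalf
  have hCr : 0 ≤ C.toReal := ENNReal.toReal_nonneg
  nlinarith [mul_lt_mul_of_pos_left hhalf (show 0 < R ^ s by positivity)]

end HM

end PartPK

section PartPL

open NumberField

namespace HM

theorem int_scale {K : Type*} [Field K] [NumberField K] (a : K) (ha : a ≠ 0) :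
    ∃ (d : K) (b : 𝓞 K), d ≠ 0 ∧ b ≠ 0 ∧ (b : K) = a * d ^ 2 := by
  obtain ⟨x, y, hy, rfl⟩ := IsFractionRing.div_surjective (A := 𝓞 K) a
  have hy0 : y ≠ 0 := nonZeroDivisors.ne_zero hy
  have hyk : algebraMap (𝓞 K) K y ≠ 0 := by simpa using hy0
  have hx0 : x ≠ 0 := by
    rintro rfl
    simp at ha
  refine ⟨algebraMap (𝓞 K) K y, x * y, hyk, mul_ne_zero hx0 hy0, ?_⟩
  change algebraMap (𝓞 K) K (x * y) = _
  rw [map_mul]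
  field_simp

end HM

end PartPL

/-- Over a number field `K`, a diagonal quadratic form in at least five variables with
nonzero coefficients is anisotropic iff there is a real embedding of `K` at which all of
the coefficients become positive or all become negative. -/
theorem anisotropic_five_variables_iff_definite
    (K : Type*) [Field K] [NumberField K] (m : ℕ) (hm : 5 ≤ m)
    (a : Fin m → K) (ha : ∀ i, a i ≠ 0) :
    (¬ ∃ x : Fin m → K, x ≠ 0 ∧ (∑ i, a i * x i ^ 2) = 0) ↔
      (∃ σ : K →+* ℝ, (∀ i, 0 < σ (a i)) ∨ (∀ i, σ (a i) < 0)) := by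
  constructor
  · intro h
    by_contra hcon
    apply h
    obtain ⟨m, rfl⟩ : ∃ k, m = k + 1 := ⟨m - 1, by omega⟩
    choose d b hd hb hab using fun i => HM.int_scale (a i) (ha i)
    have hind : HM.Indef b := by
      intro σ hσ
      apply hcon
      have hs : ∀ i, σ (b i) = σ (a i) * σ (d i) ^ 2 := fun i => by rw [hab, map_mul, map_pow]
      have hp : ∀ i, 0 < σ (d i) ^ 2 := fun i => by
        have : σ (d i) ≠ 0 := by simpa using hd i
        positivity
      refine ⟨σ, hσ.imp (fun h i => ?_) (fun h i => ?_)⟩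
      · have := h i
        rw [hs] at this
        exact (pos_iff_pos_of_mul_pos this).2 (hp i)
      · have := h i
        rw [hs] at this
        by_contra! hge
        exact absurd this (not_lt.2 (mul_nonneg hge (hp i).le))
    obtain ⟨x, hx0, hx⟩ := HM.isotropic_int (by omega) b hb hind
    refine ⟨fun i => d i * x i, ?_, ?_⟩
    · intro h0
      apply hx0
      funext i
      have := congrFun h0 i
      have h2 := (mul_eq_zero.1 this).resolve_left (hd i)
      simpa using h2
    · have h1 : algebraMap (NumberField.RingOfIntegers K) K (HM.qf b x) = 0 := by rw [hx, map_zero]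
      rw [HM.qf, map_sum] at h1
      rw [← h1]
      refine Finset.sum_congr rfl fun i _ => ?_
      rw [map_mul, map_pow, show algebraMap (NumberField.RingOfIntegers K) K (b i) = a i * d i ^ 2 from hab i]
      change a i * (d i * algebraMap (NumberField.RingOfIntegers K) K (x i)) ^ 2 = _
      ring
  · rintro ⟨σ, hσ⟩ ⟨x, hx0, hx⟩
    apply hx0
    have h1 : ∑ i, σ (a i) * σ (x i) ^ 2 = 0 := by
      have := congrArg σ hx
      simpa using this
    have h2 : ∀ i, σ (a i) * σ (x i) ^ 2 = 0 := by
      rcases hσ with h | h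
      · have := (Finset.sum_eq_zero_iff_of_nonneg (fun i _ => mul_nonneg (h i).le (sq_nonneg (σ (x i))))).1 h1
        exact fun i => this i (Finset.mem_univ i)
      · have := (Finset.sum_eq_zero_iff_of_nonpos (fun i _ => mul_nonpos_of_nonpos_of_nonneg (h i).le (sq_nonneg (σ (x i))))).1 h1
        exact fun i => this i (Finset.mem_univ i)
    funext i
    have h3 : σ (a i) ≠ 0 := by simpa using ha i
    have h4 := (mul_eq_zero.1 (h2 i)).resolve_left h3
    simpa using h4
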